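/- For g ≥ 3, the maximal cells of the moduli space T_g^{trop,(3)} of 3-edge connected tropical trigonal curves of genus g are exactly those associated to weightless graphs (G, 0) with G = (G_T)^st the stabilization of a 3-ladder G_T constructed from a tree T with g vertices. Equivalently, a 3-edge connected trigonal graph of genus g is maximal with respect to trigonal contractions if and only if it is the stabilization of a 3-ladder over a tree with g vertices with weight function identically zero. -/

import Mathlib

open scoped Classical

/-!
Finite combinatorial (multi-)graphs, weighted graphs, harmonic morphisms of
graphs, stabilization, trigonal types and `3`-ladders.
-/

structure CGraph : Type 1 where
  V : Type
  E : Type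
  fV : Fintype V
  fE : Fintype E
  dV : DecidableEq V
  dE : DecidableEq E
  src : E → V
  tgt : E → V

attribute [instance] CGraph.fV CGraph.fE CGraph.dV CGraph.dE

namespace CGraph

def Incident (G : CGraph) (e : G.E) (v : G.V) : Prop :=
  G.src e = v ∨ G.tgt e = v

/-- Incidence multiplicity (a loop counts twice). -/
def incid (G : CGraph) (e : G.E) (v : G.V) : ℕ :=
  (if G.src e = v then 1 else 0) + (if G.tgt e = v then 1 else 0)

def valence (G : CGraph) (v : G.V) : ℕ := ∑ e : G.E, G.incid e v

def dSrc (G : CGraph) (x : G.E × Bool) : G.V := if x.2 then G.src x.1 else G.tgt x.1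
def dTgt (G : CGraph) (x : G.E × Bool) : G.V := if x.2 then G.tgt x.1 else G.src x.1

def IsWalk (G : CGraph) : List (G.E × Bool) → G.V → G.V → Prop
  | [], u, v => u = v
  | x :: xs, u, v => G.dSrc x = u ∧ IsWalk G xs (G.dTgt x) v

def Connected (G : CGraph) : Prop :=
  Nonempty G.V ∧ ∀ u v : G.V, ∃ L, IsWalk G L u v

def ThreeEdgeConnected (G : CGraph) : Prop :=
  ∀ S : Finset G.E, S.card ≤ 2 → ∀ u v : G.V,
    ∃ L, IsWalk G L u v ∧ ∀ x ∈ L, x.1 ∉ S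

def IsTree (G : CGraph) : Prop :=
  Connected G ∧ Fintype.card G.E + 1 = Fintype.card G.V

/-- A weightless graph is stable iff each vertex has valence at least `3`. -/
def IsStable0 (G : CGraph) : Prop := ∀ v : G.V, 3 ≤ valence G v

/-- The unordered pair of endpoints of an edge. -/
def endsOf (G : CGraph) (e : G.E) : Sym2 G.V := s(G.src e, G.tgt e)

end CGraph

/-- The genus of a weighted graph: first Betti number plus total weight. -/
def wgenus (G : CGraph) (w : G.V → ℕ) : ℕ :=
  Fintype.card G.E + 1 + (∑ v : G.V, w v) - Fintype.card G.V

/-- The weightless graph `G^w`, obtained by attaching `w v` loops at each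
vertex `v`. -/
def withLoops (G : CGraph) (w : G.V → ℕ) : CGraph where
  V := G.V
  E := G.E ⊕ Σ v : G.V, Fin (w v)
  fV := inferInstance
  fE := inferInstance
  dV := inferInstance
  dE := inferInstance
  src := fun e => match e with
    | Sum.inl e => G.src e
    | Sum.inr q => q.1
  tgt := fun e => match e with
    | Sum.inl e => G.tgt e
    | Sum.inr q => q.1

/-! ### Isomorphisms and stabilization -/

def sameEndsMapC (G H : CGraph) (f : G.V → H.V) (e : G.E) (e' : H.E) : Prop :=
  (f (G.src e) = H.src e' ∧ f (G.tgt e) = H.tgt e') ∨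
  (f (G.src e) = H.tgt e' ∧ f (G.tgt e) = H.src e')

structure CIso (G H : CGraph) where
  vEquiv : G.V ≃ H.V
  eEquiv : G.E ≃ H.E
  ends : ∀ e, sameEndsMapC G H (fun v => vEquiv v) e (eEquiv e)

/-- Bundled weighted graph. -/
structure WGraph : Type 1 where
  G : CGraph
  w : G.V → ℕ

/-- Isomorphism of weighted graphs. -/
def WGIso (X Y : WGraph) : Prop :=
  ∃ i : CIso X.G Y.G, ∀ v, Y.w (i.vEquiv v) = X.w v

def IsStableW (X : WGraph) : Prop :=
  ∀ v, X.w v = 0 → 3 ≤ CGraph.valence X.G v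

/-- Contraction of a leaf edge (removal of a valence-one vertex and its edge). -/
def LeafStep0 (G H : CGraph) : Prop :=
  ∃ (v₀ : G.V) (e₀ : G.E), CGraph.valence G v₀ = 1 ∧ CGraph.Incident G e₀ v₀ ∧
    ∃ (fv : H.V ≃ {v : G.V // v ≠ v₀}) (fe : H.E ≃ {e : G.E // e ≠ e₀}),
      ∀ e : H.E, sameEndsMapC H G (fun v => (fv v).1) e (fe e).1

/-- Suppression of a valence-two vertex (contraction of one of its edges). -/
def SeriesStep0 (G H : CGraph) : Prop :=
  ∃ (v₀ : G.V) (e₁ e₂ : G.E) (u₁ u₂ : G.V),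
    e₁ ≠ e₂ ∧ CGraph.valence G v₀ = 2 ∧ u₁ ≠ v₀ ∧ u₂ ≠ v₀ ∧
    ({G.src e₁, G.tgt e₁} : Set G.V) = {v₀, u₁} ∧
    ({G.src e₂, G.tgt e₂} : Set G.V) = {v₀, u₂} ∧
    ∃ (fv : H.V ≃ {v : G.V // v ≠ v₀}) (ebar : H.E)
      (fe : {e : H.E // e ≠ ebar} ≃ {e : G.E // e ≠ e₁ ∧ e ≠ e₂}),
      ({(fv (H.src ebar)).1, (fv (H.tgt ebar)).1} : Set G.V) = {u₁, u₂} ∧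
      ∀ e : {e : H.E // e ≠ ebar}, sameEndsMapC H G (fun v => (fv v).1) e.1 (fe e).1

def Step0 (G H : CGraph) : Prop :=
  LeafStep0 G H ∨ SeriesStep0 G H ∨ Nonempty (CIso G H)

/-- `G` stabilizes to `H` (weightless stabilization: iteratively contract
leaves and suppress valence-two vertices). -/
def StabReduces0 (G H : CGraph) : Prop := Relation.ReflTransGen Step0 G H

/-! ### Harmonic morphisms of graphs -/

structure CMorphism (G T : CGraph) where
  vMap : G.V → T.V
  eMap : G.E → T.E ⊕ T.V
  mu : G.E → ℕ
  mu_zero : ∀ e, mu e = 0 ↔ ∃ v', eMap e = Sum.inr v'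
  contract_ok : ∀ e v', eMap e = Sum.inr v' →
    vMap (G.src e) = v' ∧ vMap (G.tgt e) = v'
  edge_ok : ∀ e e', eMap e = Sum.inl e' → sameEndsMapC G T vMap e e'

namespace CMorphism

variable {G T : CGraph}

noncomputable def locDeg (φ : CMorphism G T) (v : G.V) (e' : T.E) : ℕ :=
  ∑ e : G.E, if φ.eMap e = Sum.inl e' then φ.mu e * CGraph.incid G e v else 0

def Harmonic (φ : CMorphism G T) : Prop :=
  ∀ (v : G.V) (e₁ e₂ : T.E),
    CGraph.Incident T e₁ (φ.vMap v) → CGraph.Incident T e₂ (φ.vMap v) →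
      locDeg φ v e₁ = locDeg φ v e₂

def Nondegenerate (φ : CMorphism G T) : Prop :=
  ∀ v : G.V, ∃ e' : T.E, CGraph.Incident T e' (φ.vMap v) ∧ 1 ≤ locDeg φ v e'

def HasDegree (φ : CMorphism G T) (d : ℕ) : Prop :=
  ∀ e' : T.E, (∑ e : G.E, if φ.eMap e = Sum.inl e' then φ.mu e else 0) = d

/-- The local degree `m_φ(v)` at a vertex. -/
noncomputable def mVal (φ : CMorphism G T) (v : G.V) : ℕ :=
  (Finset.univ.filter fun e' : T.E => CGraph.Incident T e' (φ.vMap v)).sup (locDeg φ v)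

end CMorphism

/-- The class of an edge for the equivalence relation `∼_φ`: two edges are
equivalent iff they map to the same edge of the target; a contracted edge is
alone in its class. -/
def classMap {G T : CGraph} (φ : CMorphism G T) (e : G.E) : T.E ⊕ G.E :=
  match φ.eMap e with
  | Sum.inl e' => Sum.inl e'
  | Sum.inr _ => Sum.inr e

/-- `S` is a union of equivalence classes of `∼_φ`. -/
def ClassClosed {G T : CGraph} (φ : CMorphism G T) (S : Set G.E) : Prop :=
  ∀ e₁ e₂, classMap φ e₁ = classMap φ e₂ → (e₁ ∈ S ↔ e₂ ∈ S)

/-- The number of equivalence classes of `∼_φ` on the edges of the source. -/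
noncomputable def numClasses {G T : CGraph} (φ : CMorphism G T) : ℕ :=
  (Finset.univ.image (classMap φ)).card

/-! ### Weighted contractions -/

/-- Two vertices are joined by edges of `S`. -/
def SReach (G : CGraph) (S : Set G.E) (a b : G.V) : Prop :=
  Relation.ReflTransGen
    (fun u v => ∃ e ∈ S, (G.src e = u ∧ G.tgt e = v) ∨ (G.src e = v ∧ G.tgt e = u))
    a b

/-- Data exhibiting `H` as the contraction of the edge set `S` in `G`. -/
structure ContractionData (G : CGraph) (S : Set G.E) (H : CGraph) where
  c : G.V → H.V
  fe : H.E ≃ {e : G.E // e ∉ S}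
  surj : Function.Surjective c
  ends : ∀ e : H.E,
    (H.src e = c (G.src (fe e).1) ∧ H.tgt e = c (G.tgt (fe e).1)) ∨
    (H.src e = c (G.tgt (fe e).1) ∧ H.tgt e = c (G.src (fe e).1))
  fibers : ∀ u v : G.V, c u = c v ↔ SReach G S u v

/-- The weights of the weighted contraction: the sum of the weights in a fiber
plus the first Betti number of the contracted piece. -/
noncomputable def contractedWeight {G : CGraph} {S : Set G.E} {H : CGraph}
    (cd : ContractionData G S H) (w : G.V → ℕ) : H.V → ℕ :=
  fun v' => (∑ u ∈ Finset.univ.filter (fun u => cd.c u = v'), w u) +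
    ((Finset.univ.filter fun e : G.E => e ∈ S ∧ cd.c (G.src e) = v').card + 1
      - (Finset.univ.filter fun u : G.V => cd.c u = v').card)

/-! ### Trigonal types -/

/-- A `3`-edge connected trigonal type: a `3`-edge connected stable weighted
graph `(G, w)` together with a non-degenerate harmonic morphism of degree `3`
from a graph `Gphi` with `(Gphi)^st = G^w` onto a tree, such that the preimage
of every vertex of the tree contains a vertex of `G`. -/
structure TrigonalType : Type 1 where
  G : CGraph
  w : G.V → ℕ
  stable : ∀ v, w v = 0 → 3 ≤ CGraph.valence G v
  conn : CGraph.Connected G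
  threeEC : CGraph.ThreeEdgeConnected G
  Gphi : CGraph
  connphi : CGraph.Connected Gphi
  T : CGraph
  treeT : CGraph.IsTree T
  phi : CMorphism Gphi T
  harm : CMorphism.Harmonic phi
  nondeg : CMorphism.Nondegenerate phi
  deg3 : CMorphism.HasDegree phi 3
  stab : StabReduces0 Gphi (withLoops G w)
  vG : G.V → Gphi.V
  vG_inj : Function.Injective vG
  cover : ∀ t : T.V, ∃ x : G.V, phi.vMap (vG x) = t

/-- `X` is a `3`-edge connected trigonal graph. -/
def IsTrigonalGraph (X : WGraph) : Prop :=
  ∃ 𝒯 : TrigonalType, WGIso ⟨𝒯.G, 𝒯.w⟩ X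

/-- `Y` is a trigonal contraction of `X`: there are a trigonal type on `X`,
a `φ`-contraction of it, and a trigonal type on `Y` such that the contracted
graph and the new covering graph have a common stable model. -/
def TrigContraction (X Y : WGraph) : Prop :=
  ∃ 𝒯 : TrigonalType, WGIso ⟨𝒯.G, 𝒯.w⟩ X ∧
    ∃ S : Set 𝒯.Gphi.E, ClassClosed 𝒯.phi S ∧
      ∃ (H : CGraph) (cd : ContractionData 𝒯.Gphi S H)
        (𝒯' : TrigonalType) (K : CGraph),
        WGIso ⟨𝒯'.G, 𝒯'.w⟩ Y ∧ CGraph.IsStable0 K ∧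
        StabReduces0 (withLoops H (contractedWeight cd fun _ => 0)) K ∧
        StabReduces0 𝒯'.Gphi K

/-- A trigonal contraction contracting a single equivalence class of `∼_φ`. -/
def SingleClassContraction (X Y : WGraph) : Prop :=
  ∃ 𝒯 : TrigonalType, WGIso ⟨𝒯.G, 𝒯.w⟩ X ∧
    ∃ e₀ : 𝒯.Gphi.E,
      ∃ (H : CGraph)
        (cd : ContractionData 𝒯.Gphi {e | classMap 𝒯.phi e = classMap 𝒯.phi e₀} H)
        (𝒯' : TrigonalType) (K : CGraph),
        WGIso ⟨𝒯'.G, 𝒯'.w⟩ Y ∧ CGraph.IsStable0 K ∧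
        StabReduces0 (withLoops H (contractedWeight cd fun _ => 0)) K ∧
        StabReduces0 𝒯'.Gphi K

/-- A maximal `3`-edge connected trigonal graph: it is not a proper trigonal
contraction of any other trigonal graph. -/
def MaximalTrigonal (X : WGraph) : Prop :=
  IsTrigonalGraph X ∧
    ∀ Y : WGraph, IsTrigonalGraph Y → TrigContraction Y X → WGIso Y X

/-! ### `3`-ladders -/

/-- A witness that `H` is a `3`-ladder over the tree `T`: three disjoint
copies of `T`, one added edge joining two copies over each valence-two vertex,
two non-parallel added edges over each valence-one vertex, and the path
condition. -/
structure LadderWitness (T H : CGraph) : Type 1 where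
  treeT : CGraph.IsTree T
  maxval : ∀ v : T.V, CGraph.valence T v ≤ 3
  A : Type
  [fA : Fintype A]
  [dA : DecidableEq A]
  vEquiv : H.V ≃ T.V × Fin 3
  eEquiv : H.E ≃ (T.E × Fin 3) ⊕ A
  ends_copy : ∀ (e : T.E) (i : Fin 3),
    Sym2.map (fun v => vEquiv v) (CGraph.endsOf H (eEquiv.symm (Sum.inl (e, i)))) =
      s((T.src e, i), (T.tgt e, i))
  aVert : A → T.V
  aPair : A → Fin 3 × Fin 3
  aPair_ne : ∀ a, (aPair a).1 ≠ (aPair a).2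
  ends_add : ∀ a : A,
    Sym2.map (fun v => vEquiv v) (CGraph.endsOf H (eEquiv.symm (Sum.inr a))) =
      s((aVert a, (aPair a).1), (aVert a, (aPair a).2))
  count1 : ∀ v : T.V, CGraph.valence T v = 1 →
    (Finset.univ.filter fun a : A => aVert a = v).card = 2
  nonparallel : ∀ a b : A, a ≠ b → aVert a = aVert b →
    s((aPair a).1, (aPair a).2) ≠ s((aPair b).1, (aPair b).2)
  count2 : ∀ v : T.V, CGraph.valence T v = 2 →
    (Finset.univ.filter fun a : A => aVert a = v).card = 1
  count3 : ∀ v : T.V, CGraph.valence T v = 3 →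
    (Finset.univ.filter fun a : A => aVert a = v).card = 0
  pathCond : (∀ v : T.V, CGraph.valence T v ≤ 2) →
    2 ≤ (Finset.univ.filter fun v : T.V => CGraph.valence T v = 2).card →
    ¬ ∃ p : Sym2 (Fin 3), ∀ a : A, CGraph.valence T (aVert a) = 2 →
        s((aPair a).1, (aPair a).2) = p

attribute [instance] LadderWitness.fA LadderWitness.dA

/-- `φ` is the canonical degree-`3` harmonic morphism `φ_T : G_T → T` of a
`3`-ladder: it sends each copy of `T` to `T` with index `1` and contracts the
added edges. -/
def IsLadderMorphism {T H : CGraph} (L : LadderWitness T H) (φ : CMorphism H T) : Prop :=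
  (∀ v : H.V, φ.vMap v = (L.vEquiv v).1) ∧
  (∀ (e : T.E) (i : Fin 3),
    φ.eMap (L.eEquiv.symm (Sum.inl (e, i))) = Sum.inl e ∧
    φ.mu (L.eEquiv.symm (Sum.inl (e, i))) = 1) ∧
  (∀ a : L.A, φ.eMap (L.eEquiv.symm (Sum.inr a)) = Sum.inr (L.aVert a))

/-- `H` is a `3`-ladder over `T`. -/
def IsThreeLadder (T H : CGraph) : Prop := Nonempty (LadderWitness T H)

/-! ### Chain stabilizations and induced edge classes -/

/-- Data exhibiting `G` as the stabilization of `H` obtained by suppressing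
the valence-two vertices: each edge of `G` corresponds to a chain of edges
of `H`. -/
structure ChainStab (H G : CGraph) where
  rho : H.E → G.E
  iota : G.V → H.V
  inj : Function.Injective iota
  vert_char : ∀ v : H.V, (∃ u, iota u = v) ↔ 3 ≤ CGraph.valence H v
  min2 : ∀ v : H.V, 2 ≤ CGraph.valence H v
  chain : ∀ eb : G.E, ∃ Lw : List (H.E × Bool),
    CGraph.IsWalk H Lw (iota (G.src eb)) (iota (G.tgt eb)) ∧ Lw ≠ [] ∧
    (Lw.map Prod.fst).Nodup ∧ ∀ h : H.E, rho h = eb ↔ h ∈ Lw.map Prod.fst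

/-- The number of classes of the equivalence relation induced on the edges of
the stabilization `G`: two edges of `G` are identified if their chains contain
`∼_φ`-equivalent edges of `H`. -/
noncomputable def inducedClassCount {H T G : CGraph} (φ : CMorphism H T)
    (cs : ChainStab H G) : ℕ :=
  Nat.card (Quot fun e₁ e₂ : G.E =>
    ∃ h₁ h₂ : H.E, cs.rho h₁ = e₁ ∧ cs.rho h₂ = e₂ ∧ classMap φ h₁ = classMap φ h₂)

/-! ### Cells, dimension and the local Riemann–Hurwitz condition -/

/-- A trigonal type together with a tracking of the edges of the covering
graph inside the edges of the underlying trigonal graph; its dimension is the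
number of classes `|E(G)/≤_φ|` of the cone `τ_{(G,w,φ)}`. -/
structure TrackedType : Type 1 where
  base : TrigonalType
  track : base.Gphi.E → Option base.G.E
  track_surj : ∀ eb : base.G.E, ∃ h, track h = some eb

/-- The dimension `|E(G)/≤_φ|` of the cone associated to a tracked trigonal
type. -/
noncomputable def TrackedType.dim (X : TrackedType) : ℕ :=
  Nat.card (Quot fun e₁ e₂ : X.base.G.E =>
    ∃ h₁ h₂ : X.base.Gphi.E, X.track h₁ = some e₁ ∧ X.track h₂ = some e₂ ∧
      classMap X.base.phi h₁ = classMap X.base.phi h₂)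

/-- Two maximal cells share a common codimension-one face, obtained by
contracting a single equivalence class of edges. -/
def AdjacentCells (X Y : WGraph) : Prop :=
  ∃ Z : WGraph, SingleClassContraction X Z ∧ SingleClassContraction Y Z

/-- The local Riemann–Hurwitz equation
`2 − 2 w(v) = m_φ(v) (2 − 2 w'(φ(v))) − Σ_{e ∈ E_v} (μ_φ(e) − 1)`. -/
def LocalRH {G T : CGraph} (φ : CMorphism G T) (wG : G.V → ℕ) (wT : T.V → ℕ) : Prop :=
  ∀ v : G.V, (2 : ℤ) - 2 * (wG v : ℤ) =
    (CMorphism.mVal φ v : ℤ) * (2 - 2 * (wT (φ.vMap v) : ℤ)) -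
      ∑ e : G.E, (CGraph.incid G e v : ℤ) * ((φ.mu e : ℤ) - 1)


namespace TL

/-! ### Basic cut calculus -/

def Crs (G : CGraph) (W : Set G.V) (e : G.E) : Prop := ¬ (G.src e ∈ W ↔ G.tgt e ∈ W)

def Sat (G : CGraph) (S : Set G.E) (W : Set G.V) : Prop :=
  ∀ e ∈ S, (G.src e ∈ W ↔ G.tgt e ∈ W)

noncomputable def dcut (G : CGraph) (W : Set G.V) : ℕ :=
  (Finset.univ.filter fun e : G.E => Crs G W e).card

theorem sat_sreach {G : CGraph} {S : Set G.E} {W : Set G.V} (hW : Sat G S W) {a b : G.V}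
    (h : SReach G S a b) : a ∈ W ↔ b ∈ W := by
  induction h with
  | refl => rfl
  | tail _ h2 ih =>
    obtain ⟨e, he, h3⟩ := h2
    have := hW e he
    rcases h3 with ⟨h3, h4⟩ | ⟨h3, h4⟩
    · rw [ih, ← h3, ← h4, this]
    · rw [ih, ← h3, ← h4, this]

theorem sreach_refl {G : CGraph} {S : Set G.E} (a : G.V) : SReach G S a a :=
  Relation.ReflTransGen.refl

theorem sreach_trans {G : CGraph} {S : Set G.E} {a b c : G.V} (h1 : SReach G S a b)
    (h2 : SReach G S b c) : SReach G S a c := Relation.ReflTransGen.trans h1 h2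

theorem sreach_edge {G : CGraph} {S : Set G.E} {e : G.E} (he : e ∈ S) :
    SReach G S (G.src e) (G.tgt e) :=
  Relation.ReflTransGen.single ⟨e, he, Or.inl ⟨rfl, rfl⟩⟩

theorem sreach_edge' {G : CGraph} {S : Set G.E} {e : G.E} (he : e ∈ S) :
    SReach G S (G.tgt e) (G.src e) :=
  Relation.ReflTransGen.single ⟨e, he, Or.inr ⟨rfl, rfl⟩⟩

theorem sreach_sat {G : CGraph} (S : Set G.E) (a : G.V) : Sat G S {b | SReach G S a b} :=
  fun _ he => ⟨fun h => sreach_trans h (sreach_edge he), fun h => sreach_trans h (sreach_edge' he)⟩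

theorem sreach_iff {G : CGraph} {S : Set G.E} {a b : G.V} :
    SReach G S a b ↔ ∀ W, Sat G S W → a ∈ W → b ∈ W :=
  ⟨fun h _ hW ha => (sat_sreach hW h).1 ha, fun h => h _ (sreach_sat S a) (sreach_refl a)⟩

theorem sat_compl {G : CGraph} {S : Set G.E} {W : Set G.V} (h : Sat G S W) : Sat G S Wᶜ :=
  fun e he => not_congr (h e he)

theorem sreach_symm {G : CGraph} {S : Set G.E} {a b : G.V} (h : SReach G S a b) :
    SReach G S b a :=
  (sat_sreach (sreach_sat S b) h).2 (sreach_refl b)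

theorem sreach_mono {G : CGraph} {S S' : Set G.E} (hS : S ⊆ S') {a b : G.V}
    (h : SReach G S a b) : SReach G S' a b :=
  sreach_iff.2 fun W hW ha => (sat_sreach (fun e he => hW e (hS he)) h).1 ha

theorem not_crs {G : CGraph} {W : Set G.V} {e : G.E} :
    ¬ Crs G W e ↔ (G.src e ∈ W ↔ G.tgt e ∈ W) := not_not

theorem crs_compl {G : CGraph} {W : Set G.V} {e : G.E} : Crs G Wᶜ e ↔ Crs G W e := by
  unfold Crs; simp only [Set.mem_compl_iff]; tauto

theorem dcut_compl {G : CGraph} (W : Set G.V) : dcut G Wᶜ = dcut G W := by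
  unfold dcut; simp only [crs_compl]

/-- walks versus reachability -/
theorem walk_sreach {G : CGraph} {S : Set G.E} :
    ∀ (L : List (G.E × Bool)) (u v : G.V), CGraph.IsWalk G L u v → (∀ x ∈ L, x.1 ∈ S) →
      SReach G S u v
  | [], u, v, h, _ => by
      have : u = v := h
      subst this; exact sreach_refl u
  | x :: xs, u, v, h, hS => by
      obtain ⟨h1, h2⟩ := h
      have h3 := walk_sreach xs _ _ h2 (fun y hy => hS y (List.mem_cons_of_mem _ hy))
      refine sreach_trans ?_ h3
      subst h1
      have hx := hS x List.mem_cons_self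
      rcases x with ⟨e, b⟩
      cases b
      · exact sreach_edge' hx
      · exact sreach_edge hx

theorem sreach_walk {G : CGraph} {S : Set G.E} {u v : G.V} (h : SReach G S u v) :
    ∃ L, CGraph.IsWalk G L u v ∧ ∀ x ∈ L, x.1 ∈ S := by
  induction h using Relation.ReflTransGen.head_induction_on with
  | refl => exact ⟨[], rfl, by simp⟩
  | head h1 _ ih =>
    obtain ⟨e, he, h3⟩ := h1
    obtain ⟨L, hL, hL2⟩ := ih
    rcases h3 with ⟨h3, h4⟩ | ⟨h3, h4⟩
    · refine ⟨(e, true) :: L, ⟨h3, ?_⟩, ?_⟩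
      · simpa [CGraph.dTgt, h4] using hL
      · intro x hx
        rcases List.mem_cons.1 hx with rfl | hx
        · exact he
        · exact hL2 x hx
    · refine ⟨(e, false) :: L, ⟨h4, ?_⟩, ?_⟩
      · simpa [CGraph.dTgt, h3] using hL
      · intro x hx
        rcases List.mem_cons.1 hx with rfl | hx
        · exact he
        · exact hL2 x hx

theorem conn_iff {G : CGraph} :
    CGraph.Connected G ↔ Nonempty G.V ∧ ∀ u v, SReach G Set.univ u v := by
  refine and_congr Iff.rfl (forall_congr' fun u => forall_congr' fun v => ?_)
  constructor
  · rintro ⟨L, hL⟩; exact walk_sreach L u v hL (by simp)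
  · intro h; obtain ⟨L, hL, _⟩ := sreach_walk h; exact ⟨L, hL⟩

theorem conn_cut {G : CGraph} (h : CGraph.Connected G) {W : Set G.V} {u v : G.V} (hu : u ∈ W)
    (hv : v ∉ W) : ∃ e, Crs G W e := by
  by_contra hc
  push Not at hc
  exact hv ((sat_sreach (S := Set.univ) (fun e _ => not_crs.1 (hc e))
    ((conn_iff.1 h).2 u v)).1 hu)

theorem conn_of_cut {G : CGraph} (h0 : Nonempty G.V)
    (h : ∀ (W : Set G.V) (u v : G.V), u ∈ W → v ∉ W → ∃ e, Crs G W e) :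
    CGraph.Connected G := by
  refine conn_iff.2 ⟨h0, fun u v => sreach_iff.2 fun W hW hu => ?_⟩
  by_contra hv
  obtain ⟨e, he⟩ := h W u v hu hv
  exact he (hW e trivial)

theorem tec_iff {G : CGraph} :
    CGraph.ThreeEdgeConnected G ↔
      ∀ (W : Set G.V) (u v : G.V), u ∈ W → v ∉ W → 3 ≤ dcut G W := by
  constructor
  · intro h W u v hu hv
    by_contra hc
    obtain ⟨L, hL, hL2⟩ := h (Finset.univ.filter fun e : G.E => Crs G W e)
      (by unfold dcut at hc; omega) u v
    have := walk_sreach (S := {e | ¬ Crs G W e}) L u v hL (by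
      intro x hx; have := hL2 x hx; simpa using this)
    exact hv ((sat_sreach (fun e he => not_crs.1 he) this).1 hu)
  · intro h S hS u v
    have : SReach G {e | e ∉ S} u v := by
      refine sreach_iff.2 fun W hW hu => ?_
      by_contra hv
      have h1 := h W u v hu hv
      have : (Finset.univ.filter fun e : G.E => Crs G W e) ⊆ S := by
        intro e he
        by_contra hc
        exact (Finset.mem_filter.1 he).2 (hW e hc)
      have := Finset.card_le_card this
      unfold dcut at h1
      omega
    exact sreach_walk this

/-- growth: a connected piece on `U` needs at least `|U| - 1` edges -/
theorem card_le_of_conn {G : CGraph} (U : Finset G.V) (F : Finset G.E)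
    (hF : ∀ e ∈ F, G.src e ∈ U ∧ G.tgt e ∈ U)
    (hc : ∀ (W : Set G.V), (∃ u ∈ U, u ∈ W) → (∃ v ∈ U, v ∉ W) → ∃ e ∈ F, Crs G W e)
    (hne : U.Nonempty) :
    U.card ≤ F.card + 1 := by
  have key : ∀ k, k + 1 ≤ U.card → ∃ (W : Finset G.V) (F' : Finset G.E), W ⊆ U ∧ F' ⊆ F ∧
      W.card = k + 1 ∧ F'.card = k ∧ ∀ e ∈ F', G.src e ∈ W ∧ G.tgt e ∈ W := by
    intro k
    induction k with
    | zero =>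
      intro _
      obtain ⟨u, hu⟩ := hne
      exact ⟨{u}, ∅, by simpa using hu, by simp, by simp, by simp, by simp⟩
    | succ k ih =>
      intro hk
      obtain ⟨W, F', h1, h2, h3, h4, h5⟩ := ih (by omega)
      obtain ⟨v, hv, hv2⟩ : ∃ v ∈ U, v ∉ W := by
        by_contra hcon
        push Not at hcon
        have := Finset.card_le_card (show U ⊆ W from hcon)
        omega
      obtain ⟨w, hw⟩ : W.Nonempty := by
        rw [← Finset.card_pos]; omega
      obtain ⟨e, he, hcr⟩ := hc (W : Set G.V) ⟨w, h1 hw, hw⟩ ⟨v, hv, hv2⟩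
      have heF : e ∉ F' := by
        intro h
        have := h5 e h
        exact hcr (by simp [this.1, this.2])
      have hh := hF e he
      unfold Crs at hcr
      simp only [Finset.mem_coe] at hcr
      by_cases hs : G.src e ∈ W
      · have ht : G.tgt e ∉ W := by tauto
        refine ⟨insert (G.tgt e) W, insert e F', ?_, ?_, ?_, ?_, ?_⟩
        · exact Finset.insert_subset hh.2 h1
        · exact Finset.insert_subset he h2
        · rw [Finset.card_insert_of_notMem ht, h3]
        · rw [Finset.card_insert_of_notMem heF, h4]
        · intro e' he'
          rcases Finset.mem_insert.1 he' with rfl | he'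
          · simp [hs]
          · have := h5 e' he'; simp [this.1, this.2]
      · have ht : G.tgt e ∈ W := by tauto
        refine ⟨insert (G.src e) W, insert e F', ?_, ?_, ?_, ?_, ?_⟩
        · exact Finset.insert_subset hh.1 h1
        · exact Finset.insert_subset he h2
        · rw [Finset.card_insert_of_notMem hs, h3]
        · rw [Finset.card_insert_of_notMem heF, h4]
        · intro e' he'
          rcases Finset.mem_insert.1 he' with rfl | he'
          · simp [ht]
          · have := h5 e' he'; simp [this.1, this.2]
  have hpos := Finset.card_pos.2 hne
  obtain ⟨W, F', h1, h2, h3, h4, h5⟩ := key (U.card - 1) (by omega)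
  have := Finset.card_le_card h2
  omega

theorem conn_card {G : CGraph} (h : CGraph.Connected G) :
    Fintype.card G.V ≤ Fintype.card G.E + 1 := by
  have := card_le_of_conn (G := G) Finset.univ Finset.univ (by simp)
    (by
      rintro W ⟨u, _, hu⟩ ⟨v, _, hv⟩
      obtain ⟨e, he⟩ := conn_cut h hu hv
      exact ⟨e, by simp, he⟩)
    (by obtain ⟨⟨x⟩, _⟩ := h; exact ⟨x, by simp⟩)
  simpa using this

/-! ### valences -/

theorem sum_incid {G : CGraph} (e : G.E) (W : Finset G.V) :
    ∑ v ∈ W, CGraph.incid G e v =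
      (if G.src e ∈ W then 1 else 0) + (if G.tgt e ∈ W then 1 else 0) := by
  unfold CGraph.incid
  rw [Finset.sum_add_distrib, Finset.sum_ite_eq, Finset.sum_ite_eq]

noncomputable def ein (G : CGraph) (W : Finset G.V) : ℕ :=
  (Finset.univ.filter fun e : G.E => G.src e ∈ W ∧ G.tgt e ∈ W).card

theorem handshake {G : CGraph} (W : Finset G.V) :
    ∑ v ∈ W, CGraph.valence G v = 2 * ein G W + dcut G (W : Set G.V) := by
  unfold CGraph.valence ein dcut
  rw [Finset.sum_comm, Finset.card_filter, Finset.card_filter, Finset.mul_sum,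
    ← Finset.sum_add_distrib]
  refine Finset.sum_congr rfl fun e _ => ?_
  rw [sum_incid]
  unfold Crs
  simp only [Finset.mem_coe]
  by_cases h1 : G.src e ∈ W <;> by_cases h2 : G.tgt e ∈ W <;> simp [h1, h2]

theorem sum_valence {G : CGraph} :
    ∑ v : G.V, CGraph.valence G v = 2 * Fintype.card G.E := by
  have := handshake (G := G) Finset.univ
  rw [this]
  simp [ein, dcut, Crs]

def Loopless (G : CGraph) : Prop := ∀ e : G.E, G.src e ≠ G.tgt e

def Betti (G : CGraph) (g : ℕ) : Prop := Fintype.card G.E + 1 = Fintype.card G.V + g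

theorem crs_single {G : CGraph} {v : G.V} {e : G.E} (h : Crs G {v} e) :
    CGraph.Incident G e v := by
  unfold Crs at h; unfold CGraph.Incident
  simp only [Set.mem_singleton_iff] at h
  tauto

theorem dcut_le_valence {G : CGraph} (v : G.V) : dcut G {v} ≤ CGraph.valence G v := by
  have := handshake (G := G) {v}
  simp only [Finset.sum_singleton, Finset.coe_singleton] at this
  omega

theorem valence_loopless {G : CGraph} (h : Loopless G) (v : G.V) :
    CGraph.valence G v = (Finset.univ.filter fun e : G.E => CGraph.Incident G e v).card := by
  unfold CGraph.valence
  rw [Finset.card_filter]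
  refine Finset.sum_congr rfl fun e _ => ?_
  have := h e
  unfold CGraph.incid CGraph.Incident
  by_cases h1 : G.src e = v <;> by_cases h2 : G.tgt e = v
  · exact absurd (h1.trans h2.symm) this
  · simp [h1, h2]
  · simp [h1, h2]
  · simp [h1, h2]

theorem incident_card_le_valence {G : CGraph} (v : G.V) :
    (Finset.univ.filter fun e : G.E => CGraph.Incident G e v).card ≤ CGraph.valence G v := by
  unfold CGraph.valence
  rw [Finset.card_filter]
  refine Finset.sum_le_sum fun e _ => ?_
  unfold CGraph.incid CGraph.Incident
  by_cases h1 : G.src e = v <;> by_cases h2 : G.tgt e = v <;> simp [h1, h2]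

/-- number of vertices of a stable graph -/
theorem stable_card {G : CGraph} {g : ℕ} (hs : CGraph.IsStable0 G) (hb : Betti G g) :
    Fintype.card G.V + 2 ≤ 2 * g := by
  have h1 := sum_valence (G := G)
  have h2 : ∑ v : G.V, 3 ≤ ∑ v : G.V, CGraph.valence G v := Finset.sum_le_sum fun v _ => hs v
  simp at h2
  unfold Betti at hb
  omega

theorem trivalent_card {G : CGraph} {g : ℕ} (hs : ∀ v, CGraph.valence G v = 3) (hb : Betti G g) :
    Fintype.card G.V + 2 = 2 * g := by
  have h1 := sum_valence (G := G)
  simp only [hs] at h1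
  simp at h1
  unfold Betti at hb
  omega

end TL


namespace TL

/-! ### contractions -/

theorem cd_crs {G H : CGraph} {S : Set G.E} (cd : ContractionData G S H) (W : Set H.V) (e : H.E) :
    Crs H W e ↔ Crs G (cd.c ⁻¹' W) (cd.fe e).1 := by
  unfold Crs
  rcases cd.ends e with ⟨h1, h2⟩ | ⟨h1, h2⟩ <;> simp only [h1, h2, Set.mem_preimage]
  tauto

theorem cd_S {G H : CGraph} {S : Set G.E} (cd : ContractionData G S H) {e : G.E} (he : e ∈ S) :
    cd.c (G.src e) = cd.c (G.tgt e) := (cd.fibers _ _).2 (sreach_edge he)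

theorem cd_crs_notin {G H : CGraph} {S : Set G.E} (cd : ContractionData G S H) {W : Set H.V}
    {e : G.E} (h : Crs G (cd.c ⁻¹' W) e) : e ∉ S := by
  intro he
  apply h
  simp only [Set.mem_preimage, cd_S cd he]

theorem cd_dcut {G H : CGraph} {S : Set G.E} (cd : ContractionData G S H) (W : Set H.V) :
    dcut H W = dcut G (cd.c ⁻¹' W) := by
  unfold dcut
  refine Finset.card_bij (fun e _ => (cd.fe e).1) ?_ ?_ ?_
  · intro e he
    simp only [Finset.mem_filter, Finset.mem_univ, true_and] at he ⊢
    exact (cd_crs cd W e).1 he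
  · intro a _ b _ h
    exact cd.fe.injective (Subtype.ext h)
  · intro e he
    simp only [Finset.mem_filter, Finset.mem_univ, true_and] at he
    refine ⟨cd.fe.symm ⟨e, cd_crs_notin cd he⟩, ?_, by simp⟩
    simp only [Finset.mem_filter, Finset.mem_univ, true_and]
    rw [cd_crs cd]
    simpa using he

theorem cd_conn {G H : CGraph} {S : Set G.E} (cd : ContractionData G S H)
    (h : CGraph.Connected G) : CGraph.Connected H := by
  refine conn_of_cut ?_ ?_
  · obtain ⟨⟨x⟩, _⟩ := h; exact ⟨cd.c x⟩
  · intro W u v hu hv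
    obtain ⟨u, rfl⟩ := cd.surj u
    obtain ⟨v, rfl⟩ := cd.surj v
    obtain ⟨e, he⟩ := conn_cut h (W := cd.c ⁻¹' W) (u := u) (v := v) hu hv
    refine ⟨cd.fe.symm ⟨e, cd_crs_notin cd he⟩, ?_⟩
    rw [cd_crs cd]
    simpa using he

theorem cd_sum {G H : CGraph} {S : Set G.E} (cd : ContractionData G S H) (f : G.E → ℕ) :
    ∑ e : H.E, f (cd.fe e).1 + ∑ e : G.E, (if e ∈ S then f e else 0) = ∑ e : G.E, f e := by
  have h1 : ∑ e : H.E, f (cd.fe e).1 = ∑ e : {e // e ∉ S}, f e.1 :=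
    Equiv.sum_comp cd.fe (fun e => f e.1)
  rw [h1]
  have h2 : ∑ e : {e // e ∉ S}, f e.1 = ∑ e : G.E, (if e ∈ S then 0 else f e) := by
    rw [← Finset.sum_subtype (Finset.univ.filter fun e => e ∉ S) (by simp) f,
      Finset.sum_filter]
    refine Finset.sum_congr rfl fun e _ => ?_
    by_cases h : e ∈ S <;> simp [h]
  rw [h2, ← Finset.sum_add_distrib]
  refine Finset.sum_congr rfl fun e _ => ?_
  by_cases h : e ∈ S <;> simp [h]

theorem cd_val {G H : CGraph} {S : Set G.E} (cd : ContractionData G S H) (y : H.V) :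
    CGraph.valence H y + ∑ e : G.E, (if e ∈ S then (if cd.c (G.src e) = y then 2 else 0) else 0)
      = ∑ v ∈ Finset.univ.filter (fun v => cd.c v = y), CGraph.valence G v := by
  unfold CGraph.valence
  rw [Finset.sum_comm]
  simp only [sum_incid, Finset.mem_filter, Finset.mem_univ, true_and]
  refine Eq.trans ?_ (cd_sum cd _)
  congr 1
  · refine Finset.sum_congr rfl fun e _ => ?_
    unfold CGraph.incid
    rcases cd.ends e with ⟨h1, h2⟩ | ⟨h1, h2⟩ <;> simp only [h1, h2]
    rw [add_comm]
  · refine Finset.sum_congr rfl fun e _ => ?_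
    by_cases h : e ∈ S
    · simp only [h, if_true, ← cd_S cd h]
      split_ifs <;> rfl
    · simp [h]

theorem cd_ein {G H : CGraph} {S : Set G.E} (cd : ContractionData G S H) (W : Finset H.V) :
    ein H W + (Finset.univ.filter fun e : G.E => e ∈ S ∧ cd.c (G.src e) ∈ W).card =
      ein G (Finset.univ.filter fun v => cd.c v ∈ W) := by
  unfold ein
  simp only [Finset.card_filter, Finset.mem_filter, Finset.mem_univ, true_and]
  refine Eq.trans ?_ (cd_sum cd _)
  congr 1
  · refine Finset.sum_congr rfl fun e _ => ?_
    rcases cd.ends e with ⟨h1, h2⟩ | ⟨h1, h2⟩ <;> simp only [h1, h2]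
    simp only [and_comm]
  · refine Finset.sum_congr rfl fun e _ => ?_
    by_cases h : e ∈ S
    · simp only [h, if_true, ← cd_S cd h, true_and, and_self]
    · simp [h]

/-- existence of contractions -/
theorem exists_cd (G : CGraph) (S : Set G.E) :
    ∃ H : CGraph, Nonempty (ContractionData G S H) := by
  let st : Setoid G.V := ⟨SReach G S, ⟨sreach_refl, sreach_symm, sreach_trans⟩⟩
  refine ⟨⟨Quotient st, {e : G.E // e ∉ S}, inferInstance, inferInstance, inferInstance,
    inferInstance, fun e => Quotient.mk st (G.src e.1), fun e => Quotient.mk st (G.tgt e.1)⟩,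
    ⟨⟨Quotient.mk st, Equiv.refl _, Quotient.mk_surjective, fun e => Or.inl ⟨rfl, rfl⟩, ?_⟩⟩⟩
  intro u v
  exact Quotient.eq (r := st)

/-! ### normalized steps -/

structure NStep (G H : CGraph) where
  v0 : G.V
  u0 : G.V
  e0 : G.E
  e2 : G.E
  hu : u0 ≠ v0
  he0 : (G.src e0 = v0 ∧ G.tgt e0 = u0) ∨ (G.src e0 = u0 ∧ G.tgt e0 = v0)
  he2 : G.src e2 ≠ G.tgt e2
  h2 : CGraph.Incident G e2 v0
  hinc : ∀ h, CGraph.Incident G h v0 → h = e0 ∨ h = e2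
  cd : ContractionData G {e0} H
  j : H.V → G.V
  cj : ∀ y, cd.c (j y) = y
  jv : ∀ y, j y ≠ v0
  jc : ∀ v, v ≠ v0 → j (cd.c v) = v
  cv0 : cd.c v0 = cd.c u0

theorem mk_nstep {G H : CGraph} (v0 u0 : G.V) (e0 e2 : G.E) (hu : u0 ≠ v0)
    (he0 : (G.src e0 = v0 ∧ G.tgt e0 = u0) ∨ (G.src e0 = u0 ∧ G.tgt e0 = v0))
    (he2 : G.src e2 ≠ G.tgt e2) (h2 : CGraph.Incident G e2 v0)
    (hinc : ∀ h, CGraph.Incident G h v0 → h = e0 ∨ h = e2)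
    (fv : H.V ≃ {v : G.V // v ≠ v0}) (fe : H.E ≃ {e : G.E // e ≠ e0})
    (ends : ∀ e : H.E,
      ((fv (H.src e)).1 = (if G.src (fe e).1 = v0 then u0 else G.src (fe e).1) ∧
        (fv (H.tgt e)).1 = (if G.tgt (fe e).1 = v0 then u0 else G.tgt (fe e).1)) ∨
      ((fv (H.src e)).1 = (if G.tgt (fe e).1 = v0 then u0 else G.tgt (fe e).1) ∧
        (fv (H.tgt e)).1 = (if G.src (fe e).1 = v0 then u0 else G.src (fe e).1))) :
    Nonempty (NStep G H) := by
  have hr : ∀ v, (if v = v0 then u0 else v) ≠ v0 := by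
    intro v; split_ifs with h
    · exact hu
    · exact h
  let r : G.V → {v : G.V // v ≠ v0} := fun v => ⟨if v = v0 then u0 else v, hr v⟩
  have hS : ∀ v, SReach G {e0} v (r v).1 := by
    intro v
    by_cases h : v = v0
    · have hrv : (r v).1 = u0 := by simp [r, h]
      rw [hrv, h]
      rcases he0 with ⟨h1, h2⟩ | ⟨h1, h2⟩
      · rw [← h1, ← h2]; exact sreach_edge rfl
      · rw [← h1, ← h2]; exact sreach_edge' rfl
    · have hrv : (r v).1 = v := by simp [r, h]
      rw [hrv]; exact sreach_refl v
  have hru : r v0 = r u0 := by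
    apply Subtype.ext; simp [r]
  refine ⟨⟨v0, u0, e0, e2, hu, he0, he2, h2, hinc,
    ⟨fun v => fv.symm (r v), fe.trans (Equiv.refl _), ?_, ?_, ?_⟩, fun y => (fv y).1, ?_, ?_, ?_, ?_⟩⟩
  · intro y
    refine ⟨(fv y).1, ?_⟩
    rw [Equiv.symm_apply_eq]
    apply Subtype.ext; simp [r, (fv y).2]
  · intro e
    rcases ends e with ⟨h1, h2⟩ | ⟨h1, h2⟩
    · left
      constructor
      · rw [Equiv.eq_symm_apply]; exact Subtype.ext h1
      · rw [Equiv.eq_symm_apply]; exact Subtype.ext h2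
    · right
      constructor
      · rw [Equiv.eq_symm_apply]; exact Subtype.ext h1
      · rw [Equiv.eq_symm_apply]; exact Subtype.ext h2
  · intro u v
    constructor
    · intro h
      have h' : r u = r v := fv.symm.injective h
      exact sreach_trans (hS u) (by rw [h']; exact sreach_symm (hS v))
    · intro h
      have hsat : Sat G {e0} {x | r u = r x} := by
        intro e he
        have he' : e = e0 := he
        subst he'
        simp only [Set.mem_ofPred_eq]
        rcases he0 with ⟨h1, h2⟩ | ⟨h1, h2⟩ <;> rw [h1, h2, hru]
      have : r u = r v := (sat_sreach hsat h).1 rfl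
      simp only [this]
  · intro y
    rw [Equiv.symm_apply_eq]
    apply Subtype.ext; simp [r, (fv y).2]
  · intro y; exact (fv y).2
  · intro v hv
    simp [r, hv]
  · simp only [hru]

theorem step_cases {G H : CGraph} (h : Step0 G H) :
    Nonempty (CIso G H) ∨ Nonempty (NStep G H) := by
  rcases h with h | h | h
  · right
    obtain ⟨v0, e0, hv, hi, fv, fe, ends⟩ := h
    have hnl : G.src e0 ≠ G.tgt e0 := by
      intro hl
      have h1 : CGraph.incid G e0 v0 ≤ CGraph.valence G v0 :=
        Finset.single_le_sum (f := fun e => CGraph.incid G e v0) (by simp) (Finset.mem_univ e0)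
      have h2 : CGraph.incid G e0 v0 = 2 := by
        unfold CGraph.incid
        rcases hi with hi | hi
        · simp [← hl, hi]
        · simp [hl, hi]
      omega
    have hoff : ∀ e, e ≠ e0 → G.src e ≠ v0 ∧ G.tgt e ≠ v0 := by
      intro e he
      have := ends (fe.symm ⟨e, he⟩)
      simp only [sameEndsMapC, Equiv.apply_symm_apply] at this
      rcases this with ⟨h1, h2⟩ | ⟨h1, h2⟩
      · exact ⟨h1 ▸ (fv _).2, h2 ▸ (fv _).2⟩
      · exact ⟨h2 ▸ (fv _).2, h1 ▸ (fv _).2⟩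
    have hends : ∀ e : H.E,
      ∀ u0, ((fv (H.src e)).1 = (if G.src (fe e).1 = v0 then u0 else G.src (fe e).1) ∧
        (fv (H.tgt e)).1 = (if G.tgt (fe e).1 = v0 then u0 else G.tgt (fe e).1)) ∨
      ((fv (H.src e)).1 = (if G.tgt (fe e).1 = v0 then u0 else G.tgt (fe e).1) ∧
        (fv (H.tgt e)).1 = (if G.src (fe e).1 = v0 then u0 else G.src (fe e).1)) := by
      intro e u0
      have := hoff (fe e).1 (fe e).2
      rw [if_neg this.1, if_neg this.2]
      exact ends e
    have hinc : ∀ h, CGraph.Incident G h v0 → h = e0 ∨ h = e0 := by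
      intro h hh
      by_contra hc
      have := hoff h (by tauto)
      rcases hh with hh | hh
      · exact this.1 hh
      · exact this.2 hh
    rcases hi with hi | hi
    · exact mk_nstep v0 (G.tgt e0) e0 e0 (by rw [← hi]; exact hnl.symm) (Or.inl ⟨hi, rfl⟩)
        hnl (Or.inl hi) hinc fv fe (fun e => hends e _)
    · exact mk_nstep v0 (G.src e0) e0 e0 (by rw [← hi]; exact hnl) (Or.inr ⟨rfl, hi⟩)
        hnl (Or.inr hi) hinc fv fe (fun e => hends e _)
  · right
    obtain ⟨v0, e1, e2, u1, u2, hne, hv, hu1, hu2, hs1, hs2, fv, ebar, fe, hb, ends⟩ := h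
    have pair : ∀ a b c d : G.V, ({a, b} : Set G.V) = {c, d} →
        (a = c ∧ b = d) ∨ (a = d ∧ b = c) := fun a b c d h => Set.pair_eq_pair_iff.1 h
    have hj1 := pair _ _ _ _ hs1
    have hj2 := pair _ _ _ _ hs2
    have hjb := pair _ _ _ _ hb
    have hoff : ∀ e, e ≠ e1 → e ≠ e2 → G.src e ≠ v0 ∧ G.tgt e ≠ v0 := by
      intro e he he'
      have := ends (fe.symm ⟨e, he, he'⟩)
      simp only [sameEndsMapC, Equiv.apply_symm_apply] at this
      rcases this with ⟨h1, h2⟩ | ⟨h1, h2⟩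
      · exact ⟨h1 ▸ (fv _).2, h2 ▸ (fv _).2⟩
      · exact ⟨h2 ▸ (fv _).2, h1 ▸ (fv _).2⟩
    let fe' : H.E ≃ {e : G.E // e ≠ e1} :=
      { toFun := fun h => if hh : h = ebar then ⟨e2, hne.symm⟩ else ⟨(fe ⟨h, hh⟩).1, (fe ⟨h, hh⟩).2.1⟩
        invFun := fun e => if hh : e.1 = e2 then ebar else (fe.symm ⟨e.1, e.2, hh⟩).1
        left_inv := by
          intro h
          by_cases hh : h = ebar
          · simp [hh]
          · simp [hh, (fe ⟨h, hh⟩).2.2]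
        right_inv := by
          intro e
          by_cases hh : e.1 = e2
          · apply Subtype.ext; simp [hh]
          · apply Subtype.ext; simp [hh, (fe.symm ⟨e.1, e.2, hh⟩).2] }
    refine mk_nstep v0 u1 e1 e2 hu1 hj1 ?_ ?_ ?_ fv fe' ?_
    · rcases hj2 with ⟨h1, h2⟩ | ⟨h1, h2⟩ <;> rw [h1, h2]
      · exact hu2.symm
      · exact hu2
    · rcases hj2 with ⟨h1, h2⟩ | ⟨h1, h2⟩
      · exact Or.inl h1
      · exact Or.inr h2
    · intro h hh
      by_contra hc
      have := hoff h (by tauto) (by tauto)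
      rcases hh with hh | hh
      · exact this.1 hh
      · exact this.2 hh
    · intro h
      by_cases hh : h = ebar
      · have : (fe' h).1 = e2 := by simp [fe', hh]
        rw [this, hh]
        rcases hj2 with ⟨h1, h2⟩ | ⟨h1, h2⟩ <;> rw [h1, h2] <;> simp only [if_true, if_neg hu2]
        · exact hjb
        · exact hjb.symm
      · have : (fe' h).1 = (fe ⟨h, hh⟩).1 := by simp [fe', hh]
        rw [this]
        have h3 := hoff _ (fe ⟨h, hh⟩).2.1 (fe ⟨h, hh⟩).2.2
        rw [if_neg h3.1, if_neg h3.2]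
        exact ends ⟨h, hh⟩
  · left; exact h

/-! isomorphisms as contractions -/

theorem iso_crs {G H : CGraph} (i : CIso G H) (W : Set H.V) (e : G.E) :
    Crs H W (i.eEquiv e) ↔ Crs G (i.vEquiv ⁻¹' W) e := by
  unfold Crs
  rcases i.ends e with ⟨h1, h2⟩ | ⟨h1, h2⟩ <;> simp only at h1 h2 <;>
    simp only [← h1, ← h2, Set.mem_preimage]
  tauto

def CIso.cd {G H : CGraph} (i : CIso G H) : ContractionData G ∅ H where
  c := i.vEquiv
  fe := i.eEquiv.symm.trans (Equiv.subtypeUnivEquiv (by simp)).symm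
  surj := i.vEquiv.surjective
  ends := by
    intro e
    have := i.ends (i.eEquiv.symm e)
    simp only [sameEndsMapC, Equiv.apply_symm_apply] at this
    simp only [Equiv.trans_apply]
    change (_ = i.vEquiv (G.src (i.eEquiv.symm e)) ∧ _ = i.vEquiv (G.tgt (i.eEquiv.symm e))) ∨
      (_ = i.vEquiv (G.tgt (i.eEquiv.symm e)) ∧ _ = i.vEquiv (G.src (i.eEquiv.symm e)))
    rcases this with ⟨h1, h2⟩ | ⟨h1, h2⟩
    · exact Or.inl ⟨h1.symm, h2.symm⟩
    · exact Or.inr ⟨h2.symm, h1.symm⟩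
  fibers := by
    intro u v
    constructor
    · intro h
      have : u = v := i.vEquiv.injective h
      subst this; exact sreach_refl u
    · intro h
      have := (sat_sreach (W := {x | u = x}) (by intro e he; exact he.elim) h).1 rfl
      have h3 : u = v := this
      rw [h3]

def CIso.symm {G H : CGraph} (i : CIso G H) : CIso H G where
  vEquiv := i.vEquiv.symm
  eEquiv := i.eEquiv.symm
  ends := by
    intro e
    have := i.ends (i.eEquiv.symm e)
    simp only [sameEndsMapC, Equiv.apply_symm_apply] at this ⊢
    rcases this with ⟨h1, h2⟩ | ⟨h1, h2⟩
    · left; rw [← h1, ← h2]; simp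
    · right; rw [← h1, ← h2]; simp

def CIso.trans {G H K : CGraph} (i : CIso G H) (j : CIso H K) : CIso G K where
  vEquiv := i.vEquiv.trans j.vEquiv
  eEquiv := i.eEquiv.trans j.eEquiv
  ends := by
    intro e
    have h1 := i.ends e
    have h2 := j.ends (i.eEquiv e)
    simp only [sameEndsMapC, Equiv.trans_apply] at h1 h2 ⊢
    rcases h1 with ⟨h1, h3⟩ | ⟨h1, h3⟩ <;> rw [h1, h3]
    · exact h2
    · rcases h2 with ⟨h2, h4⟩ | ⟨h2, h4⟩ <;> simp [h2, h4]

def CIso.refl (G : CGraph) : CIso G G where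
  vEquiv := Equiv.refl _
  eEquiv := Equiv.refl _
  ends := fun _ => Or.inl ⟨rfl, rfl⟩

theorem CIso.valence {G H : CGraph} (i : CIso G H) (v : G.V) :
    CGraph.valence H (i.vEquiv v) = CGraph.valence G v := by
  unfold CGraph.valence
  rw [← Equiv.sum_comp i.eEquiv]
  refine Finset.sum_congr rfl fun e _ => ?_
  unfold CGraph.incid
  rcases i.ends e with ⟨h1, h2⟩ | ⟨h1, h2⟩ <;> simp only at h1 h2 <;> rw [← h1, ← h2] <;> simp
  rw [add_comm]

theorem CIso.stable {G H : CGraph} (i : CIso G H) (h : CGraph.IsStable0 G) :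
    CGraph.IsStable0 H := by
  intro v
  obtain ⟨v, rfl⟩ := i.vEquiv.surjective v
  rw [CIso.valence]; exact h v

/-! counting -/

theorem nstep_card {G H : CGraph} (s : NStep G H) :
    Fintype.card H.V + 1 = Fintype.card G.V ∧ Fintype.card H.E + 1 = Fintype.card G.E := by
  constructor
  · let f : Option H.V → G.V := fun o => o.elim s.v0 s.j
    have hf : Function.Bijective f := by
      constructor
      · rintro (_ | a) (_ | b) h
        · rfl
        · exact absurd h.symm (s.jv b)
        · exact absurd h (s.jv a)
        · have : s.j a = s.j b := h
          rw [← s.cj a, ← s.cj b, this]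
      · intro v
        by_cases h : v = s.v0
        · exact ⟨none, h.symm⟩
        · exact ⟨some (s.cd.c v), s.jc v h⟩
    have := Fintype.card_of_bijective hf
    simpa using this
  · have := Fintype.card_congr s.cd.fe
    rw [this, Fintype.card_subtype_compl]
    simp
    have : 0 < Fintype.card G.E := Fintype.card_pos_iff.2 ⟨s.e0⟩
    omega

theorem step_conn {G H : CGraph} (h : Step0 G H) (hc : CGraph.Connected G) :
    CGraph.Connected H := by
  rcases step_cases h with ⟨⟨i⟩⟩ | ⟨⟨s⟩⟩
  · exact cd_conn (CIso.cd i) hc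
  · exact cd_conn s.cd hc

theorem step_betti {G H : CGraph} (h : Step0 G H) {g : ℕ} (hc : Betti G g) : Betti H g := by
  unfold Betti at *
  rcases step_cases h with ⟨⟨i⟩⟩ | ⟨⟨s⟩⟩
  · rw [← Fintype.card_congr i.vEquiv, ← Fintype.card_congr i.eEquiv]; exact hc
  · have := nstep_card s; omega

theorem nstep_val {G H : CGraph} (s : NStep G H) : CGraph.valence G s.v0 ≤ 2 := by
  have h0 : G.src s.e0 ≠ G.tgt s.e0 := by
    rcases s.he0 with ⟨h1, h2⟩ | ⟨h1, h2⟩ <;> rw [h1, h2]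
    · exact s.hu.symm
    · exact s.hu
  have h1 : ∀ e, G.src e ≠ G.tgt e → CGraph.incid G e s.v0 ≤ 1 := by
    intro e he
    unfold CGraph.incid
    by_cases h1 : G.src e = s.v0 <;> by_cases h2 : G.tgt e = s.v0
    · exact absurd (h1.trans h2.symm) he
    all_goals simp [h1, h2]
  unfold CGraph.valence
  calc ∑ e : G.E, CGraph.incid G e s.v0
      = ∑ e ∈ {s.e0, s.e2}, CGraph.incid G e s.v0 := by
        symm
        refine Finset.sum_subset (Finset.subset_univ _) ?_
        intro e _ he
        have : ¬ CGraph.Incident G e s.v0 := by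
          intro hh
          have := s.hinc e hh
          simp at he; tauto
        unfold CGraph.Incident at this
        unfold CGraph.incid
        simp only [if_neg (show ¬ G.src e = s.v0 by tauto), if_neg (show ¬ G.tgt e = s.v0 by tauto), Nat.add_zero]
    _ ≤ ∑ e ∈ ({s.e0, s.e2} : Finset G.E), 1 := by
        refine Finset.sum_le_sum ?_
        intro e he
        simp at he
        rcases he with rfl | rfl
        · exact h1 _ h0
        · exact h1 _ s.he2
    _ ≤ 2 := by simpa using Finset.card_le_two

theorem step_maxval {G H : CGraph} (h : Step0 G H) (hm : ∀ v, CGraph.valence G v ≤ 3) :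
    ∀ v, CGraph.valence H v ≤ 3 := by
  rcases step_cases h with ⟨⟨i⟩⟩ | ⟨⟨s⟩⟩
  · intro v
    obtain ⟨v, rfl⟩ := i.vEquiv.surjective v
    rw [CIso.valence]; exact hm v
  · intro y
    have h1 := cd_val s.cd y
    have hsub : (Finset.univ.filter fun v => s.cd.c v = y) ⊆
        (if s.cd.c s.v0 = y then {s.v0, s.j y} else {s.j y}) := by
      intro v hv
      simp at hv
      by_cases hvv : v = s.v0
      · subst hvv
        simp [hv]
      · have := s.jc v hvv
        rw [hv] at this
        split_ifs <;> simp [this]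
    have h2 := Finset.sum_le_sum_of_subset hsub (f := CGraph.valence G)
    have h3 := hm (s.j y)
    have h4 := nstep_val s
    split_ifs at h2 with hy
    · rw [Finset.sum_pair (s.jv y).symm] at h2
      have h5 : (∑ e : G.E, (if e ∈ ({s.e0} : Set G.E) then
          (if s.cd.c (G.src e) = y then 2 else 0) else 0)) = 2 := by
        rw [Finset.sum_eq_single s.e0]
        · have : s.cd.c (G.src s.e0) = y := by
            rcases s.he0 with ⟨h1, h2⟩ | ⟨h1, h2⟩ <;> rw [h1]
            · exact hy
            · rw [← s.cv0]; exact hy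
          simp [this]
        · intro b _ hb
          simp [hb]
        · simp
      have h6 : CGraph.valence H y + 2 = ∑ v with s.cd.c v = y, CGraph.valence G v := by rw [← h5]; convert h1
      omega
    · simp at h2
      omega

theorem red_conn {G H : CGraph} (h : StabReduces0 G H) (hc : CGraph.Connected G) :
    CGraph.Connected H := by
  induction h with
  | refl => exact hc
  | tail _ h2 ih => exact step_conn h2 ih

theorem red_betti {G H : CGraph} (h : StabReduces0 G H) {g : ℕ} (hc : Betti G g) :
    Betti H g := by
  induction h with
  | refl => exact hc
  | tail _ h2 ih => exact step_betti h2 ih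

theorem red_maxval {G H : CGraph} (h : StabReduces0 G H) (hc : ∀ v, CGraph.valence G v ≤ 3) :
    ∀ v, CGraph.valence H v ≤ 3 := by
  induction h with
  | refl => exact hc
  | tail _ h2 ih => exact step_maxval h2 ih

theorem red_iso {G H K : CGraph} (h : StabReduces0 G H) (i : CIso H K) : StabReduces0 G K :=
  h.tail (Or.inr (Or.inr ⟨i⟩))

theorem iso_red {G H K : CGraph} (i : CIso G H) (h : StabReduces0 H K) : StabReduces0 G K :=
  Relation.ReflTransGen.head (Or.inr (Or.inr ⟨i⟩)) h

end TL


namespace TL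

/-! ### existence of stable models -/

theorem other_end {G : CGraph} {e : G.E} {v : G.V} (hi : CGraph.Incident G e v)
    (hl : G.src e ≠ G.tgt e) :
    ∃ u, u ≠ v ∧ ((G.src e = v ∧ G.tgt e = u) ∨ (G.src e = u ∧ G.tgt e = v)) := by
  rcases hi with hi | hi
  · exact ⟨G.tgt e, by rw [← hi]; exact hl.symm, Or.inl ⟨hi, rfl⟩⟩
  · exact ⟨G.src e, by rw [← hi]; exact hl, Or.inr ⟨rfl, hi⟩⟩

/-- deleting a leaf -/
theorem exists_leafstep {G : CGraph} {v : G.V} {e : G.E} (hv : CGraph.valence G v = 1)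
    (hi : CGraph.Incident G e v) (honly : ∀ h, CGraph.Incident G h v → h = e) :
    ∃ H, LeafStep0 G H ∨ SeriesStep0 G H := by
  have hs : ∀ h, h ≠ e → G.src h ≠ v := fun h hh hc => hh (honly h (Or.inl hc))
  have ht : ∀ h, h ≠ e → G.tgt h ≠ v := fun h hh hc => hh (honly h (Or.inr hc))
  refine ⟨⟨{x : G.V // x ≠ v}, {h : G.E // h ≠ e}, inferInstance, inferInstance, inferInstance,
    inferInstance, fun h => ⟨G.src h.1, hs h.1 h.2⟩, fun h => ⟨G.tgt h.1, ht h.1 h.2⟩⟩, Or.inl ?_⟩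
  exact ⟨v, e, hv, hi, Equiv.refl _, Equiv.refl _, fun h => Or.inl ⟨rfl, rfl⟩⟩

theorem exists_seriesstep {G : CGraph} {v u1 u2 : G.V} {e1 e2 : G.E} (hne : e1 ≠ e2)
    (hv : CGraph.valence G v = 2) (hu1 : u1 ≠ v) (hu2 : u2 ≠ v)
    (h1 : (G.src e1 = v ∧ G.tgt e1 = u1) ∨ (G.src e1 = u1 ∧ G.tgt e1 = v))
    (h2 : (G.src e2 = v ∧ G.tgt e2 = u2) ∨ (G.src e2 = u2 ∧ G.tgt e2 = v))
    (honly : ∀ h, CGraph.Incident G h v → h = e1 ∨ h = e2) :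
    ∃ H, LeafStep0 G H ∨ SeriesStep0 G H := by
  have hs : ∀ h, h ≠ e1 ∧ h ≠ e2 → G.src h ≠ v := fun h hh hc => by
    have := honly h (Or.inl hc); tauto
  have ht : ∀ h, h ≠ e1 ∧ h ≠ e2 → G.tgt h ≠ v := fun h hh hc => by
    have := honly h (Or.inr hc); tauto
  refine ⟨⟨{x : G.V // x ≠ v}, Option {h : G.E // h ≠ e1 ∧ h ≠ e2}, inferInstance, inferInstance,
    inferInstance, inferInstance,
    fun h => h.elim ⟨u1, hu1⟩ (fun h => ⟨G.src h.1, hs h.1 h.2⟩),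
    fun h => h.elim ⟨u2, hu2⟩ (fun h => ⟨G.tgt h.1, ht h.1 h.2⟩)⟩, Or.inr ?_⟩
  refine ⟨v, e1, e2, u1, u2, hne, hv, hu1, hu2, ?_, ?_, Equiv.refl _, none,
    ⟨fun o => o.1.get (Option.isSome_iff_ne_none.2 o.2), fun x => ⟨some x, by simp⟩,
      fun o => by simp, fun x => by simp⟩, rfl, ?_⟩
  · rcases h1 with ⟨h1, h2⟩ | ⟨h1, h2⟩ <;> rw [h1, h2]
    exact Set.pair_comm _ _
  · rcases h2 with ⟨h1, h2⟩ | ⟨h1, h2⟩ <;> rw [h1, h2]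
    exact Set.pair_comm _ _
  · rintro ⟨o, ho⟩
    cases o with
    | none => exact absurd rfl ho
    | some x => exact Or.inl ⟨rfl, rfl⟩

theorem incid_zero {G : CGraph} {e : G.E} {v : G.V} :
    CGraph.incid G e v = 0 ↔ ¬ CGraph.Incident G e v := by
  unfold CGraph.incid CGraph.Incident
  by_cases h1 : G.src e = v <;> by_cases h2 : G.tgt e = v <;> simp [h1, h2]

theorem exists_step {G : CGraph} {g : ℕ} (hc : CGraph.Connected G) (hb : Betti G g) (hg : 2 ≤ g)
    {v : G.V} (hv : CGraph.valence G v ≤ 2) : ∃ H, LeafStep0 G H ∨ SeriesStep0 G H := by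
  -- two vertices or more edges
  have hI := incident_card_le_valence (G := G) v
  -- no loop at v
  have hloop : ∀ e, CGraph.Incident G e v → G.src e ≠ G.tgt e := by
    intro e hi hl
    have h2 : CGraph.incid G e v = 2 := by
      unfold CGraph.incid
      rcases hi with hi | hi
      · simp [← hl, hi]
      · simp [hl, hi]
    have honly : ∀ e', e' ≠ e → ¬ CGraph.Incident G e' v := by
      intro e' he' hi'
      have h1 : CGraph.incid G e v + CGraph.incid G e' v ≤ CGraph.valence G v := by
        rw [← Finset.sum_pair (f := fun e => CGraph.incid G e v) he'.symm]
        exact Finset.sum_le_sum_of_subset (Finset.subset_univ _)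
      have : CGraph.incid G e' v ≠ 0 := fun h => incid_zero.1 h hi'
      omega
    have hall : ∀ u, u = v := by
      intro u
      by_contra hu
      obtain ⟨e', he'⟩ := conn_cut hc (W := {v}) (u := v) (v := u) rfl hu
      have hi' := crs_single he'
      by_cases h : e' = e
      · subst h
        unfold Crs at he'
        rw [hl] at he'
        exact he' Iff.rfl
      · exact honly e' h hi'
    have hE : ∀ e', e' = e := by
      intro e'
      by_contra h
      exact honly e' h (Or.inl (hall _))
    have h3 : Fintype.card G.V = 1 := Fintype.card_eq_one_iff.2 ⟨v, hall⟩
    have h4 : Fintype.card G.E = 1 := Fintype.card_eq_one_iff.2 ⟨e, hE⟩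
    unfold Betti at hb; omega
  have hval : CGraph.valence G v =
      (Finset.univ.filter fun e : G.E => CGraph.Incident G e v).card := by
    unfold CGraph.valence
    rw [Finset.card_filter]
    refine Finset.sum_congr rfl fun e _ => ?_
    by_cases hi : CGraph.Incident G e v
    · have := hloop e hi
      unfold CGraph.incid
      rcases hi with hi' | hi'
      · have : G.tgt e ≠ v := fun h => this (hi'.trans h.symm)
        simp [CGraph.Incident, hi', this]
      · have : G.src e ≠ v := fun h => this (h.trans hi'.symm)
        simp [CGraph.Incident, hi', this]
    · simp [hi, incid_zero.2 hi]
  have hcases : CGraph.valence G v = 0 ∨ CGraph.valence G v = 1 ∨ CGraph.valence G v = 2 := by omega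
  rcases hcases with h | h | h
  · exfalso
    rw [hval, Finset.card_eq_zero] at h
    have honly : ∀ e', ¬ CGraph.Incident G e' v := by
      intro e' hi
      have : e' ∈ (Finset.univ.filter fun e : G.E => CGraph.Incident G e v) := by simpa using hi
      rw [h] at this; simp at this
    have hall : ∀ u, u = v := by
      intro u
      by_contra hu
      obtain ⟨e', he'⟩ := conn_cut hc (W := {v}) (u := v) (v := u) rfl hu
      exact honly e' (crs_single he')
    have h3 : Fintype.card G.V = 1 := Fintype.card_eq_one_iff.2 ⟨v, hall⟩
    have h4 : Fintype.card G.E = 0 := Fintype.card_eq_zero_iff.2 ⟨fun e => honly e (Or.inl (hall _))⟩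
    unfold Betti at hb; omega
  · have h' := h
    rw [hval, Finset.card_eq_one] at h
    obtain ⟨e, he⟩ := h
    have hmem : ∀ x, CGraph.Incident G x v ↔ x = e := by
      intro x
      have : x ∈ (Finset.univ.filter fun e : G.E => CGraph.Incident G e v) ↔ x ∈ ({e} : Finset G.E) := by
        rw [he]
      simpa using this
    exact exists_leafstep h' ((hmem e).2 rfl) (fun h hh => (hmem h).1 hh)
  · have h' := h
    rw [hval, Finset.card_eq_two] at h
    obtain ⟨e1, e2, hne, he⟩ := h
    have hmem : ∀ x, CGraph.Incident G x v ↔ x = e1 ∨ x = e2 := by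
      intro x
      have : x ∈ (Finset.univ.filter fun e : G.E => CGraph.Incident G e v) ↔ x ∈ ({e1, e2} : Finset G.E) := by
        rw [he]
      simpa using this
    have hi1 := (hmem e1).2 (Or.inl rfl)
    have hi2 := (hmem e2).2 (Or.inr rfl)
    obtain ⟨u1, hu1, hj1⟩ := other_end hi1 (hloop e1 hi1)
    obtain ⟨u2, hu2, hj2⟩ := other_end hi2 (hloop e2 hi2)
    exact exists_seriesstep hne h' hu1 hu2 hj1 hj2 (fun h hh => (hmem h).1 hh)

theorem exists_stable {g : ℕ} (hg : 2 ≤ g) (n : ℕ) : ∀ (G : CGraph), Fintype.card G.V = n →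
    CGraph.Connected G → Betti G g → ∃ K, StabReduces0 G K ∧ CGraph.IsStable0 K := by
  induction n using Nat.strong_induction_on with
  | _ n ih =>
    intro G hn hc hb
    by_cases hs : CGraph.IsStable0 G
    · exact ⟨G, Relation.ReflTransGen.refl, hs⟩
    · unfold CGraph.IsStable0 at hs
      push Not at hs
      obtain ⟨v, hv⟩ := hs
      obtain ⟨H, hH⟩ := exists_step hc hb hg (v := v) (by omega)
      have hstep : Step0 G H := by
        rcases hH with h | h
        · exact Or.inl h
        · exact Or.inr (Or.inl h)
      have hcard : Fintype.card H.V < Fintype.card G.V := by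
        have : ∃ v0 : G.V, Nonempty (H.V ≃ {v : G.V // v ≠ v0}) := by
          rcases hH with h | h
          · obtain ⟨v0, _, _, _, fv, _⟩ := h; exact ⟨v0, ⟨fv⟩⟩
          · obtain ⟨v0, _, _, _, _, _, _, _, _, _, _, fv, _⟩ := h; exact ⟨v0, ⟨fv⟩⟩
        obtain ⟨v0, ⟨fv⟩⟩ := this
        rw [Fintype.card_congr fv]
        exact Fintype.card_subtype_lt (x := v0) (by simp)
      obtain ⟨K, h1, h2⟩ := ih _ (by omega) H rfl (step_conn hstep hc) (step_betti hstep hb)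
      exact ⟨K, Relation.ReflTransGen.head hstep h1, h2⟩

/-! ### immersions -/

structure Imm (X G : CGraph) (S : Set G.E) where
  rep : X.V → G.V
  kap : G.V → Option X.V
  rho : G.E → Option X.E
  kr : ∀ x, kap (rep x) = some x
  ks : ∀ e ∈ S, kap (G.src e) = kap (G.tgt e)
  star : ∀ W, Sat G S W → ∀ b, ¬ (rep (X.src b) ∈ W ↔ rep (X.tgt b) ∈ W) →
    ∃ h, rho h = some b ∧ Crs G W h

theorem Imm.inj {X G : CGraph} {S : Set G.E} (I : Imm X G S) : Function.Injective I.rep := by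
  intro x y h
  have h1 := I.kr x
  rw [h, I.kr y] at h1
  exact (Option.some.inj h1).symm

theorem Imm.transfer {X G G' : CGraph} {S : Set G.E} {S' : Set G'.E} (I : Imm X G S)
    (q : G.V → G'.V) (η : G.E → Option G'.E)
    (h1 : ∀ h ∈ S, SReach G' S' (q (G.src h)) (q (G.tgt h)))
    (h2 : ∀ h, h ∉ S → η h = none → SReach G' S' (q (G.src h)) (q (G.tgt h)))
    (h3 : ∀ h h', h ∉ S → η h = some h' →
      (SReach G' S' (q (G.src h)) (G'.src h') ∧ SReach G' S' (q (G.tgt h)) (G'.tgt h')) ∨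
      (SReach G' S' (q (G.src h)) (G'.tgt h') ∧ SReach G' S' (q (G.tgt h)) (G'.src h')))
    (hinj : ∀ a b h', a ∉ S → b ∉ S → η a = some h' → η b = some h' → a = b)
    (κ' : G'.V → Option X.V) (hk : ∀ e ∈ S', κ' (G'.src e) = κ' (G'.tgt e))
    (hr : ∀ x, κ' (q (I.rep x)) = some x) : Nonempty (Imm X G' S') := by
  refine ⟨⟨fun x => q (I.rep x), κ',
    fun h' => if hh : ∃ h, h ∉ S ∧ η h = some h' then I.rho hh.choose else none, hr, hk, ?_⟩⟩
  intro W' hW' b hb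
  have hsat : Sat G S (q ⁻¹' W') := fun e he => sat_sreach hW' (h1 e he)
  obtain ⟨h, hh, hcr⟩ := I.star (q ⁻¹' W') hsat b hb
  have hnS : h ∉ S := fun hc => hcr (hsat h hc)
  cases hη : η h with
  | none => exact absurd (sat_sreach hW' (h2 h hnS hη)) hcr
  | some h' =>
    refine ⟨h', ?_, ?_⟩
    · have hex : ∃ h, h ∉ S ∧ η h = some h' := ⟨h, hnS, hη⟩
      simp only [dif_pos hex]
      rw [hinj _ h h' hex.choose_spec.1 hnS hex.choose_spec.2 hη]
      exact hh
    · unfold Crs at hcr ⊢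
      simp only [Set.mem_preimage] at hcr
      rcases h3 h h' hnS hη with ⟨h5, h6⟩ | ⟨h5, h6⟩
      · rw [← sat_sreach hW' h5, ← sat_sreach hW' h6]; exact hcr
      · rw [sat_sreach hW' h5, sat_sreach hW' h6] at hcr; tauto

theorem Imm.lift {X G H : CGraph} {S : Set G.E} (cd : ContractionData G S H) {S0 : Set H.E}
    (I : Imm X H S0) : Nonempty (Imm X G (S ∪ {e | ∃ h ∈ S0, (cd.fe h).1 = e})) := by
  choose q hq using cd.surj
  have hmono : ∀ a b, SReach G S a b →
      SReach G (S ∪ {e | ∃ h ∈ S0, (cd.fe h).1 = e}) a b :=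
    fun a b h => sreach_mono Set.subset_union_left h
  have hqc : ∀ v, SReach G S (q (cd.c v)) v := fun v => (cd.fibers _ _).1 (hq _)
  have hends : ∀ h : H.E,
      (SReach G S (q (H.src h)) (G.src (cd.fe h).1) ∧ SReach G S (q (H.tgt h)) (G.tgt (cd.fe h).1)) ∨
      (SReach G S (q (H.src h)) (G.tgt (cd.fe h).1) ∧ SReach G S (q (H.tgt h)) (G.src (cd.fe h).1)) := by
    intro h
    rcases cd.ends h with ⟨h1, h2⟩ | ⟨h1, h2⟩ <;> rw [h1, h2]
    · exact Or.inl ⟨hqc _, hqc _⟩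
    · exact Or.inr ⟨hqc _, hqc _⟩
  refine I.transfer q (fun h => some (cd.fe h).1) ?_ ?_ ?_ ?_ (fun v => I.kap (cd.c v)) ?_ ?_
  · intro h hh
    have he : (cd.fe h).1 ∈ (S ∪ {e | ∃ h ∈ S0, (cd.fe h).1 = e}) := Or.inr ⟨h, hh, rfl⟩
    rcases hends h with ⟨h1, h2⟩ | ⟨h1, h2⟩
    · exact sreach_trans (hmono _ _ h1) (sreach_trans (sreach_edge he) (sreach_symm (hmono _ _ h2)))
    · exact sreach_trans (hmono _ _ h1) (sreach_trans (sreach_edge' he) (sreach_symm (hmono _ _ h2)))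
  · intro h _ hc; exact absurd hc (by simp)
  · intro h h' _ hh
    obtain rfl := Option.some.inj hh
    rcases hends h with ⟨h1, h2⟩ | ⟨h1, h2⟩
    · exact Or.inl ⟨hmono _ _ h1, hmono _ _ h2⟩
    · exact Or.inr ⟨hmono _ _ h1, hmono _ _ h2⟩
  · intro a b h' _ _ ha hb
    exact cd.fe.injective (Subtype.ext ((Option.some.inj ha).trans (Option.some.inj hb).symm))
  · rintro e (he | ⟨h, hh, rfl⟩)
    · simp only [cd_S cd he]
    · have := I.ks h hh
      rcases cd.ends h with ⟨h1, h2⟩ | ⟨h1, h2⟩ <;> rw [h1, h2] at this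
      · exact this
      · exact this.symm
  · intro x
    simp only [hq]; exact I.kr x

theorem Imm.quot {X G H : CGraph} {S : Set G.E} (cd : ContractionData G S H)
    (I : Imm X G S) : Nonempty (Imm X H ∅) := by
  choose q hq using cd.surj
  have hkap : ∀ u v, SReach G S u v → I.kap u = I.kap v := by
    intro u v h
    exact (sat_sreach (W := {x | I.kap u = I.kap x}) (fun e he => by
      show I.kap u = I.kap (G.src e) ↔ I.kap u = I.kap (G.tgt e)
      rw [I.ks e he]) h).1 rfl
  refine I.transfer cd.c (fun h => if hh : h ∈ S then none else some (cd.fe.symm ⟨h, hh⟩)) ?_ ?_ ?_ ?_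
    (fun y => I.kap (q y)) ?_ ?_
  · intro h hh
    rw [cd_S cd hh]; exact sreach_refl _
  · intro h hh hc; simp [hh] at hc
  · intro h h' hh hc
    simp only [hh, dif_neg, not_false_eq_true] at hc
    obtain rfl := Option.some.inj hc
    have := cd.ends (cd.fe.symm ⟨h, hh⟩)
    simp only [Equiv.apply_symm_apply] at this
    rcases this with ⟨h1, h2⟩ | ⟨h1, h2⟩
    · left; rw [h1, h2]; exact ⟨sreach_refl _, sreach_refl _⟩
    · right; rw [h1, h2]; exact ⟨sreach_refl _, sreach_refl _⟩
  · intro a b h' ha hb h1 h2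
    simp only [ha, hb, dif_neg, not_false_eq_true] at h1 h2
    have := cd.fe.symm.injective ((Option.some.inj h1).trans (Option.some.inj h2).symm)
    exact congrArg Subtype.val this
  · intro e he; exact he.elim
  · intro x
    rw [← I.kr x]
    exact hkap _ _ ((cd.fibers _ _).1 (hq _))

theorem Imm.iso {X G G' : CGraph} {S : Set G.E} (i : CIso G G') (I : Imm X G S) :
    Nonempty (Imm X G' (i.eEquiv '' S)) := by
  have hends := i.ends
  have hE : ∀ h ∈ S, SReach G' (i.eEquiv '' S) (i.vEquiv (G.src h)) (i.vEquiv (G.tgt h)) := by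
    intro h hh
    rcases hends h with ⟨h1, h2⟩ | ⟨h1, h2⟩ <;> simp only at h1 h2 <;> rw [h1, h2]
    · exact sreach_edge ⟨h, hh, rfl⟩
    · exact sreach_edge' ⟨h, hh, rfl⟩
  refine I.transfer i.vEquiv (fun h => some (i.eEquiv h)) hE ?_ ?_ ?_
    (fun y => I.kap (i.vEquiv.symm y)) ?_ ?_
  · intro h _ hc; exact absurd hc (by simp)
  · intro h h' _ hh
    obtain rfl := Option.some.inj hh
    rcases hends h with ⟨h1, h2⟩ | ⟨h1, h2⟩ <;> simp only at h1 h2 <;> rw [h1, h2]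
    · exact Or.inl ⟨sreach_refl _, sreach_refl _⟩
    · exact Or.inr ⟨sreach_refl _, sreach_refl _⟩
  · intro a b h' _ _ ha hb
    exact i.eEquiv.injective ((Option.some.inj ha).trans (Option.some.inj hb).symm)
  · rintro _ ⟨h, hh, rfl⟩
    have := I.ks h hh
    rcases hends h with ⟨h1, h2⟩ | ⟨h1, h2⟩ <;> simp only at h1 h2 <;> rw [← h1, ← h2] <;> simp [this]
  · intro x; simp [I.kr]

/-- every `x` needs at least `val x` edges in any saturated `W` containing only `rep x` -/
theorem Imm.dcut {X G : CGraph} {S : Set G.E} (I : Imm X G S) (hX : Loopless X) (x : X.V)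
    (W : Set G.V) (hW : Sat G S W) (hx : I.rep x ∈ W) (hy : ∀ y, y ≠ x → I.rep y ∉ W) :
    CGraph.valence X x ≤ dcut G W := by
  rw [valence_loopless hX]
  have : ∀ b, CGraph.Incident X b x → ∃ h, I.rho h = some b ∧ Crs G W h := by
    intro b hb
    apply I.star W hW
    have := hX b
    rcases hb with hb | hb
    · have h2 := hy (X.tgt b) (by rw [← hb]; exact this.symm)
      rw [hb]; tauto
    · have h2 := hy (X.src b) (by rw [← hb]; exact this)
      rw [hb]; tauto
  unfold TL.dcut
  rcases isEmpty_or_nonempty G.E with hem | hne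
  · have : (Finset.univ.filter fun e : X.E => CGraph.Incident X e x) = ∅ := by
      refine Finset.eq_empty_of_forall_notMem fun b hb => ?_
      simp at hb
      obtain ⟨h, _⟩ := this b hb
      exact hem.elim h
    rw [this]; simp
  choose! f hf using this
  refine Finset.card_le_card_of_injOn f ?_ ?_
  · intro b hb
    simp at hb ⊢
    exact (hf b hb).2
  · intro a ha b hb h
    simp at ha hb
    have h1 := (hf a ha).1
    rw [h, (hf b hb).1] at h1
    exact (Option.some.inj h1).symm

theorem Imm.step {X G H : CGraph} {S : Set G.E} (I : Imm X G S) (hX : Loopless X)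
    (hst : CGraph.IsStable0 X) (hs : Step0 G H) :
    ∃ S' : Set H.E, Nonempty (Imm X H S') ∧ (S = ∅ → S' = ∅) := by
  rcases step_cases hs with ⟨⟨i⟩⟩ | ⟨⟨s⟩⟩
  · exact ⟨_, I.iso i, by rintro rfl; simp⟩
  · have hfe : ∀ h (hh : h ≠ s.e0), ((s.cd.fe (s.cd.fe.symm ⟨h, hh⟩)).1) = h := by simp
    have hce0 : s.cd.c (G.src s.e0) = s.cd.c (G.tgt s.e0) := cd_S s.cd rfl
    by_cases h0 : s.e0 ∈ S
    · -- contract e0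
      refine ⟨{h' | (s.cd.fe h').1 ∈ S}, ?_, by rintro rfl; simp⟩
      have hk0 : I.kap s.v0 = I.kap s.u0 := by
        have := I.ks _ h0
        rcases s.he0 with ⟨h1, h2⟩ | ⟨h1, h2⟩ <;> rw [h1, h2] at this
        · exact this
        · exact this.symm
      have hkj : ∀ v, I.kap (s.j (s.cd.c v)) = I.kap v := by
        intro v
        by_cases hv : v = s.v0
        · rw [hv, s.cv0, s.jc _ s.hu, hk0]
        · rw [s.jc _ hv]
      refine I.transfer s.cd.c (fun h => if hh : h = s.e0 then none else some (s.cd.fe.symm ⟨h, hh⟩))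
        ?_ ?_ ?_ ?_ (fun y => I.kap (s.j y)) ?_ ?_
      · intro h hh
        by_cases he : h = s.e0
        · rw [he, hce0]; exact sreach_refl _
        · have := s.cd.ends (s.cd.fe.symm ⟨h, he⟩)
          simp only [Equiv.apply_symm_apply] at this
          have hm : (s.cd.fe.symm ⟨h, he⟩) ∈ {h' | (s.cd.fe h').1 ∈ S} := by simpa using hh
          rcases this with ⟨h1, h2⟩ | ⟨h1, h2⟩ <;> rw [← h1, ← h2]
          · exact sreach_edge hm
          · exact sreach_edge' hm
      · intro h hh hc
        have he : h = s.e0 := by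
          by_contra he
          simp [he] at hc
        exact absurd h0 (he ▸ hh)
      · intro h h' hh hc
        have he : h ≠ s.e0 := fun he => hh (he ▸ h0)
        simp only [he, dif_neg, not_false_eq_true] at hc
        obtain rfl := Option.some.inj hc
        have := s.cd.ends (s.cd.fe.symm ⟨h, he⟩)
        simp only [Equiv.apply_symm_apply] at this
        rcases this with ⟨h1, h2⟩ | ⟨h1, h2⟩ <;> rw [← h1, ← h2]
        · exact Or.inl ⟨sreach_refl _, sreach_refl _⟩
        · exact Or.inr ⟨sreach_refl _, sreach_refl _⟩
      · intro a b h' ha hb h1 h2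
        have hea : a ≠ s.e0 := fun he => ha (he ▸ h0)
        have heb : b ≠ s.e0 := fun he => hb (he ▸ h0)
        simp only [hea, heb, dif_neg, not_false_eq_true] at h1 h2
        have := s.cd.fe.symm.injective ((Option.some.inj h1).trans (Option.some.inj h2).symm)
        exact congrArg Subtype.val this
      · intro e he
        have := I.ks _ he
        rcases s.cd.ends e with ⟨h1, h2⟩ | ⟨h1, h2⟩ <;> rw [h1, h2, hkj, hkj, this]
      · intro x; rw [hkj]; exact I.kr x
    · by_cases h2 : s.e2 ∈ S
      · -- contract e2 instead
        have hne : s.e2 ≠ s.e0 := fun h => h0 (h ▸ h2)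
        obtain ⟨u2, hu2, hj2⟩ := other_end s.h2 s.he2
        have hk2 : I.kap s.v0 = I.kap u2 := by
          have := I.ks _ h2
          rcases hj2 with ⟨h1, h2⟩ | ⟨h1, h2⟩ <;> rw [h1, h2] at this
          · exact this
          · exact this.symm
        let q : G.V → H.V := fun v => if v = s.v0 then s.cd.c u2 else s.cd.c v
        have hq0 : q s.v0 = s.cd.c u2 := by simp [q]
        have hq : ∀ v, v ≠ s.v0 → q v = s.cd.c v := fun v hv => by simp [q, hv]
        have hoff : ∀ h, h ≠ s.e0 → h ≠ s.e2 → G.src h ≠ s.v0 ∧ G.tgt h ≠ s.v0 := by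
          intro h ha hb
          constructor
          · intro hc
            rcases s.hinc h (Or.inl hc) with h | h
            · exact ha h
            · exact hb h
          · intro hc
            rcases s.hinc h (Or.inr hc) with h | h
            · exact ha h
            · exact hb h
        have hrest : ∀ h (he : h ≠ s.e0), h ≠ s.e2 →
            ((H.src (s.cd.fe.symm ⟨h, he⟩) = q (G.src h) ∧ H.tgt (s.cd.fe.symm ⟨h, he⟩) = q (G.tgt h)) ∨
            (H.src (s.cd.fe.symm ⟨h, he⟩) = q (G.tgt h) ∧ H.tgt (s.cd.fe.symm ⟨h, he⟩) = q (G.src h))) := by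
          intro h he he2
          have := s.cd.ends (s.cd.fe.symm ⟨h, he⟩)
          simp only [Equiv.apply_symm_apply] at this
          have ho := hoff h he he2
          rw [hq _ ho.1, hq _ ho.2]; exact this
        refine ⟨{h' | (s.cd.fe h').1 ∈ S ∧ (s.cd.fe h').1 ≠ s.e2}, ?_, by rintro rfl; simp⟩
        refine I.transfer q (fun h => if hh : h = s.e0 then some (s.cd.fe.symm ⟨s.e2, hne⟩)
          else if h = s.e2 then none else some (s.cd.fe.symm ⟨h, hh⟩))
          ?_ ?_ ?_ ?_ (fun y => I.kap (s.j y)) ?_ ?_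
        · intro h hh
          have he : h ≠ s.e0 := fun he => h0 (he ▸ hh)
          by_cases he2 : h = s.e2
          · subst he2
            rcases hj2 with ⟨h1, h2⟩ | ⟨h1, h2⟩ <;> rw [h1, h2, hq0, hq _ hu2] <;> exact sreach_refl _
          · have hm : (s.cd.fe.symm ⟨h, he⟩) ∈ {h' | (s.cd.fe h').1 ∈ S ∧ (s.cd.fe h').1 ≠ s.e2} := by
              simpa using ⟨hh, he2⟩
            rcases hrest h he he2 with ⟨h1, h2⟩ | ⟨h1, h2⟩ <;> rw [← h1, ← h2]
            · exact sreach_edge hm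
            · exact sreach_edge' hm
        · intro h hh hc
          have he2 : h ≠ s.e2 := fun he => hh (he ▸ h2)
          by_cases he : h = s.e0
          · simp [he] at hc
          · simp [he, he2] at hc
        · intro h h' hh hc
          have he2 : h ≠ s.e2 := fun he => hh (he ▸ h2)
          by_cases he : h = s.e0
          · simp only [he, dif_pos] at hc
            obtain rfl := Option.some.inj hc
            have hb := s.cd.ends (s.cd.fe.symm ⟨s.e2, hne⟩)
            simp only [Equiv.apply_symm_apply] at hb
            have hx : (q (G.src h) = s.cd.c u2 ∧ q (G.tgt h) = s.cd.c s.u0) ∨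
                (q (G.src h) = s.cd.c s.u0 ∧ q (G.tgt h) = s.cd.c u2) := by
              rw [he]
              rcases s.he0 with ⟨h1, h2⟩ | ⟨h1, h2⟩ <;> rw [h1, h2, hq0, hq _ s.hu]
              · exact Or.inl ⟨rfl, rfl⟩
              · exact Or.inr ⟨rfl, rfl⟩
            rcases hj2 with ⟨h1, h2⟩ | ⟨h1, h2⟩ <;> rw [h1, h2, s.cv0] at hb <;>
            rcases hb with ⟨h3, h4⟩ | ⟨h3, h4⟩ <;> rw [h3, h4] <;>
            rcases hx with ⟨h5, h6⟩ | ⟨h5, h6⟩ <;> rw [h5, h6] <;>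
            first
            | exact Or.inl ⟨sreach_refl _, sreach_refl _⟩
            | exact Or.inr ⟨sreach_refl _, sreach_refl _⟩
          · simp only [he, he2, dif_neg, not_false_eq_true, if_false] at hc
            obtain rfl := Option.some.inj hc
            rcases hrest h he he2 with ⟨h1, h2⟩ | ⟨h1, h2⟩ <;> rw [← h1, ← h2]
            · exact Or.inl ⟨sreach_refl _, sreach_refl _⟩
            · exact Or.inr ⟨sreach_refl _, sreach_refl _⟩
        · intro a b h' ha hb h1 h3
          have ha2 : a ≠ s.e2 := fun he => ha (he ▸ h2)
          have hb2 : b ≠ s.e2 := fun he => hb (he ▸ h2)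
          by_cases hea : a = s.e0 <;> by_cases heb : b = s.e0
          · rw [hea, heb]
          · simp only [hea, heb, hb2, dif_pos, dif_neg, not_false_eq_true, if_false] at h1 h3
            have := s.cd.fe.symm.injective ((Option.some.inj h1).trans (Option.some.inj h3).symm)
            exact absurd (congrArg Subtype.val this).symm hb2
          · simp only [hea, heb, ha2, dif_pos, dif_neg, not_false_eq_true, if_false] at h1 h3
            have := s.cd.fe.symm.injective ((Option.some.inj h1).trans (Option.some.inj h3).symm)
            exact absurd (congrArg Subtype.val this) ha2
          · simp only [hea, heb, ha2, hb2, dif_pos, dif_neg, not_false_eq_true, if_false] at h1 h3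
            have := s.cd.fe.symm.injective ((Option.some.inj h1).trans (Option.some.inj h3).symm)
            exact congrArg Subtype.val this
        · rintro e ⟨he1, he2⟩
          have := I.ks _ he1
          have ho := hoff _ (fun he => h0 (he ▸ he1)) he2
          rcases s.cd.ends e with ⟨h1, h2⟩ | ⟨h1, h2⟩ <;> rw [h1, h2, s.jc _ ho.1, s.jc _ ho.2, this]
        · intro x
          by_cases hx : I.rep x = s.v0
          · rw [hx, hq0, s.jc _ hu2, ← hk2, ← hx]; exact I.kr x
          · rw [hq _ hx, s.jc _ hx]; exact I.kr x
      · -- v0 isolated under S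
        have hoffS : ∀ h ∈ S, G.src h ≠ s.v0 ∧ G.tgt h ≠ s.v0 := by
          intro h hh
          constructor
          · intro hc
            rcases s.hinc h (Or.inl hc) with h | h
            · exact h0 (h ▸ hh)
            · exact h2 (h ▸ hh)
          · intro hc
            rcases s.hinc h (Or.inr hc) with h | h
            · exact h0 (h ▸ hh)
            · exact h2 (h ▸ hh)
        have hrep : ∀ x, I.rep x ≠ s.v0 := by
          intro x hx
          have h1 := I.dcut hX x {s.v0} (by
            intro e he
            have := hoffS e he
            simp [this.1, this.2]) hx (by
            intro y hy hc
            exact hy (I.inj (hc.trans hx.symm)))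
          have h3 := hst x
          have h4 := dcut_le_valence s.v0
          have h5 := nstep_val s
          omega
        refine ⟨{h' | (s.cd.fe h').1 ∈ S}, ?_, by rintro rfl; simp⟩
        refine I.transfer s.cd.c (fun h => if hh : h = s.e0 then none else some (s.cd.fe.symm ⟨h, hh⟩))
          ?_ ?_ ?_ ?_ (fun y => I.kap (s.j y)) ?_ ?_
        · intro h hh
          have he : h ≠ s.e0 := fun he => h0 (he ▸ hh)
          have := s.cd.ends (s.cd.fe.symm ⟨h, he⟩)
          simp only [Equiv.apply_symm_apply] at this
          have hm : (s.cd.fe.symm ⟨h, he⟩) ∈ {h' | (s.cd.fe h').1 ∈ S} := by simpa using hh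
          rcases this with ⟨h1, h2⟩ | ⟨h1, h2⟩ <;> rw [← h1, ← h2]
          · exact sreach_edge hm
          · exact sreach_edge' hm
        · intro h hh hc
          have he : h = s.e0 := by
            by_contra he
            simp [he] at hc
          rw [he, hce0]; exact sreach_refl _
        · intro h h' hh hc
          have he : h ≠ s.e0 := by
            intro he; simp [he] at hc
          simp only [he, dif_neg, not_false_eq_true] at hc
          obtain rfl := Option.some.inj hc
          have := s.cd.ends (s.cd.fe.symm ⟨h, he⟩)
          simp only [Equiv.apply_symm_apply] at this
          rcases this with ⟨h1, h2⟩ | ⟨h1, h2⟩ <;> rw [← h1, ← h2]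
          · exact Or.inl ⟨sreach_refl _, sreach_refl _⟩
          · exact Or.inr ⟨sreach_refl _, sreach_refl _⟩
        · intro a b h' ha hb h1 h2
          have hea : a ≠ s.e0 := by
            intro he; simp [he] at h1
          have heb : b ≠ s.e0 := by
            intro he; simp [he] at h2
          simp only [hea, heb, dif_neg, not_false_eq_true] at h1 h2
          have := s.cd.fe.symm.injective ((Option.some.inj h1).trans (Option.some.inj h2).symm)
          exact congrArg Subtype.val this
        · intro e he
          have := I.ks _ he
          have ho := hoffS _ he
          rcases s.cd.ends e with ⟨h1, h2⟩ | ⟨h1, h2⟩ <;> rw [h1, h2, s.jc _ ho.1, s.jc _ ho.2, this]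
        · intro x; rw [s.jc _ (hrep x)]; exact I.kr x

theorem Imm.red {X G H : CGraph} (hX : Loopless X)
    (hst : CGraph.IsStable0 X) (hs : StabReduces0 G H) :
    ∀ (S : Set G.E), Nonempty (Imm X G S) →
    ∃ S' : Set H.E, Nonempty (Imm X H S') ∧ (S = ∅ → S' = ∅) := by
  induction hs with
  | refl => intro S hI; exact ⟨S, hI, id⟩
  | tail _ h2 ih =>
    intro S hI
    obtain ⟨S1, ⟨I1⟩, h3⟩ := ih S hI
    obtain ⟨S2, I2, h4⟩ := I1.step hX hst h2
    exact ⟨S2, I2, fun h => h4 (h3 h)⟩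

theorem Imm.red0 {X G H : CGraph} (hX : Loopless X)
    (hst : CGraph.IsStable0 X) (hs : StabReduces0 G H) (h : Nonempty (Imm X G ∅)) :
    Nonempty (Imm X H ∅) := by
  obtain ⟨S', h1, h2⟩ := Imm.red hX hst hs ∅ h
  rw [h2 rfl] at h1; exact h1

end TL


namespace TL

/-- immersions between stable graphs with injective, surjective `rep` -/
theorem imm_iso_of_card {X K : CGraph} {g : ℕ} (hX : Loopless X) (hbX : Betti X g)
    (hbK : Betti K g) (I : Imm X K ∅) (hcard : Fintype.card X.V = Fintype.card K.V) :
    Nonempty (CIso K X) := by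
  have hE : Fintype.card X.E = Fintype.card K.E := by unfold Betti at *; omega
  have hbij : Function.Bijective I.rep :=
    (Fintype.bijective_iff_injective_and_card _).2 ⟨I.inj, hcard⟩
  have hsat : ∀ W, Sat K ∅ W := fun W e he => he.elim
  have hex : ∀ b, ∃ h, I.rho h = some b := by
    intro b
    obtain ⟨h, hh, _⟩ := I.star {I.rep (X.src b)} (hsat _) b (by
      simp only [Set.mem_singleton_iff, true_iff]
      intro hc; exact hX b (I.inj hc.symm))
    exact ⟨h, hh⟩
  choose f hf using hex
  have hfinj : Function.Injective f := by
    intro a b h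
    have := hf a
    rw [h, hf b] at this
    exact (Option.some.inj this).symm
  have hfbij : Function.Bijective f :=
    (Fintype.bijective_iff_injective_and_card _).2 ⟨hfinj, hE⟩
  have hrho : ∀ h b, I.rho h = some b → h = f b := by
    intro h b hh
    obtain ⟨a, rfl⟩ := hfbij.2 h
    rw [hf a] at hh
    rw [Option.some.inj hh]
  have hinc : ∀ b x, CGraph.Incident X b x → CGraph.Incident K (f b) (I.rep x) := by
    intro b x hx
    obtain ⟨h, hh, hc⟩ := I.star {I.rep x} (hsat _) b (by
      have := hX b
      simp only [Set.mem_singleton_iff]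
      rcases hx with hx | hx
      · rw [hx]
        simp only [true_iff]
        intro hc; exact this (hx.trans (I.inj hc).symm)
      · rw [hx]
        simp only [iff_true]
        intro hc; exact this ((I.inj hc).trans hx.symm))
    rw [← hrho h b hh]
    exact crs_single hc
  refine ⟨CIso.symm ⟨Equiv.ofBijective _ hbij, Equiv.ofBijective _ hfbij, ?_⟩⟩
  intro b
  have h1 := hinc b (X.src b) (Or.inl rfl)
  have h2 := hinc b (X.tgt b) (Or.inr rfl)
  have h3 : I.rep (X.src b) ≠ I.rep (X.tgt b) := fun h => hX b (I.inj h)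
  unfold CGraph.Incident at h1 h2
  simp only [sameEndsMapC, Equiv.ofBijective_apply]
  rcases h1 with h1 | h1 <;> rcases h2 with h2 | h2
  · exact absurd (h1.symm.trans h2) h3
  · exact Or.inl ⟨h1.symm, h2.symm⟩
  · exact Or.inr ⟨h1.symm, h2.symm⟩
  · exact absurd (h1.symm.trans h2) h3

theorem imm_iso {X K : CGraph} {g : ℕ} (hX : Loopless X) (hbX : Betti X g)
    (hbK : Betti K g) (hsK : CGraph.IsStable0 K) (I : Imm X K ∅) : Nonempty (CIso K X) := by
  apply imm_iso_of_card hX hbX hbK I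
  have hle : Fintype.card X.V ≤ Fintype.card K.V := Fintype.card_le_of_injective _ I.inj
  have hv : ∀ x, CGraph.valence X x ≤ CGraph.valence K (I.rep x) := by
    intro x
    refine le_trans (I.dcut hX x {I.rep x} (fun e he => he.elim) rfl ?_) (dcut_le_valence _)
    intro y hy hc; exact hy (I.inj hc)
  have h1 : ∑ x : X.V, CGraph.valence X x ≤ ∑ v ∈ Finset.univ.image I.rep, CGraph.valence K v := by
    rw [Finset.sum_image (fun a _ b _ h => I.inj h)]
    exact Finset.sum_le_sum fun x _ => hv x
  have h2 : 3 * (Finset.univ \ Finset.univ.image I.rep).card ≤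
      ∑ v ∈ Finset.univ \ Finset.univ.image I.rep, CGraph.valence K v := by
    rw [mul_comm, ← smul_eq_mul]
    exact Finset.card_nsmul_le_sum _ _ _ fun v _ => hsK v
  have h3 := Finset.sum_sdiff (Finset.subset_univ (Finset.univ.image I.rep)) (f := CGraph.valence K)
  have h4 : (Finset.univ \ Finset.univ.image I.rep).card + Fintype.card X.V = Fintype.card K.V := by
    rw [Finset.card_sdiff_of_subset (Finset.subset_univ _), Finset.card_image_of_injective _ I.inj]
    simp only [Finset.card_univ]
    omega
  rw [sum_valence] at h3 h1
  unfold Betti at *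
  omega

/-- the reduction criterion -/
theorem red_of_imm {X Q : CGraph} {g : ℕ} (hg : 2 ≤ g) (hX : Loopless X) (hst : CGraph.IsStable0 X)
    (hbX : Betti X g) (hcQ : CGraph.Connected Q) (hbQ : Betti Q g)
    (h : Nonempty (Imm X Q ∅)) : StabReduces0 Q X := by
  obtain ⟨K, h1, h2⟩ := exists_stable hg _ Q rfl hcQ hbQ
  obtain ⟨I⟩ := Imm.red0 hX hst h1 h
  obtain ⟨i⟩ := imm_iso hX hbX (red_betti h1 hbQ) h2 I
  exact red_iso h1 i

/-- trivalent targets absorb any contraction -/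
theorem iso_of_imm_max {X K : CGraph} {g : ℕ} (hX : Loopless X)
    (hbX : Betti X g) (hcard : Fintype.card X.V + 2 = 2 * g) (hsK : CGraph.IsStable0 K)
    (hbK : Betti K g) {S : Set K.E} (I : Imm X K S) : Nonempty (CIso K X) := by
  have h1 := stable_card hsK hbK
  have h2 : Fintype.card X.V ≤ Fintype.card K.V := Fintype.card_le_of_injective _ I.inj
  have h3 : Fintype.card X.V = Fintype.card K.V := by omega
  have hbij : Function.Bijective I.rep :=
    (Fintype.bijective_iff_injective_and_card _).2 ⟨I.inj, h3⟩
  have hloop : ∀ e ∈ S, K.src e = K.tgt e := by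
    intro e he
    have := I.ks e he
    obtain ⟨x, hx⟩ := hbij.2 (K.src e)
    obtain ⟨y, hy⟩ := hbij.2 (K.tgt e)
    rw [← hx, ← hy, I.kr, I.kr] at this
    rw [← hx, ← hy, Option.some.inj this]
  refine imm_iso_of_card hX hbX hbK ⟨I.rep, I.kap, I.rho, I.kr, fun e he => he.elim, ?_⟩ h3
  intro W _ b hb
  exact I.star W (fun e he => by rw [hloop e he]) b hb

theorem red_of_imm_max {X Q : CGraph} {g : ℕ} (hg : 2 ≤ g) (hX : Loopless X)
    (hst : CGraph.IsStable0 X) (hbX : Betti X g) (hcard : Fintype.card X.V + 2 = 2 * g)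
    (hcQ : CGraph.Connected Q) (hbQ : Betti Q g) {S : Set Q.E}
    (h : Nonempty (Imm X Q S)) : StabReduces0 Q X := by
  obtain ⟨K, h1, h2⟩ := exists_stable hg _ Q rfl hcQ hbQ
  obtain ⟨S', ⟨I⟩, _⟩ := Imm.red hX hst h1 S h
  obtain ⟨i⟩ := iso_of_imm_max hX hbX hcard h2 (red_betti h1 hbQ) I
  exact red_iso h1 i

/-! ### topological minors -/

structure TM (X G : CGraph) where
  io : X.V → G.V
  inj : Function.Injective io
  rho : G.E → Option X.E
  star : ∀ W b, ¬ (io (X.src b) ∈ W ↔ io (X.tgt b) ∈ W) → ∃ h, rho h = some b ∧ Crs G W h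
  two : ∀ v h1 h2 a b, CGraph.Incident G h1 v → CGraph.Incident G h2 v → rho h1 = some a →
    rho h2 = some b → a ≠ b → ∃ x, io x = v
  inc : ∀ x h a, CGraph.Incident G h (io x) → rho h = some a → CGraph.Incident X a x

noncomputable def TM.refl (X : CGraph) : TM X X where
  io := id
  inj := Function.injective_id
  rho := some
  star := fun _ b h => ⟨b, rfl, h⟩
  two := fun v _ _ _ _ _ _ _ _ _ => ⟨v, rfl⟩
  inc := fun x h a h1 h2 => by obtain rfl := Option.some.inj h2; exact h1

theorem iso_incident {G H : CGraph} (i : CIso G H) {e : G.E} {v : G.V}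
    (h : CGraph.Incident G e v) : CGraph.Incident H (i.eEquiv e) (i.vEquiv v) := by
  unfold CGraph.Incident at *
  rcases i.ends e with ⟨h1, h2⟩ | ⟨h1, h2⟩ <;> simp only at h1 h2 <;> rw [← h1, ← h2] <;>
    rcases h with h | h <;> simp [h]

theorem cd_incident {G H : CGraph} {S : Set G.E} (cd : ContractionData G S H) {e : H.E} {v : G.V}
    (h : CGraph.Incident G (cd.fe e).1 v) : CGraph.Incident H e (cd.c v) := by
  unfold CGraph.Incident at *
  rcases cd.ends e with ⟨h1, h2⟩ | ⟨h1, h2⟩ <;> rw [h1, h2] <;>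
    rcases h with h | h <;> simp [h]

theorem TM.back {X G H : CGraph} (hs : Step0 G H) (t : TM X H) : Nonempty (TM X G) := by
  rcases step_cases hs with ⟨⟨i⟩⟩ | ⟨⟨s⟩⟩
  · refine ⟨⟨fun x => i.vEquiv.symm (t.io x), fun a b h => t.inj (i.vEquiv.symm.injective h),
      fun h => t.rho (i.eEquiv h), ?_, ?_, ?_⟩⟩
    · intro W b hb
      obtain ⟨h, h1, h2⟩ := t.star (i.vEquiv.symm ⁻¹' W) b hb
      obtain ⟨h, rfl⟩ := i.eEquiv.surjective h
      refine ⟨h, h1, ?_⟩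
      rw [iso_crs] at h2
      convert h2
      ext x; simp
    · intro v h1 h2 a b i1 i2 r1 r2 hne
      obtain ⟨x, hx⟩ := t.two (i.vEquiv v) _ _ a b (iso_incident i i1) (iso_incident i i2) r1 r2 hne
      exact ⟨x, by rw [hx]; simp⟩
    · intro x h a hi hr
      have := iso_incident i hi
      simp only [Equiv.apply_symm_apply] at this
      exact t.inc x _ a this hr
  · -- the edge map
    let bar : G.E → Option H.E := fun h =>
      if hh : h = s.e0 then (if h2 : s.e2 = s.e0 then none else some (s.cd.fe.symm ⟨s.e2, h2⟩))
      else some (s.cd.fe.symm ⟨h, hh⟩)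
    have hbar : ∀ h (hh : h ≠ s.e0), bar h = some (s.cd.fe.symm ⟨h, hh⟩) := by
      intro h hh; simp [bar, hh]
    -- incidence transport, at vertices other than v0
    have hinc : ∀ v h h', v ≠ s.v0 → CGraph.Incident G h v → bar h = some h' →
        CGraph.Incident H h' (s.cd.c v) := by
      intro v h h' hv hi hb
      by_cases hh : h = s.e0
      · have hvu : v = s.u0 := by
          rw [hh] at hi
          rcases s.he0 with ⟨h1, h2⟩ | ⟨h1, h2⟩ <;> rcases hi with hi | hi
          · exact absurd (hi.symm.trans h1) hv
          · exact hi.symm.trans h2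
          · exact hi.symm.trans h1
          · exact absurd (hi.symm.trans h2) hv
        by_cases h2 : s.e2 = s.e0
        · simp [bar, hh, h2] at hb
        · simp [bar, hh, h2] at hb
          subst hb
          rw [hvu, ← s.cv0]
          apply cd_incident
          simpa using s.h2
      · rw [hbar h hh] at hb
        obtain rfl := Option.some.inj hb
        apply cd_incident
        simpa using hi
    refine ⟨⟨fun x => s.j (t.io x), fun a b h => t.inj (by
        have := congrArg s.cd.c h
        rwa [s.cj, s.cj] at this), fun h => (bar h).bind t.rho, ?_, ?_, ?_⟩⟩
    · intro W b hb
      obtain ⟨h', h1, h2⟩ := t.star (s.j ⁻¹' W) b hb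
      obtain ⟨⟨h, hh⟩, rfl⟩ : ∃ h, h' = s.cd.fe.symm h := ⟨s.cd.fe h', by simp⟩
      have hh' : h ≠ s.e0 := hh
      have hends := s.cd.ends (s.cd.fe.symm ⟨h, hh⟩)
      simp only [Equiv.apply_symm_apply] at hends
      by_cases hhi : CGraph.Incident G h s.v0
      · have h2e : h = s.e2 := (s.hinc h hhi).resolve_left hh'
        subst h2e
        obtain ⟨u2, hu2, hj2⟩ := other_end s.h2 s.he2
        have hcc : ¬ (s.u0 ∈ W ↔ u2 ∈ W) := by
          unfold Crs at h2
          simp only [Set.mem_preimage] at h2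
          rcases hj2 with ⟨h3, h4⟩ | ⟨h3, h4⟩ <;> rw [h3, h4, s.cv0] at hends <;>
          rcases hends with ⟨h5, h6⟩ | ⟨h5, h6⟩ <;>
          rw [h5, h6, s.jc _ s.hu, s.jc _ hu2] at h2 <;> tauto
        have hb2 : (bar s.e2).bind t.rho = some b := by rw [hbar _ hh']; exact h1
        have hb0 : (bar s.e0).bind t.rho = some b := by simp [bar, hh']; exact h1
        by_cases hc : s.v0 ∈ W ↔ u2 ∈ W
        · refine ⟨s.e0, hb0, ?_⟩
          unfold Crs
          rcases s.he0 with ⟨h3, h4⟩ | ⟨h3, h4⟩ <;> rw [h3, h4] <;> tauto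
        · refine ⟨s.e2, hb2, ?_⟩
          unfold Crs
          rcases hj2 with ⟨h3, h4⟩ | ⟨h3, h4⟩ <;> rw [h3, h4] <;> tauto
      · refine ⟨h, by rw [hbar _ hh']; exact h1, ?_⟩
        unfold CGraph.Incident at hhi
        have n1 : G.src h ≠ s.v0 := by tauto
        have n2 : G.tgt h ≠ s.v0 := by tauto
        unfold Crs at h2 ⊢
        simp only [Set.mem_preimage] at h2
        rcases hends with ⟨h5, h6⟩ | ⟨h5, h6⟩ <;>
          rw [h5, h6, s.jc _ n1, s.jc _ n2] at h2 <;> tauto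
    · intro v h1 h2 a b i1 i2 r1 r2 hne
      by_cases hv : v = s.v0
      · exfalso
        subst hv
        have key : ∀ h, CGraph.Incident G h s.v0 → (bar h).bind t.rho = (bar s.e0).bind t.rho := by
          intro h hi
          rcases s.hinc h hi with rfl | rfl
          · rfl
          · by_cases h2 : s.e2 = s.e0
            · rw [h2]
            · simp [bar, h2]
        rw [key _ i1] at r1
        rw [key _ i2, r1] at r2
        exact hne (Option.some.inj r2)
      · obtain ⟨h1', e1, r1⟩ := Option.bind_eq_some_iff.1 r1
        obtain ⟨h2', e2, r2⟩ := Option.bind_eq_some_iff.1 r2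
        obtain ⟨x, hx⟩ := t.two (s.cd.c v) h1' h2' a b (hinc _ _ _ hv i1 e1) (hinc _ _ _ hv i2 e2) r1 r2 hne
        exact ⟨x, by rw [hx, s.jc _ hv]⟩
    · intro x h a hi hr
      obtain ⟨h', e1, r1⟩ := Option.bind_eq_some_iff.1 hr
      have := hinc _ _ _ (s.jv _) hi e1
      rw [s.cj] at this
      exact t.inc x h' a this r1

theorem exists_tm {X G : CGraph} (h : StabReduces0 G X) : Nonempty (TM X G) := by
  induction h using Relation.ReflTransGen.head_induction_on with
  | refl => exact ⟨TM.refl X⟩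
  | head h1 _ ih => obtain ⟨t⟩ := ih; exact t.back h1

theorem TM.imm {X G : CGraph} (t : TM X G) : Nonempty (Imm X G ∅) := by
  refine ⟨⟨t.io, fun v => if h : ∃ x, t.io x = v then some h.choose else none, t.rho, ?_,
    fun e he => he.elim, fun W _ b hb => t.star W b hb⟩⟩
  intro x
  have hex : ∃ y, t.io y = t.io x := ⟨x, rfl⟩
  simp only [dif_pos hex]
  rw [t.inj hex.choose_spec]

theorem imm_of_red {X G : CGraph} (h : StabReduces0 G X) : Nonempty (Imm X G ∅) := by
  obtain ⟨t⟩ := exists_tm h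
  exact t.imm

/-- uniqueness of the stable model -/
theorem stable_unique {X G K : CGraph} {g : ℕ} (hX : Loopless X) (hst : CGraph.IsStable0 X)
    (hbG : Betti G g) (h1 : StabReduces0 G X) (h2 : StabReduces0 G K)
    (hK : CGraph.IsStable0 K) : Nonempty (CIso K X) := by
  obtain ⟨I⟩ := Imm.red0 hX hst h2 (imm_of_red h1)
  exact imm_iso hX (red_betti h1 hbG) (red_betti h2 hbG) hK I

/-! ### loops -/

theorem wl_crs {G : CGraph} {w : G.V → ℕ} {W : Set G.V} {e : G.E} :
    Crs (withLoops G w) W (Sum.inl e) ↔ Crs G W e := Iff.rfl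

theorem wl_conn {G : CGraph} {w : G.V → ℕ} (h : CGraph.Connected G) :
    CGraph.Connected (withLoops G w) := by
  refine conn_of_cut h.1 fun W u v hu hv => ?_
  obtain ⟨e, he⟩ := conn_cut h hu hv
  exact ⟨Sum.inl e, he⟩

theorem wl_card {G : CGraph} {w : G.V → ℕ} :
    Fintype.card (withLoops G w).V = Fintype.card G.V ∧
    Fintype.card (withLoops G w).E = Fintype.card G.E + ∑ v, w v := by
  constructor
  · rfl
  · change Fintype.card (G.E ⊕ Σ v : G.V, Fin (w v)) = _
    rw [Fintype.card_sum, Fintype.card_sigma]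
    simp

theorem wl_betti_cd {G H : CGraph} {S : Set G.E} (cd : ContractionData G S H) {g : ℕ}
    (hb : Betti G g) : Betti (withLoops H (contractedWeight cd fun _ => 0)) g := by
  unfold Betti at *
  rw [wl_card.1, wl_card.2]
  have h1 : Fintype.card H.E + ∑ y : H.V, (Finset.univ.filter fun e : G.E =>
      e ∈ S ∧ cd.c (G.src e) = y).card = Fintype.card G.E := by
    have := cd_sum cd (fun _ => 1)
    simp only [Finset.sum_const, smul_eq_mul, mul_one, Finset.card_univ] at this
    rw [← this, ← Finset.card_filter]
    congr 1
    rw [← Finset.card_biUnion]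
    · congr 1
      ext e; simp
    · intro a _ b _ hab
      rw [Function.onFun, Finset.disjoint_left]
      intro e h1 h2
      simp at h1 h2
      exact hab (h1.2.symm.trans h2.2)
  have h2 : ∑ y : H.V, (Finset.univ.filter fun u : G.V => cd.c u = y).card = Fintype.card G.V := by
    rw [← Finset.card_eq_sum_card_fiberwise (f := cd.c) (t := Finset.univ) (by simp)]
    simp
  have h3 : ∀ y : H.V, contractedWeight cd (fun _ => 0) y +
      (Finset.univ.filter fun u : G.V => cd.c u = y).card =
      (Finset.univ.filter fun e : G.E => e ∈ S ∧ cd.c (G.src e) = y).card + 1 := by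
    intro y
    have : (Finset.univ.filter fun u : G.V => cd.c u = y).card ≤
        (Finset.univ.filter fun e : G.E => e ∈ S ∧ cd.c (G.src e) = y).card + 1 := by
      apply card_le_of_conn
      · intro e he
        simp at he ⊢
        exact ⟨he.2, by rw [← cd_S cd he.1]; exact he.2⟩
      · rintro W ⟨u, hu, huW⟩ ⟨v, hv, hvW⟩
        simp at hu hv
        by_contra hc
        push Not at hc
        have hr := (cd.fibers u v).1 (hu.trans hv.symm)
        have hsat : Sat G S {x | x ∈ W ∧ cd.c x = y} := by
          intro e he
          simp only [Set.mem_ofPred_eq, ← cd_S cd he]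
          by_cases hy : cd.c (G.src e) = y
          · have := not_crs.1 (hc e (by simp [he, hy]))
            rw [this]
          · simp [hy]
        exact hvW ((sat_sreach hsat hr).1 ⟨huW, hu⟩).1
      · obtain ⟨x, hx⟩ := cd.surj y
        exact ⟨x, by simpa using hx⟩
    unfold contractedWeight
    simp only [Finset.sum_const_zero, zero_add]
    omega
  have h4 : ∑ y : H.V, contractedWeight cd (fun _ => 0) y + Fintype.card G.V =
      ∑ y : H.V, (Finset.univ.filter fun e : G.E => e ∈ S ∧ cd.c (G.src e) = y).card +
        Fintype.card H.V := by
    rw [← h2, ← Finset.sum_add_distrib, Finset.sum_congr rfl (fun y _ => h3 y),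
      Finset.sum_add_distrib]
    simp
  omega

theorem Imm.unloop {X G : CGraph} {w : G.V → ℕ} (h : Nonempty (Imm X (withLoops G w) ∅)) :
    Nonempty (Imm X G ∅) := by
  obtain ⟨I⟩ := h
  refine ⟨⟨I.rep, I.kap, fun e => I.rho (Sum.inl e), I.kr, fun e he => he.elim, ?_⟩⟩
  intro W _ b hb
  obtain ⟨h, h1, h2⟩ := I.star W (fun e he => he.elim) b hb
  rcases h with h | h
  · exact ⟨h, h1, h2⟩
  · exact absurd Iff.rfl h2

theorem Imm.loop {X G : CGraph} {w : G.V → ℕ} (h : Nonempty (Imm X G ∅)) :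
    Nonempty (Imm X (withLoops G w) ∅) := by
  obtain ⟨I⟩ := h
  refine ⟨⟨I.rep, I.kap, fun e => Sum.elim I.rho (fun _ => none) e, I.kr, fun e he => he.elim, ?_⟩⟩
  intro W _ b hb
  obtain ⟨h, h1, h2⟩ := I.star W (fun e he => he.elim) b hb
  exact ⟨Sum.inl h, h1, h2⟩

def wl_zero {G : CGraph} {w : G.V → ℕ} (hw : ∀ v, w v = 0) : CIso (withLoops G w) G where
  vEquiv := Equiv.refl _
  eEquiv :=
    haveI : IsEmpty (Σ v : G.V, Fin (w v)) := ⟨fun q => by have h1 := q.2.2; have h2 := hw q.1; omega⟩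
    Equiv.sumEmpty _ _
  ends := by
    intro e
    rcases e with e | q
    · exact Or.inl ⟨rfl, rfl⟩
    · have h1 := q.2.2; have h2 := hw q.1; omega

end TL


namespace TL

/-! ### Tree facts -/

def Sep (T : CGraph) (e : T.E) (u v : T.V) : Prop := ¬ SReach T {e' | e' ≠ e} u v

theorem sep_symm {T : CGraph} {e : T.E} {u v : T.V} (h : Sep T e u v) : Sep T e v u :=
  fun h1 => h (sreach_symm h1)

theorem tree_sep {T : CGraph} (hT : CGraph.IsTree T) (e : T.E) : Sep T e (T.src e) (T.tgt e) := by
  intro h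
  have h1 := card_le_of_conn (G := T) Finset.univ (Finset.univ.erase e)
    (fun _ _ => ⟨Finset.mem_univ _, Finset.mem_univ _⟩) ?_ ?_
  · have h2 := hT.2
    rw [Finset.card_erase_of_mem (Finset.mem_univ _), Finset.card_univ, Finset.card_univ] at h1
    have : 0 < Fintype.card T.E := Fintype.card_pos_iff.2 ⟨e⟩
    omega
  · rintro W ⟨u, -, hu⟩ ⟨v, -, hv⟩
    by_contra hcon
    push Not at hcon
    have hsat : Sat T {e' | e' ≠ e} W := by
      intro e' he'
      exact not_crs.1 (hcon e' (Finset.mem_erase.2 ⟨he', Finset.mem_univ _⟩))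
    obtain ⟨e1, he1⟩ := conn_cut hT.1 hu hv
    by_cases h3 : e1 = e
    · subst h3
      exact he1 (sat_sreach hsat h)
    · exact he1 (hsat e1 h3)
  · obtain ⟨u⟩ := hT.1.1
    exact ⟨u, Finset.mem_univ _⟩

theorem tree_loopless {T : CGraph} (hT : CGraph.IsTree T) : Loopless T := by
  intro e h
  apply tree_sep hT e
  rw [h]
  exact sreach_refl _

/-! ### Basic facts on trigonal types -/

theorem tt_two (t : TrigonalType) : ∃ x y : t.G.V, x ≠ y := by
  obtain ⟨v⟩ := t.connphi.1
  obtain ⟨e, -, -⟩ := t.nondeg v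
  obtain ⟨x, hx⟩ := t.cover (t.T.src e)
  obtain ⟨y, hy⟩ := t.cover (t.T.tgt e)
  refine ⟨x, y, ?_⟩
  rintro rfl
  exact tree_loopless t.treeT e (hx.symm.trans hy)

theorem wl_dcut {G : CGraph} {w : G.V → ℕ} (W : Set G.V) : dcut (withLoops G w) W = dcut G W := by
  have h0 : dcut (withLoops G w) W = ∑ e : (withLoops G w).E,
      if Crs (withLoops G w) W e then 1 else 0 := by
    unfold dcut; rw [Finset.card_filter]
  have h1 : (∑ e : (withLoops G w).E, if Crs (withLoops G w) W e then 1 else 0) =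
      (∑ e : G.E, if Crs (withLoops G w) W (Sum.inl e) then 1 else 0) +
      ∑ q : (Σ v : G.V, Fin (w v)), if Crs (withLoops G w) W (Sum.inr q) then 1 else 0 :=
    Fintype.sum_sum_type _
  rw [h0, h1]
  have h2 : (∑ q : (Σ v : G.V, Fin (w v)),
      if Crs (withLoops G w) W (Sum.inr q) then 1 else 0) = 0 := by
    apply Finset.sum_eq_zero
    intro q _
    rw [if_neg]
    exact fun h => h Iff.rfl
  rw [h2, add_zero]
  unfold dcut
  rw [Finset.card_filter]
  rfl

theorem wl_tec {G : CGraph} {w : G.V → ℕ} (h : CGraph.ThreeEdgeConnected G) :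
    CGraph.ThreeEdgeConnected (withLoops G w) := by
  rw [tec_iff] at h ⊢
  intro W u v hu hv
  exact (h W u v hu hv).trans (wl_dcut (G := G) (w := w) W).symm.le

theorem tec_stable {G : CGraph} (h : CGraph.ThreeEdgeConnected G) (h2 : ∃ x y : G.V, x ≠ y) :
    CGraph.IsStable0 G := by
  obtain ⟨x, y, hxy⟩ := h2
  rw [tec_iff] at h
  intro v
  have : ∃ u, u ≠ v := by
    by_cases hv : x = v
    · exact ⟨y, fun h => hxy (hv.trans h.symm)⟩
    · exact ⟨x, hv⟩
  obtain ⟨u, hu⟩ := this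
  exact (h {v} v u rfl hu).trans (dcut_le_valence v)

theorem tt_stable (t : TrigonalType) : CGraph.IsStable0 t.G := tec_stable t.threeEC (tt_two t)

theorem tt_wstable (t : TrigonalType) : CGraph.IsStable0 (withLoops t.G t.w) :=
  tec_stable (wl_tec t.threeEC) (tt_two t)

theorem betti_exists {G : CGraph} (h : CGraph.Connected G) : ∃ g, Betti G g :=
  ⟨Fintype.card G.E + 1 - Fintype.card G.V, by
    have := conn_card h
    unfold Betti; omega⟩

theorem betti_unique {G : CGraph} {a b : ℕ} (h1 : Betti G a) (h2 : Betti G b) : a = b := by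
  unfold Betti at *; omega

theorem red_betti' {G H : CGraph} (h : StabReduces0 G H) (hc : CGraph.Connected G) {g : ℕ}
    (hb : Betti H g) : Betti G g := by
  obtain ⟨g', hg'⟩ := betti_exists hc
  rwa [betti_unique hb (red_betti h hg')]

theorem cd_betti' {G H : CGraph} {S : Set G.E} (cd : ContractionData G S H)
    (hc : CGraph.Connected G) {g : ℕ}
    (hb : Betti (withLoops H (contractedWeight cd fun _ => 0)) g) : Betti G g := by
  obtain ⟨g', hg'⟩ := betti_exists hc
  rwa [betti_unique hb (wl_betti_cd cd hg')]

theorem iso_betti {G H : CGraph} (i : CIso G H) {g : ℕ} (hb : Betti G g) : Betti H g := by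
  unfold Betti at *
  rw [← Fintype.card_congr i.vEquiv, ← Fintype.card_congr i.eEquiv]; exact hb

theorem iso_loopless {G H : CGraph} (i : CIso G H) (hl : Loopless G) : Loopless H := by
  intro e he
  obtain ⟨e, rfl⟩ := i.eEquiv.surjective e
  rcases i.ends e with ⟨h1, h2⟩ | ⟨h1, h2⟩ <;>
  · apply hl e
    apply i.vEquiv.injective
    have h1' : i.vEquiv (G.src e) = _ := h1
    have h2' : i.vEquiv (G.tgt e) = _ := h2
    rw [h1', h2', he]

theorem iso_tec {G H : CGraph} (i : CIso G H) (h : CGraph.ThreeEdgeConnected G) :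
    CGraph.ThreeEdgeConnected H := by
  rw [tec_iff] at h ⊢
  intro W u v hu hv
  rw [cd_dcut (CIso.cd i)]
  apply h _ (i.vEquiv.symm u) (i.vEquiv.symm v)
  · simpa [CIso.cd] using hu
  · simpa [CIso.cd] using hv

theorem iso_conn {G H : CGraph} (i : CIso G H) (h : CGraph.Connected G) :
    CGraph.Connected H := cd_conn (CIso.cd i) h

/-- Isomorphic weighted graphs have isomorphic loop graphs. -/
theorem wl_iso {G H : CGraph} {w : G.V → ℕ} {w' : H.V → ℕ} (i : CIso G H)
    (h : ∀ v, w' (i.vEquiv v) = w v) : Nonempty (CIso (withLoops G w) (withLoops H w')) := by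
  refine ⟨⟨i.vEquiv, Equiv.sumCongr i.eEquiv
    (Equiv.sigmaCongr i.vEquiv (fun v => finCongr (h v).symm)), ?_⟩⟩
  intro e
  rcases e with e | q
  · exact i.ends e
  · exact Or.inl ⟨rfl, rfl⟩

theorem wg_betti {G : CGraph} {w : G.V → ℕ} {g : ℕ} (hc : CGraph.Connected G)
    (h : wgenus G w = g) : Betti (withLoops G w) g := by
  have h1 := conn_card hc
  obtain ⟨h2, h3⟩ := wl_card (G := G) (w := w)
  unfold Betti
  rw [h2, h3]
  unfold wgenus at h
  omega

theorem trivalent_loopless {G : CGraph} (h : CGraph.ThreeEdgeConnected G)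
    (h2 : ∃ x y : G.V, x ≠ y) (h3 : ∀ v, CGraph.valence G v ≤ 3) : Loopless G := by
  intro e he
  obtain ⟨x, y, hxy⟩ := h2
  rw [tec_iff] at h
  have : ∃ u, u ≠ G.src e := by
    by_cases hv : x = G.src e
    · exact ⟨y, fun h => hxy (hv.trans h.symm)⟩
    · exact ⟨x, hv⟩
  obtain ⟨u, hu⟩ := this
  have h4 := h {G.src e} (G.src e) u rfl hu
  have h5 := handshake (G := G) {G.src e}
  rw [Finset.sum_singleton, Finset.coe_singleton] at h5
  have h6 : 1 ≤ ein G {G.src e} := by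
    unfold ein
    apply Finset.card_pos.2
    refine ⟨e, ?_⟩
    simp [← he]
  have := h3 (G.src e)
  omega

theorem ladder_max {g : ℕ} {X : WGraph} (hX : IsTrigonalGraph X)
    (hgen : wgenus X.G X.w = g) (hw : ∀ v, X.w v = 0) (hs : CGraph.IsStable0 X.G)
    (hm : ∀ v, CGraph.valence X.G v ≤ 3) : MaximalTrigonal X := by
  refine ⟨hX, ?_⟩
  obtain ⟨t0, i0, hi0⟩ := hX
  have hc : CGraph.Connected X.G := iso_conn i0 t0.conn
  have htec := iso_tec i0 t0.threeEC
  have h2 : ∃ x y : X.G.V, x ≠ y := by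
    obtain ⟨x, y, hxy⟩ := tt_two t0
    exact ⟨i0.vEquiv x, i0.vEquiv y, fun h => hxy (i0.vEquiv.injective h)⟩
  have hl := trivalent_loopless htec h2 hm
  have hb : Betti X.G g := iso_betti (wl_zero hw) (wg_betti hc hgen)
  have hcard := trivalent_card (fun v => le_antisymm (hm v) (hs v)) hb
  rintro Y hY ⟨t, ⟨iY, hiY⟩, S, -, H, cd, t', K, ⟨iX, hiX⟩, hK, hHK, htK⟩
  have hbt' : Betti t'.Gphi g := by
    refine red_betti' t'.stab t'.connphi ?_
    obtain ⟨j⟩ := wl_iso iX hiX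
    exact iso_betti (CIso.symm (CIso.trans j (wl_zero hw))) hb
  have hstab' : StabReduces0 t'.Gphi X.G := by
    obtain ⟨j⟩ := wl_iso iX hiX
    exact red_iso t'.stab (CIso.trans j (wl_zero hw))
  obtain ⟨kX⟩ := stable_unique hl hs hbt' hstab' htK hK
  have hHX := red_iso hHK kX
  obtain ⟨I⟩ := Imm.unloop (imm_of_red hHX)
  obtain ⟨S', I', -⟩ := Imm.red hl hs t.stab _ (Imm.lift cd I)
  have hbG : Betti t.Gphi g := by
    refine cd_betti' cd t.connphi (red_betti' hHX (wl_conn (cd_conn cd t.connphi)) hb)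
  obtain ⟨I'⟩ := I'
  obtain ⟨j⟩ := iso_of_imm_max hl hb hcard (tt_wstable t) (red_betti t.stab hbG) I'
  have hl2 := iso_loopless (CIso.symm j) hl
  have htw : ∀ v, t.w v = 0 := by
    intro v
    by_contra hv
    exact hl2 (Sum.inr ⟨v, ⟨0, Nat.pos_of_ne_zero hv⟩⟩) rfl
  refine ⟨CIso.trans (CIso.symm iY) (CIso.trans (CIso.symm (wl_zero htw)) j), ?_⟩
  intro v
  rw [hw]
  have := hiY (iY.vEquiv.symm v)
  simp only [Equiv.apply_symm_apply] at this
  rw [this, htw]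

/-! ### Ladder data -/

structure LD : Type 1 where
  T : CGraph
  A : Type
  fA : Fintype A
  dA : DecidableEq A
  aV : A → T.V
  aP : A → Fin 3 × Fin 3
  ne : ∀ a, (aP a).1 ≠ (aP a).2

attribute [instance] LD.fA LD.dA

namespace LD

abbrev P (D : LD) : CGraph where
  V := D.T.V × Fin 3
  E := (D.T.E × Fin 3) ⊕ D.A
  fV := inferInstance
  fE := inferInstance
  dV := inferInstance
  dE := inferInstance
  src := fun e => match e with
    | Sum.inl (e, i) => (D.T.src e, i)
    | Sum.inr a => (D.aV a, (D.aP a).1)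
  tgt := fun e => match e with
    | Sum.inl (e, i) => (D.T.tgt e, i)
    | Sum.inr a => (D.aV a, (D.aP a).2)

/-- Number of rungs over a vertex. -/
noncomputable def nr (D : LD) (t : D.T.V) : ℕ :=
  (Finset.univ.filter fun a : D.A => D.aV a = t).card

theorem val (D : LD) (t : D.T.V) (i : Fin 3) :
    CGraph.valence D.P (t, i) = CGraph.valence D.T t +
      (Finset.univ.filter fun a : D.A => D.aV a = t ∧ ((D.aP a).1 = i ∨ (D.aP a).2 = i)).card := by
  have h0 : CGraph.valence D.P (t, i) =
      ∑ q : D.T.E × Fin 3, CGraph.incid D.P (Sum.inl q) (t, i) +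
      ∑ a : D.A, CGraph.incid D.P (Sum.inr a) (t, i) := Fintype.sum_sum_type _
  rw [h0]
  congr 1
  · rw [Fintype.sum_prod_type]
    unfold CGraph.valence
    apply Finset.sum_congr rfl
    intro e _
    rw [Finset.sum_eq_single i]
    · simp [CGraph.incid, P]
    · intro j _ hj
      simp [CGraph.incid, P, hj]
    · simp
  · rw [Finset.card_filter]
    apply Finset.sum_congr rfl
    intro a _
    have := D.ne a
    simp only [CGraph.incid, P, Prod.mk.injEq]
    by_cases h1 : D.aV a = t
    · by_cases h2 : (D.aP a).1 = i
      · have h3 : (D.aP a).2 ≠ i := fun h => this (h2.trans h.symm)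
        simp [h1, h2, h3]
      · simp [h1, h2]
    · simp [h1]

theorem val_le (D : LD) (t : D.T.V) (i : Fin 3) :
    CGraph.valence D.P (t, i) ≤ CGraph.valence D.T t + D.nr t := by
  rw [val]
  gcongr
  unfold nr
  apply Finset.card_le_card
  intro a ha
  simp only [Finset.mem_filter, Finset.mem_univ, true_and] at ha ⊢
  exact ha.1

end LD

theorem conn_val_pos {T : CGraph} (hc : CGraph.Connected T) {u v : T.V} (h : u ≠ v) :
    1 ≤ CGraph.valence T u := by
  obtain ⟨e, he⟩ := conn_cut hc (W := {u}) rfl (fun h' => h (Set.mem_singleton_iff.1 h').symm)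
  refine le_trans ?_ (dcut_le_valence u)
  exact Finset.card_pos.2 ⟨e, Finset.mem_filter.2 ⟨Finset.mem_univ _, he⟩⟩

abbrev LadderWitness.toLD {T H : CGraph} (L : LadderWitness T H) : LD where
  T := T
  A := L.A
  fA := L.fA
  dA := L.dA
  aV := L.aVert
  aP := L.aPair
  ne := L.aPair_ne

def LadderWitness.iso {T H : CGraph} (L : LadderWitness T H) :
    CIso H (LadderWitness.toLD L).P where
  vEquiv := L.vEquiv
  eEquiv := L.eEquiv
  ends := by
    intro e
    obtain ⟨e, rfl⟩ := L.eEquiv.symm.surjective e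
    rcases e with ⟨e, i⟩ | a
    · have := L.ends_copy e i
      simp only [CGraph.endsOf, Sym2.map_mk, Sym2.eq_iff] at this
      have h2 : ∀ q, q = L.eEquiv (L.eEquiv.symm q) := fun q => (L.eEquiv.apply_symm_apply q).symm
      exact h2 _ ▸ this
    · have := L.ends_add a
      simp only [CGraph.endsOf, Sym2.map_mk, Sym2.eq_iff] at this
      have h2 : ∀ q, q = L.eEquiv (L.eEquiv.symm q) := fun q => (L.eEquiv.apply_symm_apply q).symm
      exact h2 _ ▸ this

/-- Valences in a ladder are at most three. -/
theorem ladder_val {T H : CGraph} (L : LadderWitness T H) (hT : 2 ≤ Fintype.card T.V) (v : H.V) :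
    CGraph.valence H v ≤ 3 := by
  rw [← CIso.valence (LadderWitness.iso L)]
  generalize (LadderWitness.iso L).vEquiv v = q
  obtain ⟨t, i⟩ := q
  change T.V at t
  refine (LD.val_le (LadderWitness.toLD L) t i).trans ?_
  have hnr : (LadderWitness.toLD L).nr t =
      (Finset.univ.filter fun a : L.A => L.aVert a = t).card := by
    unfold LD.nr; congr
  rw [hnr]
  change CGraph.valence T t + _ ≤ 3
  have : ∃ s, t ≠ s := by
    by_contra h
    push Not at h
    have := Fintype.card_le_one_iff.2 (fun a b : T.V => (h a).symm.trans (h b))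
    omega
  obtain ⟨s, hs⟩ := this
  have h1 := conn_val_pos L.treeT.1 hs
  have h3 := L.maxval t
  have : CGraph.valence T t = 1 ∨ CGraph.valence T t = 2 ∨ CGraph.valence T t = 3 := by omega
  rcases this with h | h | h
  · rw [h, L.count1 t h]
  · rw [h, L.count2 t h]
  · rw [h, L.count3 t h]

theorem main_back {g : ℕ} (hg : 3 ≤ g) {X : WGraph} (hX : IsTrigonalGraph X)
    (hgen : wgenus X.G X.w = g) (hw : ∀ v, X.w v = 0) (hs : CGraph.IsStable0 X.G)
    (h : ∃ T H, IsThreeLadder T H ∧ Fintype.card T.V = g ∧ StabReduces0 H X.G) :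
    MaximalTrigonal X := by
  obtain ⟨T, H, ⟨L⟩, hT, hH⟩ := h
  exact ladder_max hX hgen hw hs (red_maxval hH (ladder_val L (by omega)))

end TL


namespace TL

/-! ### Weights and loops of maximal graphs -/

def cdId (G : CGraph) : ContractionData G ∅ G := CIso.cd (CIso.refl G)

theorem cdId_weight (G : CGraph) (v : G.V) :
    contractedWeight (cdId G) (fun _ => 0) v = 0 := by
  unfold contractedWeight
  have h1 : (Finset.univ.filter fun u : G.V => (cdId G).c u = v) = {v} := by
    ext u
    simp [cdId, CIso.cd, CIso.refl]
  rw [h1]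
  simp

theorem swap {t t' : TrigonalType} {K : CGraph} (hK : CGraph.IsStable0 K)
    (h : StabReduces0 t.Gphi K) (h' : StabReduces0 t'.Gphi K) {Y X : WGraph}
    (hY : WGIso ⟨t.G, t.w⟩ Y) (hX : WGIso ⟨t'.G, t'.w⟩ X) : TrigContraction Y X := by
  refine ⟨t, hY, ∅, ?_, t.Gphi, cdId _, t', K, hX, hK, ?_, h'⟩
  · intro e1 e2 _; simp
  · exact iso_red (wl_zero (cdId_weight _)) h

theorem wg_refl (X : WGraph) : WGIso X X := ⟨CIso.refl _, fun _ => rfl⟩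

theorem wl_tec' {G : CGraph} {w : G.V → ℕ} (h : CGraph.ThreeEdgeConnected (withLoops G w)) :
    CGraph.ThreeEdgeConnected G := by
  rw [tec_iff] at h ⊢
  intro W u v hu hv
  exact (h W u v hu hv).trans (wl_dcut (G := G) (w := w) W).le

theorem tec_conn {G : CGraph} (h : CGraph.ThreeEdgeConnected G) (h0 : Nonempty G.V) :
    CGraph.Connected G := by
  refine ⟨h0, fun u v => ?_⟩
  obtain ⟨L, hL, -⟩ := h ∅ (by simp) u v
  exact ⟨L, hL⟩

/-- Same covering data, for a different presentation of the stable model. -/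
def reT (t : TrigonalType) (G' : CGraph) (w' : G'.V → ℕ) (hc : CGraph.Connected G')
    (h3 : CGraph.ThreeEdgeConnected G') (j : G'.V ≃ t.G.V)
    (i : CIso (withLoops t.G t.w) (withLoops G' w')) : TrigonalType where
  G := G'
  w := w'
  stable := fun v _ => by
    obtain ⟨x, y, hxy⟩ := tt_two t
    exact tec_stable h3 ⟨j.symm x, j.symm y, fun h => hxy (j.symm.injective h)⟩ v
  conn := hc
  threeEC := h3
  Gphi := t.Gphi
  connphi := t.connphi
  T := t.T
  treeT := t.treeT
  phi := t.phi
  harm := t.harm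
  nondeg := t.nondeg
  deg3 := t.deg3
  stab := red_iso t.stab i
  vG := fun x => t.vG (j x)
  vG_inj := t.vG_inj.comp j.injective
  cover := fun s => by
    obtain ⟨x, hx⟩ := t.cover s
    exact ⟨j.symm x, by simpa using hx⟩

abbrev unloopG (G : CGraph) : CGraph where
  V := G.V
  E := {e : G.E // G.src e ≠ G.tgt e}
  fV := inferInstance
  fE := inferInstance
  dV := inferInstance
  dE := inferInstance
  src := fun e => G.src e.1
  tgt := fun e => G.tgt e.1

noncomputable def nloops (G : CGraph) (v : G.V) : ℕ :=
  Fintype.card {e : {e : G.E // ¬ G.src e ≠ G.tgt e} // G.src e.1 = v}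

theorem unloop_iso (G : CGraph) : Nonempty (CIso (withLoops (unloopG G) (nloops G)) G) := by
  let f : (Σ v : G.V, Fin (nloops G v)) ≃ {e : G.E // ¬ G.src e ≠ G.tgt e} :=
    (Equiv.sigmaCongrRight fun v => (Fintype.equivFin _).symm).trans
      (Equiv.sigmaFiberEquiv fun e : {e : G.E // ¬ G.src e ≠ G.tgt e} => G.src e.1)
  have hf : ∀ q, G.src (f q).1 = q.1 ∧ G.tgt (f q).1 = q.1 := by
    intro q
    have h1 : G.src (f q).1 = q.1 := ((Fintype.equivFin
      {e : {e : G.E // ¬ G.src e ≠ G.tgt e} // G.src e.1 = q.1}).symm q.2).2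
    exact ⟨h1, (not_not.1 (f q).2).symm.trans h1⟩
  refine ⟨⟨Equiv.refl _, (Equiv.sumCongr (Equiv.refl _) f).trans (Equiv.sumCompl _), ?_⟩⟩
  intro e
  rcases e with e | q
  · exact Or.inl ⟨rfl, rfl⟩
  · exact Or.inl ⟨(hf q).1.symm, (hf q).2.symm⟩

theorem max_w0 {X : WGraph} (hM : MaximalTrigonal X) : ∀ v, X.w v = 0 := by
  obtain ⟨⟨t, ht⟩, hmax⟩ := hM
  let t1 := reT t (withLoops t.G t.w) (fun _ => 0) (wl_conn t.conn) (wl_tec t.threeEC)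
    (Equiv.refl _) (CIso.symm (wl_zero fun _ => rfl))
  obtain ⟨i, -⟩ := hmax ⟨t1.G, t1.w⟩ ⟨t1, wg_refl _⟩
    (swap (t := t1) (t' := t) (tt_wstable t) t.stab t.stab (wg_refl ⟨t1.G, t1.w⟩) ht)
  obtain ⟨j, hj⟩ := ht
  have h1 := Fintype.card_congr (CIso.trans i (CIso.symm j)).eEquiv
  have h2 : Fintype.card (withLoops t.G t.w).E = Fintype.card t.G.E := by
    exact h1
  rw [wl_card.2] at h2
  have h3 : ∑ v, t.w v = 0 := by omega
  rw [Finset.sum_eq_zero_iff] at h3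
  intro v
  have := hj (j.vEquiv.symm v)
  simp only [Equiv.apply_symm_apply] at this
  rw [this]
  exact h3 _ (Finset.mem_univ _)

theorem max_loopless {X : WGraph} (hM : MaximalTrigonal X) : Loopless X.G := by
  have hw := max_w0 hM
  obtain ⟨⟨t, ht⟩, hmax⟩ := hM
  have htw : ∀ v, t.w v = 0 := by
    obtain ⟨j, hj⟩ := ht
    intro v
    exact (hj v).symm.trans (hw _)
  obtain ⟨u⟩ := unloop_iso t.G
  have h3 : CGraph.ThreeEdgeConnected (unloopG t.G) := wl_tec' (iso_tec (CIso.symm u) t.threeEC)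
  let t1 := reT t (unloopG t.G) (nloops t.G) (tec_conn h3 t.conn.1) h3
    (Equiv.refl _) (CIso.trans (wl_zero htw) (CIso.symm u))
  obtain ⟨i, hi⟩ := hmax ⟨t1.G, t1.w⟩ ⟨t1, wg_refl _⟩
    (swap (t := t1) (t' := t) (tt_wstable t) t.stab t.stab (wg_refl ⟨t1.G, t1.w⟩) ht)
  obtain ⟨j, hj⟩ := ht
  apply iso_loopless j
  intro e he
  have h1 := hi (t.G.src e)
  rw [hw] at h1
  have h2 : nloops t.G (t.G.src e) = 0 := h1.symm
  unfold nloops at h2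
  rw [Fintype.card_eq_zero_iff] at h2
  exact h2.false ⟨⟨e, not_not.2 he⟩, rfl⟩

end TL


namespace TL

/-! ### Sides of a tree edge -/

def sd (T : CGraph) (e : T.E) (v : T.V) : Prop := SReach T {e' | e' ≠ e} (T.src e) v

theorem sd_src (T : CGraph) (e : T.E) : sd T e (T.src e) := sreach_refl _

theorem sd_tgt {T : CGraph} (hT : CGraph.IsTree T) (e : T.E) : ¬ sd T e (T.tgt e) := tree_sep hT e

theorem sd_edge {T : CGraph} {e e1 : T.E} (h : e1 ≠ e) : sd T e (T.src e1) ↔ sd T e (T.tgt e1) :=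
  sreach_sat {e' | e' ≠ e} (T.src e) e1 h

theorem sd_or {T : CGraph} (hT : CGraph.IsTree T) (e : T.E) (v : T.V) :
    sd T e v ∨ SReach T {e' | e' ≠ e} (T.tgt e) v := by
  by_contra h
  push Not at h
  obtain ⟨e1, he1⟩ := conn_cut hT.1
    (W := {v | sd T e v ∨ SReach T {e' | e' ≠ e} (T.tgt e) v}) (u := T.src e) (v := v)
    (Or.inl (sd_src T e)) (fun h' => h'.elim h.1 h.2)
  apply he1
  by_cases h1 : e1 = e
  · subst h1
    exact ⟨fun _ => Or.inr (sreach_refl _), fun _ => Or.inl (sd_src T _)⟩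
  · have h2 := sd_edge h1
    have h3 := sreach_sat {e' | e' ≠ e} (T.tgt e) e1 h1
    exact or_congr h2 h3

theorem sep_iff {T : CGraph} (hT : CGraph.IsTree T) {e : T.E} {u v : T.V} :
    Sep T e u v ↔ ¬ (sd T e u ↔ sd T e v) := by
  unfold Sep
  rw [not_iff_not]
  constructor
  · intro h
    exact ⟨fun h1 => sreach_trans h1 h, fun h1 => sreach_trans h1 (sreach_symm h)⟩
  · intro h
    by_cases h1 : sd T e u
    · exact sreach_trans (sreach_symm h1) (h.1 h1)
    · have h2 : ¬ sd T e v := fun h3 => h1 (h.2 h3)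
      exact sreach_trans (sreach_symm ((sd_or hT e u).resolve_left h1))
        ((sd_or hT e v).resolve_left h2)

theorem sd_inc {T : CGraph} {e e1 : T.E} (h : e1 ≠ e) {u v : T.V} (hu : CGraph.Incident T e1 u)
    (hv : CGraph.Incident T e1 v) : sd T e u ↔ sd T e v := by
  have := sd_edge h
  rcases hu with rfl | rfl <;> rcases hv with rfl | rfl
  · exact Iff.rfl
  · exact this
  · exact this.symm
  · exact Iff.rfl

theorem inc_other {T : CGraph} (hT : CGraph.IsTree T) {e : T.E} {t : T.V}
    (h : CGraph.Incident T e t) : ∃ s, CGraph.Incident T e s ∧ s ≠ t ∧ Sep T e t s := by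
  rcases h with rfl | rfl
  · exact ⟨T.tgt e, Or.inr rfl, (tree_loopless hT e).symm, tree_sep hT e⟩
  · exact ⟨T.src e, Or.inl rfl, tree_loopless hT e, sep_symm (tree_sep hT e)⟩

theorem sep_ends {T : CGraph} (hT : CGraph.IsTree T) {e : T.E} {s t : T.V}
    (h : CGraph.Incident T e t) (hs : CGraph.Incident T e s) (hne : s ≠ t) : Sep T e t s := by
  rcases h with rfl | rfl <;> rcases hs with rfl | rfl
  · exact absurd rfl hne
  · exact tree_sep hT e
  · exact sep_symm (tree_sep hT e)
  · exact absurd rfl hne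

/-- Two edges at `t` cannot both separate `t` from `u`. -/
theorem sep_excl {T : CGraph} (hT : CGraph.IsTree T) {e1 e2 : T.E} (hne : e1 ≠ e2) {t u : T.V}
    (h1 : CGraph.Incident T e1 t) (h2 : CGraph.Incident T e2 t) (hs1 : Sep T e1 t u)
    (hs2 : Sep T e2 t u) : False := by
  obtain ⟨e, he⟩ := conn_cut hT.1 (W := {v | Sep T e1 t v ∧ Sep T e2 t v}) (u := u) (v := t)
    ⟨hs1, hs2⟩ (fun h => h.1 (sreach_refl _))
  apply he
  simp only [Set.mem_ofPred_eq, sep_iff hT]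
  by_cases he1 : e = e1
  · subst he1
    have h3 := sd_inc (e := e2) hne h1 (Or.inl rfl : CGraph.Incident T e (T.src e))
    have h4 := sd_inc (e := e2) hne h1 (Or.inr rfl : CGraph.Incident T e (T.tgt e))
    tauto
  · by_cases he2 : e = e2
    · subst he2
      have h3 := sd_inc (e := e1) hne.symm h2 (Or.inl rfl : CGraph.Incident T e (T.src e))
      have h4 := sd_inc (e := e1) hne.symm h2 (Or.inr rfl : CGraph.Incident T e (T.tgt e))
      tauto
    · have h3 := sd_edge (T := T) he1
      have h4 := sd_edge (T := T) he2
      rw [h3, h4]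

theorem sep_path {T : CGraph} (hT : CGraph.IsTree T) (u v : T.V) :
    SReach T {e | Sep T e u v} u v := by
  have hex : ∃ n, ∃ F : Finset T.E, F.card = n ∧ SReach T (F : Set T.E) u v :=
    ⟨_, Finset.univ, rfl, by
      rw [Finset.coe_univ]; exact (conn_iff.1 hT.1).2 u v⟩
  obtain ⟨F, hFc, hF⟩ := Nat.find_spec hex
  have hmin := fun n => Nat.find_min hex (m := n)
  refine sreach_mono ?_ hF
  intro e he
  have he' : e ∈ F := he
  have hno : ¬ SReach T ((F.erase e : Finset T.E) : Set T.E) u v := by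
    intro h
    refine hmin (F.erase e).card ?_ ⟨_, rfl, h⟩
    rw [← hFc]
    exact Finset.card_erase_lt_of_mem he'
  have hsub : ((F.erase e : Finset T.E) : Set T.E) ⊆ {e' | e' ≠ e} := by
    intro a ha
    exact (Finset.mem_erase.1 ha).1
  have key : ∀ a b, SReach T (F : Set T.E) a b →
      ¬ SReach T ((F.erase e : Finset T.E) : Set T.E) a b →
      Crs T {w | SReach T ((F.erase e : Finset T.E) : Set T.E) a w} e := by
    intro a b hab hnab hcon
    apply hnab
    have hsat : Sat T (F : Set T.E) {w | SReach T ((F.erase e : Finset T.E) : Set T.E) a w} := by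
      intro e1 he1
      by_cases h : e1 = e
      · subst h; exact hcon
      · exact sreach_sat _ _ e1 (Finset.mem_coe.2 (Finset.mem_erase.2 ⟨h, he1⟩))
    exact (sat_sreach hsat hab).1 (sreach_refl _)
  have k1 := key u v hF hno
  have k2 := key v u (sreach_symm hF) (fun h => hno (sreach_symm h))
  have hdis : ∀ w, SReach T ((F.erase e : Finset T.E) : Set T.E) u w →
      SReach T ((F.erase e : Finset T.E) : Set T.E) v w → False :=
    fun w h1 h2 => hno (sreach_trans h1 (sreach_symm h2))
  have hs := tree_sep hT e
  intro hcon
  unfold Crs at k1 k2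
  simp only [Set.mem_ofPred_eq] at k1 k2
  by_cases h1 : SReach T ((F.erase e : Finset T.E) : Set T.E) u (T.src e)
  · have h2 : SReach T ((F.erase e : Finset T.E) : Set T.E) v (T.tgt e) := by
      by_contra h3
      have := hdis _ h1
      tauto
    exact hs (sreach_trans (sreach_symm (sreach_mono hsub h1))
      (sreach_trans hcon (sreach_mono hsub h2)))
  · have h1' : SReach T ((F.erase e : Finset T.E) : Set T.E) u (T.tgt e) := by tauto
    have h2 : SReach T ((F.erase e : Finset T.E) : Set T.E) v (T.src e) := by
      by_contra h3
      have := hdis _ h1'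
      tauto
    exact hs (sreach_trans (sreach_symm (sreach_mono hsub h2))
      (sreach_trans (sreach_symm hcon) (sreach_mono hsub h1')))

theorem sep_exists {T : CGraph} (hT : CGraph.IsTree T) {t u : T.V} (h : t ≠ u) :
    ∃ e, CGraph.Incident T e t ∧ Sep T e t u := by
  by_contra hcon
  push Not at hcon
  have hsat : Sat T {e | Sep T e t u} {t} := by
    intro e he
    by_contra hc
    exact hcon e (crs_single hc) he
  exact h ((sat_sreach hsat (sep_path hT t u)).1 rfl).symm

/-! ### Layouts -/

noncomputable def Cr {X T : CGraph} (f : X.V → T.V) (e : T.E) : Finset X.E :=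
  Finset.univ.filter fun b => Sep T e (f (X.src b)) (f (X.tgt b))

theorem mem_Cr {X T : CGraph} {f : X.V → T.V} {e : T.E} {b : X.E} :
    b ∈ Cr f e ↔ Sep T e (f (X.src b)) (f (X.tgt b)) := by simp [Cr]

noncomputable def aCr {X T : CGraph} (f : X.V → T.V) (x : X.V) (e : T.E) : ℕ :=
  ((Cr f e).filter fun b => CGraph.Incident X b x).card

structure Layout (X T : CGraph) (f : X.V → T.V) : Prop where
  tree : CGraph.IsTree T
  p1 : ∀ e, (Cr f e).card ≤ 3
  p2 : ∀ t, (Finset.univ.filter fun x => f x = t).card ≤ 3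
  p3 : ∀ x e, CGraph.Incident T e (f x) → (Cr f e).Nonempty → 1 ≤ aCr f x e
  p4 : ∀ x e1 e2, e1 ≠ e2 → CGraph.Incident T e1 (f x) → CGraph.Incident T e2 (f x) →
    (Cr f e1).Nonempty → (Cr f e2).Nonempty → aCr f x e1 = aCr f x e2
  p5 : ∀ t e1 e2 b, CGraph.Incident T e1 t → CGraph.Incident T e2 t → b ∈ Cr f e1 →
    (Cr f e2).Nonempty → f (X.src b) ≠ t → f (X.tgt b) ≠ t → b ∈ Cr f e2

theorem Cr_crs {X T : CGraph} (hT : CGraph.IsTree T) {f : X.V → T.V} {e : T.E} {b : X.E} :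
    b ∈ Cr f e ↔ Crs X {x | sd T e (f x)} b := by
  rw [mem_Cr, sep_iff hT]; rfl

theorem Cr_card {X T : CGraph} (hT : CGraph.IsTree T) {f : X.V → T.V} {e : T.E} :
    (Cr f e).card = dcut X {x | sd T e (f x)} := by
  unfold dcut
  congr 1
  ext b
  rw [Cr_crs hT]; simp

/-- If vertices lie on both sides there are at least three crossing edges. -/
theorem Cr_three {X T : CGraph} (hX : CGraph.ThreeEdgeConnected X) (hT : CGraph.IsTree T)
    {f : X.V → T.V} {e : T.E} {x y : X.V} (h : Sep T e (f x) (f y)) : 3 ≤ (Cr f e).card := by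
  rw [Cr_card hT]
  rw [sep_iff hT] at h
  rw [tec_iff] at hX
  by_cases h1 : sd T e (f x)
  · exact hX _ x y h1 (fun h2 => h ⟨fun _ => h2, fun _ => h1⟩)
  · exact hX _ y x (by by_contra h2; exact h ⟨fun h3 => absurd h3 h1, fun h3 => absurd h3 h2⟩) h1

end TL


namespace TL

/-! ### The layout of a trigonal type -/

section
variable {G T : CGraph} (φ : CMorphism G T)

theorem over_sep (hT : CGraph.IsTree T) {h : G.E} {e : T.E} (ho : φ.eMap h = Sum.inl e) :
    Sep T e (φ.vMap (G.src h)) (φ.vMap (G.tgt h)) := by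
  rcases φ.edge_ok h e ho with ⟨h1, h2⟩ | ⟨h1, h2⟩
  · rw [h1, h2]; exact tree_sep hT e
  · rw [h1, h2]; exact sep_symm (tree_sep hT e)

theorem sep_over (hT : CGraph.IsTree T) {h : G.E} {e : T.E}
    (hs : Sep T e (φ.vMap (G.src h)) (φ.vMap (G.tgt h))) : φ.eMap h = Sum.inl e := by
  rcases hm : φ.eMap h with e1 | v
  · by_cases h1 : e1 = e
    · rw [h1]
    · exfalso
      have h2 := sd_edge h1
      rw [sep_iff hT] at hs
      rcases φ.edge_ok h e1 hm with ⟨h3, h4⟩ | ⟨h3, h4⟩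
      · rw [h3, h4] at hs; exact hs h2
      · rw [h3, h4] at hs; exact hs h2.symm
  · exfalso
    obtain ⟨h1, h2⟩ := φ.contract_ok h v hm
    rw [h1, h2] at hs
    exact hs (sreach_refl _)

theorem over_mu {h : G.E} {e : T.E} (ho : φ.eMap h = Sum.inl e) : 1 ≤ φ.mu h := by
  rcases Nat.eq_zero_or_pos (φ.mu h) with h0 | h0
  · obtain ⟨v, hv⟩ := (φ.mu_zero h).1 h0
    rw [hv] at ho; cases ho
  · exact h0

noncomputable def ov (e : T.E) : Finset G.E := Finset.univ.filter fun h => φ.eMap h = Sum.inl e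

theorem ov_sum (hd : φ.HasDegree 3) (e : T.E) : ∑ h ∈ ov φ e, φ.mu h = 3 := by
  have := hd e
  rw [← this]
  unfold ov
  rw [Finset.sum_filter]

theorem ov_card (hd : φ.HasDegree 3) (e : T.E) : (ov φ e).card ≤ 3 := by
  rw [← ov_sum φ hd e, Finset.card_eq_sum_ones]
  apply Finset.sum_le_sum
  intro h hh
  exact over_mu φ (Finset.mem_filter.1 hh).2

theorem locDeg_ov (v : G.V) (e : T.E) :
    φ.locDeg v e = ∑ h ∈ ov φ e, φ.mu h * CGraph.incid G h v := by
  unfold CMorphism.locDeg ov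
  rw [Finset.sum_filter]

theorem locDeg_pos {v : G.V} {e : T.E} :
    1 ≤ φ.locDeg v e ↔ ∃ h, φ.eMap h = Sum.inl e ∧ CGraph.Incident G h v := by
  constructor
  · intro h
    rw [locDeg_ov] at h
    obtain ⟨a, ha, h1⟩ := Finset.exists_ne_zero_of_sum_ne_zero (by omega :
      ∑ h ∈ ov φ e, φ.mu h * CGraph.incid G h v ≠ 0)
    refine ⟨a, (Finset.mem_filter.1 ha).2, ?_⟩
    by_contra hc
    rw [incid_zero.2 hc] at h1
    simp at h1
  · rintro ⟨a, ha, hi⟩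
    rw [locDeg_ov]
    have hm : a ∈ ov φ e := Finset.mem_filter.2 ⟨Finset.mem_univ _, ha⟩
    refine le_trans ?_ (Finset.single_le_sum (fun _ _ => Nat.zero_le _) hm)
    have h1 := over_mu φ ha
    have h2 : CGraph.incid G a v ≠ 0 := fun h => incid_zero.1 h hi
    exact Nat.mul_pos h1 (Nat.pos_of_ne_zero h2)

/-- Edges over `e` are not loops, so incidence is 0 or 1. -/
theorem over_incid (hT : CGraph.IsTree T) {h : G.E} {e : T.E} (ho : φ.eMap h = Sum.inl e)
    (v : G.V) : CGraph.incid G h v = if CGraph.Incident G h v then 1 else 0 := by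
  have h1 := over_sep φ hT ho
  have hne : G.src h ≠ G.tgt h := by
    intro hh; rw [hh] at h1; exact h1 (sreach_refl _)
  unfold CGraph.incid CGraph.Incident
  by_cases h2 : G.src h = v
  · have h3 : G.tgt h ≠ v := fun h3 => hne (h2.trans h3.symm)
    simp [h2, h3]
  · simp [h2]

theorem over_end {h : G.E} {e : T.E} (ho : φ.eMap h = Sum.inl e) {t : T.V}
    (hi : CGraph.Incident T e t) : ∃ u, CGraph.Incident G h u ∧ φ.vMap u = t := by
  rcases φ.edge_ok h e ho with ⟨h3, h4⟩ | ⟨h3, h4⟩ <;> rcases hi with hi | hi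
  · exact ⟨_, Or.inl rfl, h3.trans hi⟩
  · exact ⟨_, Or.inr rfl, h4.trans hi⟩
  · exact ⟨_, Or.inr rfl, h4.trans hi⟩
  · exact ⟨_, Or.inl rfl, h3.trans hi⟩

theorem over_end_unique (hT : CGraph.IsTree T) {h : G.E} {e : T.E} (ho : φ.eMap h = Sum.inl e)
    {u v : G.V} (hu : CGraph.Incident G h u) (hv : CGraph.Incident G h v)
    (huv : φ.vMap u = φ.vMap v) : u = v := by
  have h1 := over_sep φ hT ho
  rcases hu with rfl | rfl <;> rcases hv with rfl | rfl
  · rfl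
  · rw [huv] at h1; exact absurd (sreach_refl _) h1
  · rw [huv] at h1; exact absurd (sreach_refl _) h1
  · rfl

theorem fibre_card (hT : CGraph.IsTree T) (hh : φ.Harmonic) (hn : φ.Nondegenerate)
    (hd : φ.HasDegree 3) (t : T.V) : (Finset.univ.filter fun v => φ.vMap v = t).card ≤ 3 := by
  by_cases hne : ∃ v, φ.vMap v = t
  · obtain ⟨v0, rfl⟩ := hne
    obtain ⟨e, he, -⟩ := hn v0
    have hpos : ∀ v, φ.vMap v = φ.vMap v0 →
        ∃ h, φ.eMap h = Sum.inl e ∧ CGraph.Incident G h v := by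
      intro v hv
      obtain ⟨e1, he1, h1⟩ := hn v
      rw [← locDeg_pos, hh v e e1 (hv ▸ he) he1]
      exact h1
    haveI : Nonempty G.E := ⟨(hpos v0 rfl).choose⟩
    choose! σ hσ1 hσ2 using hpos
    refine le_trans ?_ (ov_card φ hd e)
    apply Finset.card_le_card_of_injOn σ
    · intro v hv
      have hv' := (Finset.mem_filter.1 hv).2
      exact Finset.mem_filter.2 ⟨Finset.mem_univ _, hσ1 v hv'⟩
    · intro a ha b hb hab
      have ha' := (Finset.mem_filter.1 ha).2
      have hb' := (Finset.mem_filter.1 hb).2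
      exact over_end_unique φ hT (hσ1 a ha') (hσ2 a ha') (hab ▸ hσ2 b hb') (ha'.trans hb'.symm)
  · rw [Finset.filter_false_of_mem]
    · simp
    · intro v _ hv
      exact hne ⟨v, hv⟩

end

theorem layout_aux {X G T : CGraph} (φ : CMorphism G T) (hT : CGraph.IsTree T) (hh : φ.Harmonic)
    (hn : φ.Nondegenerate) (hd : φ.HasDegree 3) (hX : CGraph.ThreeEdgeConnected X) (t : TM X G)
    (hv : Nonempty G.V) :
    Layout X T (fun x => φ.vMap (t.io x)) := by
  set f : X.V → T.V := fun x => φ.vMap (t.io x) with hf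
  have hlab : ∀ e b, b ∈ Cr f e → ∃ h, h ∈ ov φ e ∧ t.rho h = some b := by
    intro e b hb
    rw [Cr_crs hT] at hb
    obtain ⟨h, h1, h2⟩ := t.star {v | sd T e (φ.vMap v)} b hb
    refine ⟨h, Finset.mem_filter.2 ⟨Finset.mem_univ _, sep_over φ hT ?_⟩, h1⟩
    rw [sep_iff hT]; exact h2
  haveI : Nonempty G.E := by
    obtain ⟨v⟩ := hv
    obtain ⟨e, -, h⟩ := hn v
    exact ⟨((locDeg_pos φ).1 h).choose⟩
  choose! σ hσ1 hσ2 using hlab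
  have hinj : ∀ e, Set.InjOn (σ e) (Cr f e : Set X.E) := by
    intro e a ha b hb hab
    have h1 := hσ2 e a ha
    have h2 := hσ2 e b hb
    rw [hab, h2] at h1
    exact (Option.some.inj h1).symm
  have hp1 : ∀ e, (Cr f e).card ≤ 3 := fun e =>
    (Finset.card_le_card_of_injOn (σ e) (fun b hb => hσ1 e b hb) (hinj e)).trans (ov_card φ hd e)
  have h3 : ∀ e, (Cr f e).Nonempty → (Cr f e).card = 3 := by
    rintro e ⟨b, hb⟩
    exact le_antisymm (hp1 e) (Cr_three hX hT (mem_Cr.1 hb))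
  -- all edges over a crossed edge are labelled
  have hB : ∀ e, (Cr f e).Nonempty → ∀ h ∈ ov φ e, ∃ b ∈ Cr f e, σ e b = h := by
    intro e he h hh
    have himg : (Cr f e).image (σ e) = ov φ e := by
      apply Finset.eq_of_subset_of_card_le
      · intro a ha
        obtain ⟨b, hb, rfl⟩ := Finset.mem_image.1 ha
        exact hσ1 e b hb
      · rw [Finset.card_image_of_injOn (hinj e), h3 e he]
        exact ov_card φ hd e
    rw [← himg] at hh
    exact Finset.mem_image.1 hh
  have hB1 : ∀ e, (Cr f e).Nonempty → ∀ h ∈ ov φ e, ∃ b ∈ Cr f e, t.rho h = some b := by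
    intro e he h hh
    obtain ⟨b, hb, rfl⟩ := hB e he h hh
    exact ⟨b, hb, hσ2 e b hb⟩
  have hB2 : ∀ e, (Cr f e).Nonempty → ∀ h ∈ ov φ e, ∀ h' ∈ ov φ e, t.rho h = t.rho h' →
      h = h' := by
    intro e he h hh h' hh' hr
    obtain ⟨b, hb, rfl⟩ := hB e he h hh
    obtain ⟨b', hb', rfl⟩ := hB e he h' hh'
    rw [hσ2 e b hb, hσ2 e b' hb'] at hr
    rw [Option.some.inj hr]
  have hmu : ∀ e, (Cr f e).Nonempty → ∀ h ∈ ov φ e, φ.mu h = 1 := by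
    intro e he
    have hc : (ov φ e).card = 3 := by
      refine le_antisymm (ov_card φ hd e) ?_
      rw [← h3 e he]
      exact Finset.card_le_card_of_injOn (σ e) (fun b hb => hσ1 e b hb) (hinj e)
    have hs := ov_sum φ hd e
    have hle : ∀ h ∈ ov φ e, 1 ≤ φ.mu h := fun h hh => over_mu φ (Finset.mem_filter.1 hh).2
    have heq : ∑ h ∈ ov φ e, 1 = ∑ h ∈ ov φ e, φ.mu h := by
      rw [hs, Finset.sum_const, hc]; rfl
    intro h hh
    exact ((Finset.sum_eq_sum_iff_of_le hle).1 heq h hh).symm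
  have hov : ∀ {e h}, h ∈ ov φ e ↔ φ.eMap h = Sum.inl e := by
    intro e h; simp [ov]
  have hpos : ∀ x e, CGraph.Incident T e (f x) →
      ∃ h, h ∈ ov φ e ∧ CGraph.Incident G h (t.io x) := by
    intro x e he
    obtain ⟨e1, he1, h1⟩ := hn (t.io x)
    rw [hh (t.io x) e1 e he1 he, locDeg_pos] at h1
    obtain ⟨h, h2, h4⟩ := h1
    exact ⟨h, hov.2 h2, h4⟩
  -- propagation at a vertex outside X
  have hfree : ∀ (u : G.V) (e1 e2 : T.E) (h : G.E) (b : X.E), (∀ x, t.io x ≠ u) →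
      CGraph.Incident T e1 (φ.vMap u) → CGraph.Incident T e2 (φ.vMap u) → h ∈ ov φ e1 →
      CGraph.Incident G h u → t.rho h = some b → (Cr f e2).Nonempty → b ∈ Cr f e2 := by
    intro u e1 e2 h b hu he1 he2 hho hhu hr hne
    have h1 : 1 ≤ φ.locDeg u e1 := (locDeg_pos φ).2 ⟨h, hov.1 hho, hhu⟩
    rw [hh u e1 e2 he1 he2, locDeg_pos] at h1
    obtain ⟨h', h2, h4⟩ := h1
    obtain ⟨b', hb', hr'⟩ := hB1 e2 hne h' (hov.2 h2)
    by_cases hbb : b = b'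
    · rw [hbb]; exact hb'
    · obtain ⟨x, hx⟩ := t.two u h h' b b' hhu h4 hr hr' hbb
      exact absurd hx (hu x)
  refine ⟨hT, hp1, ?_, ?_, ?_, ?_⟩
  · intro s
    refine le_trans ?_ (fibre_card φ hT hh hn hd s)
    apply Finset.card_le_card_of_injOn t.io
    · intro x hx
      exact Finset.mem_filter.2 ⟨Finset.mem_univ _, (Finset.mem_filter.1 hx).2⟩
    · exact t.inj.injOn
  · intro x e he hne
    obtain ⟨h, h1, h2⟩ := hpos x e he
    obtain ⟨b, hb, hr⟩ := hB1 e hne h h1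
    exact Finset.card_pos.2 ⟨b, Finset.mem_filter.2 ⟨hb, t.inc x h b h2 hr⟩⟩
  · -- equality of multiplicities
    have key : ∀ x e1 e2, e1 ≠ e2 → CGraph.Incident T e1 (f x) → CGraph.Incident T e2 (f x) →
        (Cr f e1).Nonempty → (Cr f e2).Nonempty → aCr f x e1 = φ.locDeg (t.io x) e1 := by
      intro x e1 e2 hne he1 he2 hn1 hn2
      have h1 : φ.locDeg (t.io x) e1 =
          ((ov φ e1).filter fun h => CGraph.Incident G h (t.io x)).card := by
        rw [locDeg_ov, Finset.card_filter]
        apply Finset.sum_congr rfl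
        intro h hh
        rw [hmu e1 hn1 h hh, one_mul, over_incid φ hT (hov.1 hh)]
      rw [h1]
      apply Finset.card_bij (fun b _ => σ e1 b)
      · intro b hb
        obtain ⟨hb1, hb2⟩ := Finset.mem_filter.1 hb
        refine Finset.mem_filter.2 ⟨hσ1 e1 b hb1, ?_⟩
        obtain ⟨u, hu1, hu2⟩ := over_end φ (hov.1 (hσ1 e1 b hb1)) he1
        by_cases hux : u = t.io x
        · rw [← hux]; exact hu1
        · exfalso
          by_cases hfr : ∃ x', t.io x' = u
          · obtain ⟨x', rfl⟩ := hfr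
            have h5 := t.inc x' _ b hu1 (hσ2 e1 b hb1)
            have hxx : x' ≠ x := fun h => hux (by rw [h])
            have hs := mem_Cr.1 hb1
            have hfx : f x' = f x := hu2
            rcases hb2 with hb2 | hb2 <;> rcases h5 with h5 | h5
            · exact hxx (h5.symm.trans hb2)
            · rw [hb2, h5, hfx] at hs; exact hs (sreach_refl _)
            · rw [hb2, h5, hfx] at hs; exact hs (sreach_refl _)
            · exact hxx (h5.symm.trans hb2)
          · push Not at hfr
            have h6 := hfree u e1 e2 _ b hfr (hu2.symm ▸ he1) (hu2.symm ▸ he2) (hσ1 e1 b hb1) hu1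
              (hσ2 e1 b hb1) hn2
            have hs1 := mem_Cr.1 hb1
            have hs2 := mem_Cr.1 h6
            rcases hb2 with hb2 | hb2
            · rw [hb2] at hs1 hs2
              exact sep_excl hT hne he1 he2 hs1 hs2
            · rw [hb2] at hs1 hs2
              exact sep_excl hT hne he1 he2 (sep_symm hs1) (sep_symm hs2)
      · intro a ha b hb hab
        exact hinj e1 (Finset.mem_filter.1 ha).1 (Finset.mem_filter.1 hb).1 hab
      · intro h hh
        obtain ⟨h5, h6⟩ := Finset.mem_filter.1 hh
        obtain ⟨b, hb, rfl⟩ := hB e1 hn1 h h5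
        exact ⟨b, Finset.mem_filter.2 ⟨hb, t.inc x _ b h6 (hσ2 e1 b hb)⟩, rfl⟩
    intro x e1 e2 hne he1 he2 hn1 hn2
    rw [key x e1 e2 hne he1 he2 hn1 hn2, key x e2 e1 hne.symm he2 he1 hn2 hn1]
    exact hh _ _ _ he1 he2
  · intro s e1 e2 b he1 he2 hb hn2 hs1 hs2
    obtain ⟨u, hu1, hu2⟩ := over_end φ (hov.1 (hσ1 e1 b hb)) he1
    refine hfree u e1 e2 (σ e1 b) b ?_ (hu2.symm ▸ he1) (hu2.symm ▸ he2) (hσ1 e1 b hb) hu1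
      (hσ2 e1 b hb) hn2
    rintro x rfl
    rcases t.inc x _ b hu1 (hσ2 e1 b hb) with h | h
    · exact hs1 (by rw [h]; exact hu2)
    · exact hs2 (by rw [h]; exact hu2)

theorem layout_of_type (t : TrigonalType) (hw : ∀ v, t.w v = 0) :
    ∃ f : t.G.V → t.T.V, Layout t.G t.T f := by
  obtain ⟨m⟩ := exists_tm (red_iso t.stab (wl_zero hw))
  exact ⟨_, layout_aux t.phi t.treeT t.harm t.nondeg t.deg3 t.threeEC m t.connphi.1⟩

/-! ### Transport of layouts along isomorphisms of the source -/

theorem layout_iso {X X' T : CGraph} (i : CIso X X') {f : X.V → T.V} (L : Layout X T f) :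
    Layout X' T (fun x => f (i.vEquiv.symm x)) := by
  have hCr : ∀ e b, i.eEquiv b ∈ Cr (X := X') (fun x => f (i.vEquiv.symm x)) e ↔ b ∈ Cr f e := by
    intro e b
    rw [mem_Cr, mem_Cr]
    rcases i.ends b with ⟨h1, h2⟩ | ⟨h1, h2⟩
    · rw [← h1, ← h2]; simp
    · rw [← h1, ← h2]; simp only [Equiv.symm_apply_apply]
      exact ⟨sep_symm, sep_symm⟩
  have hCr' : ∀ e, Cr (X := X') (fun x => f (i.vEquiv.symm x)) e =
      (Cr f e).map i.eEquiv.toEmbedding := by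
    intro e
    ext b
    obtain ⟨b, rfl⟩ := i.eEquiv.surjective b
    rw [hCr]; simp
  have hinc : ∀ b x, CGraph.Incident X' (i.eEquiv b) x ↔ CGraph.Incident X b (i.vEquiv.symm x) := by
    intro b x
    constructor
    · intro h
      have := iso_incident (CIso.symm i) h
      simpa [CIso.symm] using this
    · intro h
      have := iso_incident i h
      simpa using this
  have ha : ∀ x e, aCr (X := X') (fun x => f (i.vEquiv.symm x)) x e =
      aCr f (i.vEquiv.symm x) e := by
    intro x e
    unfold aCr
    rw [hCr', Finset.filter_map, Finset.card_map]
    congr 1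
    ext b
    simp [hinc]
  have hne : ∀ e, (Cr (X := X') (fun x => f (i.vEquiv.symm x)) e).Nonempty ↔
      (Cr f e).Nonempty := by
    intro e; rw [hCr', Finset.map_nonempty]
  refine ⟨L.tree, ?_, ?_, ?_, ?_, ?_⟩
  · intro e; rw [hCr', Finset.card_map]; exact L.p1 e
  · intro s
    refine le_trans ?_ (L.p2 s)
    apply Finset.card_le_card_of_injOn i.vEquiv.symm
    · intro x hx
      exact Finset.mem_filter.2 ⟨Finset.mem_univ _, (Finset.mem_filter.1 hx).2⟩
    · exact i.vEquiv.symm.injective.injOn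
  · intro x e he hn
    rw [ha]; exact L.p3 _ e he ((hne e).1 hn)
  · intro x e1 e2 h12 he1 he2 hn1 hn2
    rw [ha, ha]; exact L.p4 _ e1 e2 h12 he1 he2 ((hne e1).1 hn1) ((hne e2).1 hn2)
  · intro s e1 e2 b he1 he2 hb hn2 hs1 hs2
    obtain ⟨b, rfl⟩ := i.eEquiv.surjective b
    rw [hCr] at hb ⊢
    refine L.p5 s e1 e2 b he1 he2 hb ((hne e2).1 hn2) ?_ ?_
    all_goals
      rcases i.ends b with ⟨h1, h2⟩ | ⟨h1, h2⟩
      · rw [← h1] at hs1; rw [← h2] at hs2; simp at hs1 hs2; assumption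
      · rw [← h1] at hs2; rw [← h2] at hs1; simp at hs1 hs2; assumption

end TL


namespace TL

/-! ### Contracting tree vertices not in the image -/

theorem sreach_single {T : CGraph} {e : T.E} {u v : T.V} (h : SReach T {e} u v) :
    u = v ∨ (CGraph.Incident T e u ∧ CGraph.Incident T e v) := by
  have key : ∀ a b, SReach T {e} a b → a ≠ b → CGraph.Incident T e a := by
    intro a b hab hne
    by_contra hc
    have hsat : Sat T {e} {a} := by
      intro e1 he1
      rw [Set.mem_singleton_iff] at he1
      subst he1
      exact not_crs.1 (fun h => hc (crs_single h))
    exact hne ((sat_sreach hsat hab).1 rfl).symm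
  by_cases huv : u = v
  · exact Or.inl huv
  · exact Or.inr ⟨key u v h huv, key v u (sreach_symm h) (Ne.symm huv)⟩

section
variable {T T' : CGraph} {e' : T.E} (cd : ContractionData T {e'} T')

theorem cd1_eq {u v : T.V} : cd.c u = cd.c v ↔
    u = v ∨ (CGraph.Incident T e' u ∧ CGraph.Incident T e' v) := by
  rw [cd.fibers]
  constructor
  · exact sreach_single
  · rintro (rfl | ⟨h1, h2⟩)
    · exact sreach_refl _
    · have h3 : e' ∈ ({e'} : Set T.E) := rfl
      rcases h1 with rfl | rfl <;> rcases h2 with rfl | rfl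
      · exact sreach_refl _
      · exact sreach_edge h3
      · exact sreach_edge' h3
      · exact sreach_refl _

theorem cd1_cardE {T T' : CGraph} {e' : T.E} (cd : ContractionData T {e'} T') : Fintype.card T'.E + 1 = Fintype.card T.E := by
  rw [Fintype.card_congr cd.fe]
  have h1 : Fintype.card {e : T.E // e ∉ ({e'} : Set T.E)} = Fintype.card T.E - 1 := by
    have := Fintype.card_subtype_compl (fun e : T.E => e = e')
    rw [Fintype.card_subtype_eq] at this
    rw [← this]
    apply Fintype.card_congr
    exact Equiv.subtypeEquivRight (fun e => Iff.rfl)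
  have : 0 < Fintype.card T.E := Fintype.card_pos_iff.2 ⟨e'⟩
  omega

theorem cd1_tree {T T' : CGraph} {e' : T.E} (cd : ContractionData T {e'} T') (hT : CGraph.IsTree T) : CGraph.IsTree T' ∧
    Fintype.card T'.V + 1 = Fintype.card T.V := by
  have h1 := cd1_cardE cd
  have h2 := cd_conn cd hT.1
  have h3 := conn_card h2
  have h4 := hT.2
  have h5 : (Finset.univ.erase (T.src e')).card ≤ (Finset.univ : Finset T'.V).card := by
    apply Finset.card_le_card_of_injOn cd.c
    · intro _ _; simp
    · intro a ha b hb hab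
      rcases (cd1_eq cd).1 hab with h | ⟨ha1, hb1⟩
      · exact h
      · have ha2 := (Finset.mem_erase.1 ha).1
        have hb2 := (Finset.mem_erase.1 hb).1
        exact (ha1.resolve_left (Ne.symm ha2)).symm.trans (hb1.resolve_left (Ne.symm hb2))
  rw [Finset.card_erase_of_mem (Finset.mem_univ _), Finset.card_univ, Finset.card_univ] at h5
  have h6 : Fintype.card T'.V + 1 = Fintype.card T.V := by omega
  exact ⟨⟨h2, by omega⟩, h6⟩

theorem cd1_sep {e : T'.E} {u v : T.V} :
    Sep T' e (cd.c u) (cd.c v) ↔ Sep T (cd.fe e).1 u v := by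
  unfold Sep
  rw [not_iff_not]
  have hfe : ∀ e2 : T'.E, (cd.fe e2).1 ≠ e' := fun e2 h => (cd.fe e2).2 h
  constructor
  · intro h
    set W : Set T.V := {w | SReach T {e1 | e1 ≠ (cd.fe e).1} u w} with hW
    have hsat := sreach_sat {e1 | e1 ≠ (cd.fe e).1} u
    have hpre : cd.c ⁻¹' (cd.c '' W) = W := by
      ext w
      constructor
      · rintro ⟨w', hw', hc⟩
        have h1 := (cd.fibers w' w).1 hc
        have h2 : Sat T {e'} W := by
          intro e1 he1
          rw [Set.mem_singleton_iff] at he1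
          subst he1
          exact hsat _ (hfe e).symm
        exact (sat_sreach h2 h1).1 hw'
      · intro hw; exact ⟨w, hw, rfl⟩
    have hsat' : Sat T' {e1 | e1 ≠ e} (cd.c '' W) := by
      intro e2 he2
      apply not_crs.1
      rw [cd_crs cd, hpre, not_crs]
      exact hsat _ (fun h => he2 (cd.fe.injective (Subtype.ext h)))
    have h1 := (sat_sreach hsat' h).1 ⟨u, sreach_refl _, rfl⟩
    have h2 : v ∈ cd.c ⁻¹' (cd.c '' W) := h1
    rw [hpre] at h2
    exact h2
  · intro h
    rw [sreach_iff] at h ⊢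
    intro W hW hu
    refine h (cd.c ⁻¹' W) ?_ hu
    intro e1 he1
    by_cases h1 : e1 = e'
    · subst h1
      have := cd_S cd (e := e1) rfl
      simp only [Set.mem_preimage, this]
    · obtain ⟨e2, he2⟩ := cd.fe.surjective ⟨e1, h1⟩
      have h3 : (cd.fe e2).1 = e1 := by rw [he2]
      have h4 : e2 ≠ e := fun h => he1 (by rw [← h3, h])
      have h5 := hW e2 h4
      have h6 := not_crs.2 h5
      rw [cd_crs cd, h3] at h6
      exact not_crs.1 h6

theorem cd1_inc {e : T'.E} {t : T'.V} (h : CGraph.Incident T' e t) :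
    ∃ u, cd.c u = t ∧ CGraph.Incident T (cd.fe e).1 u := by
  rcases cd.ends e with ⟨h1, h2⟩ | ⟨h1, h2⟩ <;> rcases h with rfl | rfl
  · exact ⟨_, h1.symm, Or.inl rfl⟩
  · exact ⟨_, h2.symm, Or.inr rfl⟩
  · exact ⟨_, h1.symm, Or.inr rfl⟩
  · exact ⟨_, h2.symm, Or.inl rfl⟩

end

theorem Cr_beyond {X T : CGraph} (hT : CGraph.IsTree T) {f : X.V → T.V} {e : T.E} {b : X.E}
    (hb : b ∈ Cr f e) (u : T.V) : ∃ y, Sep T e u (f y) := by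
  have h := mem_Cr.1 hb
  simp only [sep_iff hT] at *
  by_cases h1 : (sd T e u ↔ sd T e (f (X.src b)))
  · exact ⟨X.tgt b, by tauto⟩
  · exact ⟨X.src b, h1⟩

theorem layout_contract {X T T' : CGraph} (hX : CGraph.ThreeEdgeConnected X) {f : X.V → T.V}
    (L : Layout X T f) {s : T.V} (hs : ∀ x, f x ≠ s) {e' : T.E} (he' : CGraph.Incident T e' s)
    (cd : ContractionData T {e'} T') : Layout X T' (fun x => cd.c (f x)) := by
  have hT := L.tree
  have hfe : ∀ e2 : T'.E, (cd.fe e2).1 ≠ e' := fun e2 h => (cd.fe e2).2 h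
  have hCr : ∀ e, Cr (fun x => cd.c (f x)) e = Cr f (cd.fe e).1 := by
    intro e
    ext b
    rw [mem_Cr, mem_Cr, cd1_sep cd]
  have ha : ∀ x e, aCr (fun x => cd.c (f x)) x e = aCr f x (cd.fe e).1 := by
    intro x e; unfold aCr; rw [hCr]
  have core : ∀ e1 x, e1 ≠ e' → CGraph.Incident T e1 s → (Cr f e1).Nonempty →
      Sep T e' s (f x) → (Cr f e').Nonempty ∧ Cr f e1 = Cr f e' := by
    rintro e1 x hne h1 ⟨b, hb⟩ hsep
    obtain ⟨y, hy⟩ := Cr_beyond hT hb s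
    have hy2 : ¬ Sep T e' s (f y) := fun h => sep_excl hT hne h1 he' hy h
    have hsep2 : Sep T e' (f x) (f y) := by
      rw [sep_iff hT] at *; tauto
    have hne' : (Cr f e').Nonempty := by
      rw [← Finset.card_pos]
      have := Cr_three hX hT hsep2
      omega
    refine ⟨hne', ?_⟩
    ext b'
    exact ⟨fun h => L.p5 s e1 e' b' h1 he' h hne' (hs _) (hs _),
      fun h => L.p5 s e' e1 b' he' h1 h ⟨b, hb⟩ (hs _) (hs _)⟩
  -- an edge at the image of `x` is either at `f x` or parallel to the contracted edge
  have alt : ∀ x e, CGraph.Incident T' e (cd.c (f x)) → (Cr f (cd.fe e).1).Nonempty →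
      CGraph.Incident T (cd.fe e).1 (f x) ∨ (CGraph.Incident T e' (f x) ∧ (Cr f e').Nonempty ∧
        Cr f (cd.fe e).1 = Cr f e') := by
    intro x e he hne
    obtain ⟨u, hu, hi⟩ := cd1_inc cd he
    rcases (cd1_eq cd).1 hu with rfl | ⟨h1, h2⟩
    · exact Or.inl hi
    · by_cases hux : u = f x
      · rw [hux] at hi; exact Or.inl hi
      · right
        have hus : u = s := by
          have h3 := hs x
          have h4 : ∀ w, CGraph.Incident T e' w → w = T.src e' ∨ w = T.tgt e' :=
            fun w hw => hw.imp Eq.symm Eq.symm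
          rcases h4 _ h1 with h5 | h5 <;> rcases h4 _ h2 with h6 | h6 <;>
            rcases h4 _ he' with h7 | h7 <;> simp_all
        subst hus
        exact ⟨h2, core _ x (hfe e) hi hne (sep_ends hT he' h2 (hs x))⟩
  refine ⟨(cd1_tree cd hT).1, ?_, ?_, ?_, ?_, ?_⟩
  · intro e; rw [hCr]; exact L.p1 _
  · intro t
    by_cases hne : ∃ x, cd.c (f x) = t
    · obtain ⟨x, rfl⟩ := hne
      refine le_trans ?_ (L.p2 (f x))
      apply Finset.card_le_card
      intro y hy
      have hy' := (Finset.mem_filter.1 hy).2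
      refine Finset.mem_filter.2 ⟨Finset.mem_univ _, ?_⟩
      rcases (cd1_eq cd).1 hy' with h | ⟨h1, h2⟩
      · exact h
      · have h3 := hs x
        have h3' := hs y
        have h4 : ∀ w, CGraph.Incident T e' w → w = T.src e' ∨ w = T.tgt e' :=
          fun w hw => hw.imp Eq.symm Eq.symm
        rcases h4 _ h1 with h5 | h5 <;> rcases h4 _ h2 with h6 | h6 <;>
          rcases h4 _ he' with h7 | h7 <;> simp_all
    · rw [Finset.filter_false_of_mem]
      · simp
      · intro v _ hv
        exact hne ⟨v, hv⟩
  · intro x e he hne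
    rw [hCr] at hne
    rw [ha]
    rcases alt x e he hne with h | ⟨h1, h2, h3⟩
    · exact L.p3 x _ h hne
    · unfold aCr; rw [h3]; exact L.p3 x e' h1 h2
  · intro x e1 e2 h12 he1 he2 hn1 hn2
    rw [hCr] at hn1 hn2
    rw [ha, ha]
    have h12' : (cd.fe e1).1 ≠ (cd.fe e2).1 :=
      fun h => h12 (cd.fe.injective (Subtype.ext h))
    rcases alt x e1 he1 hn1 with h | ⟨h1, h2, h3⟩ <;>
      rcases alt x e2 he2 hn2 with k | ⟨k1, k2, k3⟩
    · exact L.p4 x _ _ h12' h k hn1 hn2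
    · have := L.p4 x _ e' (hfe e1) h k1 hn1 k2
      rw [this]; unfold aCr; rw [k3]
    · have := L.p4 x e' _ (hfe e2).symm h1 k h2 hn2
      rw [← this]; unfold aCr; rw [h3]
    · unfold aCr; rw [h3, k3]
  · intro t e1 e2 b he1 he2 hb hn2 hs1 hs2
    rw [hCr] at hb hn2 ⊢
    obtain ⟨u1, hu1, hi1⟩ := cd1_inc cd he1
    obtain ⟨u2, hu2, hi2⟩ := cd1_inc cd he2
    have d1 : ∀ x u, cd.c u = t → cd.c (f x) ≠ t → f x ≠ u := by
      intro x u h1 h2 h3; exact h2 (by rw [h3, h1])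
    rcases (cd1_eq cd).1 (hu1.trans hu2.symm) with h | ⟨h1, h2⟩
    · subst h
      exact L.p5 u1 _ _ b hi1 hi2 hb hn2 (d1 _ _ hu1 hs1) (d1 _ _ hu1 hs2)
    · by_cases hu12 : u1 = u2
      · subst hu12
        exact L.p5 u1 _ _ b hi1 hi2 hb hn2 (d1 _ _ hu1 hs1) (d1 _ _ hu1 hs2)
      · have hne' : (Cr f e').Nonempty := by
          obtain ⟨b2, hb2⟩ := hn2
          obtain ⟨y1, hy1⟩ := Cr_beyond hT hb u1
          obtain ⟨y2, hy2⟩ := Cr_beyond hT hb2 u2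
          have k1 : ¬ Sep T e' u1 (f y1) := fun h => sep_excl hT (hfe e1) hi1 h1 hy1 h
          have k2 : ¬ Sep T e' u2 (f y2) := fun h => sep_excl hT (hfe e2) hi2 h2 hy2 h
          have k3 := sep_ends hT h1 h2 (Ne.symm hu12)
          have k4 : Sep T e' (f y1) (f y2) := by
            rw [sep_iff hT] at k1 k2 k3 ⊢; tauto
          rw [← Finset.card_pos]
          have := Cr_three hX hT k4
          omega
        have hb' := L.p5 u1 _ e' b hi1 h1 hb hne' (d1 _ _ hu1 hs1) (d1 _ _ hu1 hs2)
        exact L.p5 u2 e' _ b h2 hi2 hb' hn2 (d1 _ _ hu2 hs1) (d1 _ _ hu2 hs2)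

theorem layout_surj {X : CGraph} (hX : CGraph.ThreeEdgeConnected X) (hne : Nonempty X.V) (n : ℕ) :
    ∀ (T : CGraph) (f : X.V → T.V), Fintype.card T.V = n → Layout X T f →
      ∃ (T' : CGraph) (f' : X.V → T'.V), Layout X T' f' ∧ Function.Surjective f' := by
  induction n with
  | zero =>
    intro T f hc L
    obtain ⟨x⟩ := hne
    rw [Fintype.card_eq_zero_iff] at hc
    exact (hc.false (f x)).elim
  | succ n ih =>
    intro T f hc L
    by_cases hsur : Function.Surjective f
    · exact ⟨T, f, L, hsur⟩
    · unfold Function.Surjective at hsur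
      push Not at hsur
      obtain ⟨s, hs⟩ := hsur
      obtain ⟨x⟩ := hne
      obtain ⟨e', he', -⟩ := sep_exists L.tree (Ne.symm (hs x))
      obtain ⟨T', ⟨cd⟩⟩ := exists_cd T {e'}
      have h1 := (cd1_tree cd L.tree).2
      exact ih T' _ (by omega) (layout_contract hX L hs he' cd)

end TL


namespace TL

/-! ### Sheets -/

/-- The item of the crossing edge `b` over the tree vertex `t`. -/
noncomputable def itm {X T : CGraph} (f : X.V → T.V) (t : T.V) (b : X.E) : X.V ⊕ X.E :=
  if f (X.src b) = t then Sum.inl (X.src b) else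
    if f (X.tgt b) = t then Sum.inl (X.tgt b) else Sum.inr b

theorem Cr_ne {X T : CGraph} {f : X.V → T.V} {e : T.E} {b : X.E} (h : b ∈ Cr f e) :
    f (X.src b) ≠ f (X.tgt b) := by
  intro h1
  rw [mem_Cr, h1] at h
  exact h (sreach_refl _)

theorem itm_inl {X T : CGraph} {f : X.V → T.V} {e : T.E} {b : X.E} (h : b ∈ Cr f e) {t : T.V}
    {x : X.V} : itm f t b = Sum.inl x ↔ f x = t ∧ CGraph.Incident X b x := by
  have h1 := Cr_ne h
  unfold itm CGraph.Incident
  split_ifs with h2 h3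
  · rw [Sum.inl.injEq]
    constructor
    · rintro rfl; exact ⟨h2, Or.inl rfl⟩
    · rintro ⟨h4, h5 | h5⟩
      · exact h5
      · subst h5; exact absurd (h2.trans h4.symm) h1
  · rw [Sum.inl.injEq]
    constructor
    · rintro rfl; exact ⟨h3, Or.inr rfl⟩
    · rintro ⟨h4, h5 | h5⟩
      · subst h5; exact absurd h4 h2
      · exact h5
  · constructor
    · intro h; cases h
    · rintro ⟨h4, h5 | h5⟩
      · subst h5; exact absurd h4 h2
      · subst h5; exact absurd h4 h3

theorem itm_inr {X T : CGraph} {f : X.V → T.V} {b b' : X.E} {t : T.V} :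
    itm f t b = Sum.inr b' ↔ b = b' ∧ f (X.src b) ≠ t ∧ f (X.tgt b) ≠ t := by
  unfold itm
  split_ifs with h2 h3 <;> simp_all

theorem local_bij {X T : CGraph} {f : X.V → T.V} (L : Layout X T f)
    (hne : ∀ e, (Cr f e).Nonempty) {t : T.V} {e1 e2 : T.E} (h12 : e1 ≠ e2)
    (h1 : CGraph.Incident T e1 t) (h2 : CGraph.Incident T e2 t) :
    ∃ σ : Cr f e1 ≃ Cr f e2, ∀ b, itm f t (σ b).1 = itm f t b.1 := by
  have key : ∀ c, Nonempty ({b : Cr f e1 // itm f t b.1 = c} ≃ {b : Cr f e2 // itm f t b.1 = c}) := by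
    rintro (x | b)
    · by_cases hx : f x = t
      · have h4 := L.p4 x e1 e2 h12 (hx ▸ h1) (hx ▸ h2) (hne _) (hne _)
        have cnt : ∀ e, Nonempty ({b : Cr f e // itm f t b.1 = Sum.inl x} ≃
            ((Cr f e).filter fun b => CGraph.Incident X b x)) := by
          intro e
          exact ⟨{ toFun := fun b => ⟨b.1.1, Finset.mem_filter.2 ⟨b.1.2, ((itm_inl b.1.2).1 b.2).2⟩⟩
                   invFun := fun b => ⟨⟨b.1, (Finset.mem_filter.1 b.2).1⟩,
                     (itm_inl (Finset.mem_filter.1 b.2).1).2 ⟨hx, (Finset.mem_filter.1 b.2).2⟩⟩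
                   left_inv := fun b => rfl
                   right_inv := fun b => rfl }⟩
        obtain ⟨c1⟩ := cnt e1
        obtain ⟨c2⟩ := cnt e2
        exact ⟨c1.trans ((Finset.equivOfCardEq h4).trans c2.symm)⟩
      · have emp : ∀ e, IsEmpty {b : Cr f e // itm f t b.1 = Sum.inl x} := fun e =>
          ⟨fun b => hx ((itm_inl b.1.2).1 b.2).1⟩
        have := emp e1
        have := emp e2
        exact ⟨Equiv.equivOfIsEmpty _ _⟩
    · refine ⟨{ toFun := fun q => ⟨⟨q.1.1, ?_⟩, q.2⟩
                invFun := fun q => ⟨⟨q.1.1, ?_⟩, q.2⟩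
                left_inv := fun q => rfl
                right_inv := fun q => rfl }⟩
      · have h3 := itm_inr.1 q.2
        exact L.p5 t e1 e2 q.1.1 h1 h2 q.1.2 (hne _) h3.2.1 h3.2.2
      · have h3 := itm_inr.1 q.2
        exact L.p5 t e2 e1 q.1.1 h2 h1 q.1.2 (hne _) h3.2.1 h3.2.2
  let φ := fun c => Classical.choice (key c)
  exact ⟨Equiv.ofFiberEquiv φ, fun b => Equiv.ofFiberEquiv_map φ b⟩

theorem lab_exists {X T : CGraph} {f : X.V → T.V} (L : Layout X T f)
    (h3 : ∀ e, (Cr f e).card = 3) :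
    ∃ lab : ∀ e, Fin 3 ≃ Cr f e, ∀ t e1 e2, CGraph.Incident T e1 t → CGraph.Incident T e2 t →
      ∀ i, itm f t (lab e1 i).1 = itm f t (lab e2 i).1 := by
  have hne : ∀ e, (Cr f e).Nonempty := fun e => by rw [← Finset.card_pos, h3]; norm_num
  have hT := L.tree
  -- grow a connected vertex set
  have key : ∀ n, n ≤ Fintype.card T.V → 1 ≤ n → ∃ U : Finset T.V, U.card = n ∧
      (∀ u ∈ U, ∀ v ∈ U, SReach T {e | T.src e ∈ U ∧ T.tgt e ∈ U} u v) ∧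
      ∃ lab : ∀ e, Fin 3 ≃ Cr f e, ∀ t ∈ U, ∀ e1 e2, CGraph.Incident T e1 t →
        CGraph.Incident T e2 t → ∀ i, itm f t (lab e1 i).1 = itm f t (lab e2 i).1 := by
    have step : ∀ (U : Finset T.V) (s : T.V) (e0 : T.E) (lab : ∀ e, Fin 3 ≃ Cr f e),
        CGraph.Incident T e0 s →
        ∃ lab' : ∀ e, Fin 3 ≃ Cr f e, (∀ e, (e = e0 ∨ ¬ CGraph.Incident T e s) → lab' e = lab e) ∧
        ∀ e1 e2, CGraph.Incident T e1 s →
        CGraph.Incident T e2 s → ∀ i, itm f s (lab' e1 i).1 = itm f s (lab' e2 i).1 := by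
      intro U s e0 lab h0
      have : ∀ e, ∃ l : Fin 3 ≃ Cr f e, ((e = e0 ∨ ¬ CGraph.Incident T e s) → l = lab e) ∧
          (CGraph.Incident T e s → ∀ i, itm f s (l i).1 = itm f s (lab e0 i).1) := by
        intro e
        by_cases he : e = e0
        · subst he; exact ⟨lab e, fun _ => rfl, fun _ _ => rfl⟩
        · by_cases hi : CGraph.Incident T e s
          · obtain ⟨σ, hσ⟩ := local_bij L hne (Ne.symm he) h0 hi
            refine ⟨(lab e0).trans σ, fun h => ?_, fun _ i => hσ _⟩
            rcases h with h | h
            · exact absurd h he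
            · exact absurd hi h
          · exact ⟨lab e, fun _ => rfl, fun h => absurd h hi⟩
      choose l hl1 hl2 using this
      exact ⟨l, hl1, fun e1 e2 h1 h2 i => (hl2 e1 h1 i).trans (hl2 e2 h2 i).symm⟩
    intro n
    induction n with
    | zero => intro _ h; omega
    | succ n ih =>
      intro hn _
      have hlab0 : ∃ lab : ∀ e, Fin 3 ≃ Cr f e, True :=
        ⟨fun e => (Finset.equivFinOfCardEq (h3 e)).symm, trivial⟩
      obtain ⟨lab0, -⟩ := hlab0
      rcases Nat.eq_zero_or_pos n with rfl | hpos
      · obtain ⟨t0⟩ := hT.1.1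
        by_cases hE : ∃ e0, CGraph.Incident T e0 t0
        · obtain ⟨e0, h0⟩ := hE
          obtain ⟨lab', -, hl⟩ := step ∅ t0 e0 lab0 h0
          refine ⟨{t0}, rfl, ?_, lab', ?_⟩
          · intro u hu v hv
            rw [Finset.mem_singleton] at hu hv; subst hu; subst hv; exact sreach_refl _
          · intro t ht; rw [Finset.mem_singleton] at ht; subst ht; exact hl
        · refine ⟨{t0}, rfl, ?_, lab0, ?_⟩
          · intro u hu v hv
            rw [Finset.mem_singleton] at hu hv; subst hu; subst hv; exact sreach_refl _
          · intro t ht e1 _ he1; rw [Finset.mem_singleton] at ht; subst ht; exact absurd ⟨e1, he1⟩ hE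
      · obtain ⟨U, hU, hUc, lab, hl⟩ := ih (by omega) hpos
        obtain ⟨u, hu⟩ := Finset.card_pos.1 (hU ▸ hpos)
        obtain ⟨v, hv⟩ : ∃ v, v ∉ U := by
          by_contra h; push Not at h
          have : U = Finset.univ := Finset.eq_univ_iff_forall.2 h
          rw [this, Finset.card_univ] at hU; omega
        obtain ⟨e0, he0⟩ := conn_cut hT.1 (W := (U : Set T.V)) (u := u) (v := v) hu hv
        obtain ⟨s, w, hs, hw, hsi, hwi⟩ : ∃ s w, s ∉ U ∧ w ∈ U ∧ CGraph.Incident T e0 s ∧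
            CGraph.Incident T e0 w := by
          have he0' : ¬ (T.src e0 ∈ U ↔ T.tgt e0 ∈ U) := he0
          by_cases h : T.src e0 ∈ U
          · exact ⟨T.tgt e0, T.src e0, by tauto, h, Or.inr rfl, Or.inl rfl⟩
          · exact ⟨T.src e0, T.tgt e0, h, by tauto, Or.inl rfl, Or.inr rfl⟩
        obtain ⟨lab', hl1, hl2⟩ := step U s e0 lab hsi
        have huniq : ∀ e z, CGraph.Incident T e s → CGraph.Incident T e z → z ∈ U → e = e0 := by
          intro e z hes hez hz
          by_contra hne0
          have h1 : SReach T {e' | e' ≠ e0} s z := by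
            have : e ∈ {e' | e' ≠ e0} := hne0
            rcases hes with rfl | rfl <;> rcases hez with rfl | rfl
            · exact sreach_refl _
            · exact sreach_edge this
            · exact sreach_edge' this
            · exact sreach_refl _
          have h2 : SReach T {e' | e' ≠ e0} z w := by
            refine sreach_mono ?_ (hUc z hz w hw)
            intro e' he'
            rintro rfl
            rcases hsi with rfl | rfl
            · exact hs he'.1
            · exact hs he'.2
          exact sep_ends hT hsi hwi (by rintro rfl; exact hs hw) (sreach_trans h1 h2)
        refine ⟨insert s U, by rw [Finset.card_insert_of_notMem hs, hU], ?_, lab', ?_⟩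
        · have hsw : SReach T {e | T.src e ∈ insert s U ∧ T.tgt e ∈ insert s U} s w := by
            have hmem : e0 ∈ {e | T.src e ∈ insert s U ∧ T.tgt e ∈ insert s U} := by
              have hsw : s ≠ w := by rintro rfl; exact hs hw
              constructor
              · rcases hsi with h | h
                · rw [h]; exact Finset.mem_insert_self _ _
                · rcases hwi with h' | h'
                  · rw [h']; exact Finset.mem_insert_of_mem hw
                  · exact absurd (h.symm.trans h') hsw
              · rcases hsi with h | h
                · rcases hwi with h' | h'
                  · exact absurd (h.symm.trans h') hsw
                  · rw [h']; exact Finset.mem_insert_of_mem hw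
                · rw [h]; exact Finset.mem_insert_self _ _
            rcases hsi with rfl | rfl <;> rcases hwi with rfl | rfl
            · exact sreach_refl _
            · exact sreach_edge hmem
            · exact sreach_edge' hmem
            · exact sreach_refl _
          have hcw : ∀ a ∈ insert s U, SReach T {e | T.src e ∈ insert s U ∧ T.tgt e ∈ insert s U} a w := by
            intro a ha
            rcases Finset.mem_insert.1 ha with rfl | ha
            · exact hsw
            · refine sreach_mono ?_ (hUc a ha w hw)
              intro e he
              exact ⟨Finset.mem_insert_of_mem he.1, Finset.mem_insert_of_mem he.2⟩
          intro a ha b hb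
          exact sreach_trans (hcw a ha) (sreach_symm (hcw b hb))
        · intro t ht e1 e2 he1 he2 i
          rcases Finset.mem_insert.1 ht with rfl | ht
          · exact hl2 e1 e2 he1 he2 i
          · have : ∀ e, CGraph.Incident T e t → lab' e = lab e := by
              intro e he
              apply hl1
              by_cases h : CGraph.Incident T e s
              · exact Or.inl (huniq e t h he ht)
              · exact Or.inr h
            rw [this e1 he1, this e2 he2]
            exact hl t ht e1 e2 he1 he2 i
  have hpos : 1 ≤ Fintype.card T.V := Fintype.card_pos_iff.2 hT.1.1
  obtain ⟨U, hU, -, lab, hl⟩ := key _ le_rfl hpos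
  have hUu : U = Finset.univ := Finset.eq_univ_of_card U hU
  exact ⟨lab, fun t => hl t (hUu ▸ Finset.mem_univ t)⟩

structure Sheet (X T : CGraph) (f : X.V → T.V) where
  lab : ∀ e, Fin 3 ≃ Cr f e
  kp : T.V → Fin 3 → Option X.V
  s1 : ∀ t i x, kp t i = some x → f x = t
  s2 : ∀ x, ∃ i, kp (f x) i = some x
  s3 : ∀ e t, CGraph.Incident T e t → ∀ i x, f x = t →
    (kp t i = some x ↔ CGraph.Incident X (lab e i).1 x)
  s4 : ∀ e1 e2 t, CGraph.Incident T e1 t → CGraph.Incident T e2 t → ∀ i, kp t i = none →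
    (lab e1 i).1 = (lab e2 i).1
  s5 : ∀ t, (∀ e, ¬ CGraph.Incident T e t) → ∀ i, kp t i ≠ none

theorem sheet_exists {X T : CGraph} {f : X.V → T.V} (hX : CGraph.ThreeEdgeConnected X)
    (L : Layout X T f) (hs : Function.Surjective f) : Nonempty (Sheet X T f) := by
  have hT := L.tree
  have h3 : ∀ e, (Cr f e).card = 3 := by
    intro e
    apply le_antisymm (L.p1 e)
    obtain ⟨x, hx⟩ := hs (T.src e)
    obtain ⟨y, hy⟩ := hs (T.tgt e)
    apply Cr_three hX hT (x := x) (y := y)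
    rw [hx, hy]; exact tree_sep hT e
  have hne : ∀ e, (Cr f e).Nonempty := fun e => by rw [← Finset.card_pos, h3]; norm_num
  obtain ⟨lab, hl⟩ := lab_exists L h3
  have hk : ∀ t, ∃ k : Fin 3 → Option X.V, (∀ i x, k i = some x → f x = t) ∧
      (∀ x, f x = t → ∃ i, k i = some x) ∧
      (∀ e, CGraph.Incident T e t → ∀ i x, f x = t →
        (k i = some x ↔ CGraph.Incident X (lab e i).1 x)) ∧
      (∀ e1 e2, CGraph.Incident T e1 t → CGraph.Incident T e2 t → ∀ i, k i = none →
        (lab e1 i).1 = (lab e2 i).1) ∧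
      ((∀ e, ¬ CGraph.Incident T e t) → ∀ i, k i ≠ none) := by
    intro t
    by_cases hE : ∃ e, CGraph.Incident T e t
    · obtain ⟨e0, he0⟩ := hE
      have hsome : ∀ i x, (itm f t (lab e0 i).1).getLeft? = some x ↔
          itm f t (lab e0 i).1 = Sum.inl x := by
        intro i x; exact Sum.getLeft?_eq_some_iff
      have hlike : ∀ e, CGraph.Incident T e t → ∀ i x, f x = t →
        ((itm f t (lab e0 i).1).getLeft? = some x ↔ CGraph.Incident X (lab e i).1 x) := by
        intro e he i x hx
        rw [hsome, hl t e0 e he0 he i, itm_inl (lab e i).2]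
        exact and_iff_right hx
      refine ⟨fun i => (itm f t (lab e0 i).1).getLeft?, ?_, ?_, hlike, ?_, ?_⟩
      · intro i x h
        rw [hsome, itm_inl (lab e0 i).2] at h
        exact h.1
      · intro x hx
        have := L.p3 x e0 (hx ▸ he0) (hne _)
        obtain ⟨b, hb⟩ := Finset.card_pos.1 this
        obtain ⟨hb1, hb2⟩ := Finset.mem_filter.1 hb
        refine ⟨(lab e0).symm ⟨b, hb1⟩, ?_⟩
        rw [hlike e0 he0 _ _ hx]
        simpa using hb2
      · intro e1 e2 h1 h2 i hi
        have hi' : ∃ b, itm f t (lab e0 i).1 = Sum.inr b := by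
          cases h : itm f t (lab e0 i).1 with
          | inl x =>
            have hi2 : (itm f t (lab e0 i).1).getLeft? = none := hi
            rw [h] at hi2; simp at hi2
          | inr b => exact ⟨b, rfl⟩
        obtain ⟨b, hb⟩ := hi'
        have k1 := itm_inr.1 ((hl t e1 e0 h1 he0 i).trans hb)
        have k2 := itm_inr.1 ((hl t e2 e0 h2 he0 i).trans hb)
        exact k1.1.trans k2.1.symm
      · intro h; exact absurd he0 (h e0)
    · push Not at hE
      have h2 := L.p2 t
      obtain ⟨x0, hx0⟩ := hs t
      have hemb : Nonempty ((Finset.univ.filter fun x => f x = t) ↪ Fin 3) :=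
        Function.Embedding.nonempty_of_card_le (by rw [Fintype.card_coe, Fintype.card_fin]; exact h2)
      obtain ⟨φ⟩ := hemb
      have hne' : Nonempty (Finset.univ.filter fun x => f x = t) :=
        ⟨⟨x0, by simp [hx0]⟩⟩
      refine ⟨fun i => some (Function.invFun φ i).1, ?_, ?_, ?_, ?_, ?_⟩
      · intro i x h
        have h4 := (Function.invFun φ i).2
        rw [Option.some.injEq] at h
        rw [h] at h4
        exact (Finset.mem_filter.1 h4).2
      · intro x hx
        refine ⟨φ ⟨x, by simp [hx]⟩, ?_⟩
        show some (Function.invFun φ (φ _)).1 = _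
        rw [Function.leftInverse_invFun φ.injective]
      · intro e he; exact absurd he (hE e)
      · intro e _ he; exact absurd he (hE e)
      · intro _ i; simp
  choose k k1 k2 k3 k4 k5 using hk
  exact ⟨⟨lab, k, k1, fun x => k2 _ x rfl, fun e t h => k3 t e h,
    fun e1 e2 t h1 h2 => k4 t e1 e2 h1 h2, k5⟩⟩

end TL


namespace TL

/-! ### The initial ladder-like cover -/

structure Frame (X T : CGraph) (f : X.V → T.V) extends Sheet X T f where
  tree : CGraph.IsTree T
  ll : Loopless X
  rp : X.V → Fin 3
  hrp : ∀ x, kp (f x) (rp x) = some x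
  pr : X.E → Fin 3 × Fin 3
  hpr1 : ∀ b, kp (f (X.src b)) (pr b).1 = some (X.src b)
  hpr2 : ∀ b, kp (f (X.tgt b)) (pr b).2 = some (X.tgt b)
  m : ℕ
  t0 : T.V

namespace Frame
variable {X T : CGraph} {f : X.V → T.V} (F : Frame X T f)

abbrev N (_ : Frame X T f) : Type := {b : X.E // f (X.src b) = f (X.tgt b)}
abbrev B : Type := {q : T.V × Fin 3 // ∃ x, F.kp q.1 q.2 = some x ∧ q.2 ≠ F.rp x}

def par (q : T.V × Fin 3) : Fin 3 := (F.kp q.1 q.2).elim 0 F.rp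

theorem par_eq {q : T.V × Fin 3} {x : X.V} (h : F.kp q.1 q.2 = some x) : F.par q = F.rp x := by
  unfold par; rw [h]; rfl

abbrev D : LD where
  T := T
  A := F.N ⊕ (F.B ⊕ Fin F.m)
  fA := inferInstance
  dA := inferInstance
  aV := fun a => match a with
    | Sum.inl b => f (X.src b.1)
    | Sum.inr (Sum.inl q) => q.1.1
    | Sum.inr (Sum.inr _) => F.t0
  aP := fun a => match a with
    | Sum.inl b => F.pr b.1
    | Sum.inr (Sum.inl q) => (q.1.2, F.par q.1)
    | Sum.inr (Sum.inr _) => (0, 1)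
  ne := by
    rintro (b | q | j)
    · intro h
      have h1 := F.hpr1 b.1
      have h2 := F.hpr2 b.1
      simp only at h
      rw [h, b.2, h2, Option.some.injEq] at h1
      exact F.ll b.1 h1.symm
    · obtain ⟨q, x, hx, hq⟩ := q
      simp only
      rw [F.par_eq hx]; exact hq
    · simp

abbrev S : Set (F.D).P.E := {e | ∃ q : F.B, e = Sum.inr (Sum.inr (Sum.inl q))}

theorem sat_rep {W : Set (T.V × Fin 3)} (hW : Sat (F.D).P F.S W) {t : T.V} {i : Fin 3} {x : X.V}
    (h : F.kp t i = some x) : (t, i) ∈ W ↔ (f x, F.rp x) ∈ W := by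
  have h1 := F.s1 _ _ _ h
  by_cases hi : i = F.rp x
  · rw [hi, h1]
  · have h2 := hW (Sum.inr (Sum.inr (Sum.inl ⟨(t, i), x, h, hi⟩))) ⟨_, rfl⟩
    have h3 : (t, i) ∈ W ↔ (t, F.par (t, i)) ∈ W := h2
    have h4 : F.par (t, i) = F.rp x := F.par_eq (q := (t, i)) h
    rw [h3, h1, h4]

theorem imm : Nonempty (Imm X (F.D).P F.S) := by
  refine ⟨⟨fun x => (f x, F.rp x), fun v => F.kp v.1 v.2, fun h => match h with
    | Sum.inl (e, i) => some (F.lab e i).1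
    | Sum.inr (Sum.inl b) => some b.1
    | Sum.inr (Sum.inr _) => none, F.hrp, ?_, ?_⟩⟩
  · rintro e ⟨⟨⟨t, i⟩, x, hx, hi⟩, rfl⟩
    show F.kp t i = F.kp t (F.par (t, i))
    have h4 : F.par (t, i) = F.rp x := F.par_eq (q := (t, i)) hx
    have h1 := F.s1 _ _ _ hx
    simp only at h1 hx
    rw [h4, hx, ← h1, F.hrp]
  · intro W hW b hb
    by_cases hN : f (X.src b) = f (X.tgt b)
    · refine ⟨Sum.inr (Sum.inl ⟨b, hN⟩), rfl, ?_⟩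
      have h1 := F.sat_rep hW (F.hpr1 b)
      have h2 := F.sat_rep hW (F.hpr2 b)
      show ¬ ((f (X.src b), (F.pr b).1) ∈ W ↔ (f (X.src b), (F.pr b).2) ∈ W)
      rw [h1]
      nth_rewrite 2 [hN]
      rw [h2]; exact hb
    · by_contra hcon
      push Not at hcon
      have hT := F.tree
      have hE : ∀ e i, (F.lab e i).1 = b → ((T.src e, i) ∈ W ↔ (T.tgt e, i) ∈ W) := by
        intro e i h
        have := hcon (Sum.inl (e, i)) (by simp [h])
        exact not_crs.1 this
      have hE' : ∀ e i u v, (F.lab e i).1 = b → CGraph.Incident T e u → CGraph.Incident T e v →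
          ((u, i) ∈ W ↔ (v, i) ∈ W) := by
        intro e i u v h hu hv
        have := hE e i h
        rcases hu with rfl | rfl <;> rcases hv with rfl | rfl
        · exact Iff.rfl
        · exact this
        · exact this.symm
        · exact Iff.rfl
      set c : Prop := (f (X.src b), F.rp (X.src b)) ∈ W
      let Z : Set T.V := {u | ∀ e i, CGraph.Incident T e u → (F.lab e i).1 = b → ((u, i) ∈ W ↔ c)}
      have hstep : ∀ e0 u v, Sep T e0 (f (X.src b)) (f (X.tgt b)) → CGraph.Incident T e0 u →
          CGraph.Incident T e0 v → u ∈ Z → v ∈ Z := by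
        intro e0 u v hsep hu hv hZ e i he hi
        have hb0 : b ∈ Cr f e0 := mem_Cr.2 hsep
        obtain ⟨i0, hi0⟩ : ∃ i0, (F.lab e0 i0).1 = b :=
          ⟨(F.lab e0).symm ⟨b, hb0⟩, by simp⟩
        have h1 : (v, i0) ∈ W ↔ c := (hE' e0 i0 v u hi0 hv hu).trans (hZ e0 i0 hu hi0)
        cases hk : F.kp v i0 with
        | none =>
          have h2 := F.s4 e0 e v hv he i0 hk
          have h3 : (F.lab e) i0 = F.lab e i := Subtype.ext (by rw [← h2, hi0, hi])
          rw [← (F.lab e).injective h3]; exact h1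
        | some x =>
          have hx := F.s1 _ _ _ hk
          have h2 := (F.s3 e0 v hv i0 x hx).1 hk
          rw [hi0, ← hi] at h2
          have h3 := (F.s3 e v he i x hx).2 h2
          rw [F.sat_rep hW h3, ← F.sat_rep hW hk]; exact h1
      have hsat : Sat T {e | Sep T e (f (X.src b)) (f (X.tgt b))} Z := fun e he =>
        ⟨hstep e _ _ he (Or.inl rfl) (Or.inr rfl), hstep e _ _ he (Or.inr rfl) (Or.inl rfl)⟩
      have hstart : f (X.src b) ∈ Z := by
        intro e i he hi
        exact F.sat_rep hW ((F.s3 e _ he i (X.src b) rfl).2 (by rw [hi]; exact Or.inl rfl))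
      have hend := (sat_sreach hsat (sep_path hT _ _)).1 hstart
      obtain ⟨e, he, hs⟩ := sep_exists hT (Ne.symm hN)
      have hbe : b ∈ Cr f e := mem_Cr.2 (sep_symm hs)
      obtain ⟨i, hi⟩ : ∃ i, (F.lab e i).1 = b := ⟨(F.lab e).symm ⟨b, hbe⟩, by simp⟩
      have h1 := hend e i he hi
      rw [F.sat_rep hW ((F.s3 e _ he i (X.tgt b) rfl).2 (by rw [hi]; exact Or.inr rfl))] at h1
      exact hb h1.symm

theorem count {g : ℕ} (hb : Betti X g) : Fintype.card F.N + Fintype.card F.B ≤ g + 2 := by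
  have hT := F.tree
  -- three times the number of vertices
  have h1 : 3 * Fintype.card T.V = Fintype.card {q : T.V × Fin 3 // F.kp q.1 q.2 = none} +
      Fintype.card {q : T.V × Fin 3 // ¬ F.kp q.1 q.2 = none} := by
    have := Fintype.card_subtype_compl (fun q : T.V × Fin 3 => F.kp q.1 q.2 = none)
    have h2 := Fintype.card_subtype_le (fun q : T.V × Fin 3 => F.kp q.1 q.2 = none)
    rw [Fintype.card_prod, Fintype.card_fin] at this h2
    omega
  have h2 : Fintype.card {q : T.V × Fin 3 // ¬ F.kp q.1 q.2 = none} =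
      Fintype.card F.B + Fintype.card X.V := by
    rw [← Fintype.card_sum]
    symm
    apply Fintype.card_of_bijective (f := fun z : F.B ⊕ X.V => match z with
      | Sum.inl q => (⟨q.1, by obtain ⟨q, x, hx, _⟩ := q; simp [hx]⟩ :
          {q : T.V × Fin 3 // ¬ F.kp q.1 q.2 = none})
      | Sum.inr x => ⟨(f x, F.rp x), by simp [F.hrp]⟩)
    constructor
    · rintro (⟨q, x, hx, hq⟩ | x) (⟨q', x', hx', hq'⟩ | x') h
      · simp at h; subst h; rfl
      · simp at h; subst h
        simp only at hx hq
        rw [F.hrp, Option.some.injEq] at hx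
        exact absurd (by rw [hx]) hq
      · simp at h; subst h
        simp only at hx' hq'
        rw [F.hrp, Option.some.injEq] at hx'
        exact absurd (by rw [hx']) hq'
      · simp at h
        have a1 := F.hrp x
        rw [h.1, h.2, F.hrp, Option.some.injEq] at a1
        rw [a1]
    · rintro ⟨⟨t, i⟩, hq⟩
      obtain ⟨x, hx⟩ := Option.ne_none_iff_exists'.1 hq
      by_cases hi : i = F.rp x
      · refine ⟨Sum.inr x, ?_⟩
        simp [F.s1 _ _ _ hx, hi]
      · exact ⟨Sum.inl ⟨(t, i), x, hx, hi⟩, rfl⟩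
  have h3 : 3 * Fintype.card T.E ≤ Fintype.card {b : X.E // ¬ f (X.src b) = f (X.tgt b)} +
      Fintype.card {q : T.V × Fin 3 // F.kp q.1 q.2 = none} := by
    have far : ∀ (q : T.E × Fin 3), ∃ h, CGraph.Incident T q.1 h ∧
        Sep T q.1 h (f (X.src (F.lab q.1 q.2).1)) := by
      intro q
      have := tree_sep hT q.1
      have h : Sep T q.1 (T.src q.1) (T.tgt q.1) := this
      by_cases h0 : Sep T q.1 (T.src q.1) (f (X.src (F.lab q.1 q.2).1))
      · exact ⟨_, Or.inl rfl, h0⟩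
      · refine ⟨_, Or.inr rfl, ?_⟩
        rw [sep_iff hT] at *; tauto
    choose far hf1 hf2 using far
    have hno : ∀ q : T.E × Fin 3, far q ≠ f (X.tgt (F.lab q.1 q.2).1) → F.kp (far q) q.2 = none := by
      intro q hq
      by_contra hk
      obtain ⟨x, hx⟩ := Option.ne_none_iff_exists'.1 hk
      have h5 := F.s1 _ _ _ hx
      have h6 := (F.s3 q.1 _ (hf1 q) q.2 x h5).1 hx
      rcases h6 with h6 | h6
      · have := hf2 q
        rw [h6, h5] at this
        exact this (sreach_refl _)
      · exact hq (by rw [h6, h5])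
    have hinj : Function.Injective (fun q : T.E × Fin 3 =>
        if h : far q = f (X.tgt (F.lab q.1 q.2).1) then
          (Sum.inl ⟨(F.lab q.1 q.2).1, Cr_ne (F.lab q.1 q.2).2⟩ :
            {b : X.E // ¬ f (X.src b) = f (X.tgt b)} ⊕ {q : T.V × Fin 3 // F.kp q.1 q.2 = none})
        else Sum.inr ⟨(far q, q.2), hno q h⟩) := by
      rintro ⟨e, i⟩ ⟨e', i'⟩ h
      have a1 := hf1 (e, i)
      have a2 := hf2 (e, i)
      have b1 := hf1 (e', i')
      have b2 := hf2 (e', i')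
      simp only at h a1 a2 b1 b2
      have fin : far (e, i) = far (e', i') → (F.lab e i).1 = (F.lab e' i').1 → (e, i) = (e', i') := by
        intro c1 c2
        rw [← c1] at b1 b2
        rw [← c2] at b2
        have hee : e = e' := by
          by_contra hne
          exact sep_excl hT hne a1 b1 a2 b2
        subst hee
        rw [(F.lab e).injective (Subtype.ext c2)]
      split_ifs at h with h5 h6
      · simp only [Sum.inl.injEq, Subtype.mk.injEq] at h
        exact fin (by rw [h5, h6, h]) h
      · simp only [Sum.inr.injEq, Subtype.mk.injEq, Prod.mk.injEq] at h
        obtain ⟨h, rfl⟩ := h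
        refine fin h (F.s4 e e' _ a1 (h ▸ b1) i (hno (e, i) h5))
    have := Fintype.card_le_of_injective _ hinj
    rw [Fintype.card_sum, Fintype.card_prod, Fintype.card_fin] at this
    omega
  have h4 := Fintype.card_subtype_compl (fun b : X.E => f (X.src b) = f (X.tgt b))
  have h5 := Fintype.card_subtype_le (fun b : X.E => f (X.src b) = f (X.tgt b))
  have h6 := hT.2
  unfold Betti at hb
  have h7 : Fintype.card F.N = Fintype.card {b : X.E // f (X.src b) = f (X.tgt b)} := rfl
  omega

/-- Low valence: every occupied sheet is touched by a rung. -/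
theorem touch (hst : CGraph.IsStable0 X) {t : T.V} (hv : CGraph.valence T t ≤ 2) {k : Fin 3}
    {x : X.V} (hk : F.kp t k = some x) :
    ∃ a : (F.D).A, (F.D).aV a = t ∧ (((F.D).aP a).1 = k ∨ ((F.D).aP a).2 = k) := by
  by_contra hcon
  push Not at hcon
  have hT := F.tree
  have hx := F.s1 _ _ _ hk
  have huniq : ∀ j, F.kp t j = some x → j = k := by
    intro j hj
    by_contra hne
    by_cases h : j = F.rp x
    · have hk' : k ≠ F.rp x := fun h' => hne (h.trans h'.symm)
      exact (hcon (Sum.inr (Sum.inl ⟨(t, k), x, hk, hk'⟩)) rfl).1 rfl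
    · have h1 := (hcon (Sum.inr (Sum.inl ⟨(t, j), x, hj, h⟩)) rfl).2
      have h2 : F.par (t, j) = F.rp x := F.par_eq (q := (t, j)) hj
      have h3 : F.rp x ≠ k := by rw [← h2]; exact h1
      have h4 := (hcon (Sum.inr (Sum.inl ⟨(t, k), x, hk, Ne.symm h3⟩)) rfl).1
      exact h4 rfl
  have hN : ∀ b, CGraph.Incident X b x → f (X.src b) ≠ f (X.tgt b) := by
    intro b hb hbN
    rcases hb with hb | hb
    · have h1 := F.hpr1 b
      rw [hb, hx] at h1
      exact (hcon (Sum.inl ⟨b, hbN⟩) (by show f (X.src b) = t; rw [hb, hx])).1 (huniq _ h1)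
    · have h1 := F.hpr2 b
      rw [hb, hx] at h1
      exact (hcon (Sum.inl ⟨b, hbN⟩) (by show f (X.src b) = t; rw [hbN, hb, hx])).2 (huniq _ h1)
  have hmap : ∀ b, CGraph.Incident X b x → ∃ e, CGraph.Incident T e t ∧ (F.lab e k).1 = b := by
    intro b hb
    have h1 : ∃ e, CGraph.Incident T e t ∧ b ∈ Cr f e := by
      have h2 := hN b hb
      rcases hb with hb | hb
      · obtain ⟨e, h3, h4⟩ := sep_exists hT h2
        rw [← hx, ← hb]
        exact ⟨e, h3, mem_Cr.2 h4⟩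
      · obtain ⟨e, h3, h4⟩ := sep_exists hT (Ne.symm h2)
        rw [← hx, ← hb]
        exact ⟨e, h3, mem_Cr.2 (sep_symm h4)⟩
    obtain ⟨e, he, hbe⟩ := h1
    refine ⟨e, he, ?_⟩
    have h5 : (F.lab e ((F.lab e).symm ⟨b, hbe⟩)).1 = b := by simp
    have h6 := huniq _ ((F.s3 e t he ((F.lab e).symm ⟨b, hbe⟩) x hx).2 (by rw [h5]; exact hb))
    rw [← h6]; exact h5
  have h3 := hst x
  rw [valence_loopless F.ll] at h3
  rw [valence_loopless (tree_loopless hT)] at hv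
  have h4 : (Finset.univ.filter fun b => CGraph.Incident X b x).card ≤
      (Finset.univ.filter fun e => CGraph.Incident T e t).card := by
    have : (Finset.univ.filter fun b => CGraph.Incident X b x) ⊆
        (Finset.univ.filter fun e => CGraph.Incident T e t).image (fun e => (F.lab e k).1) := by
      intro b hb
      obtain ⟨e, he, hb'⟩ := hmap b (Finset.mem_filter.1 hb).2
      exact Finset.mem_image.2 ⟨e, by simp [he], hb'⟩
    exact (Finset.card_le_card this).trans Finset.card_image_le
  omega

/-- Sheets over a leaf are all occupied. -/
theorem leaf_occ {t : T.V} (hv : CGraph.valence T t = 1) (k : Fin 3) :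
    ∃ x, F.kp t k = some x := by
  have hT := F.tree
  rw [valence_loopless (tree_loopless hT)] at hv
  obtain ⟨e, he⟩ := Finset.card_eq_one.1 hv
  have hmem : ∀ e', CGraph.Incident T e' t ↔ e' = e := by
    intro e'
    have : e' ∈ (Finset.univ.filter fun e => CGraph.Incident T e t) ↔ e' ∈ ({e} : Finset T.E) := by
      rw [he]
    simpa using this
  have hte := (hmem e).2 rfl
  have hb := mem_Cr.1 (F.lab e k).2
  have hsd : ∀ x, ¬ Sep T e t (f x) → f x = t := by
    intro x hx
    by_contra hne
    obtain ⟨e', h1, h2⟩ := sep_exists hT (Ne.symm hne)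
    rw [(hmem e').1 h1] at h2
    exact hx h2
  by_cases h1 : Sep T e t (f (X.src (F.lab e k).1))
  · have h2 : f (X.tgt (F.lab e k).1) = t := by
      apply hsd
      rw [sep_iff hT] at *; tauto
    exact ⟨_, (F.s3 e t hte k _ h2).2 (Or.inr rfl)⟩
  · have h2 := hsd _ h1
    exact ⟨_, (F.s3 e t hte k _ h2).2 (Or.inl rfl)⟩

end Frame

end TL


namespace TL

/-! ### Valid covers -/

/-- Two rungs are not parallel. -/
def LD.NP (D : LD) (a b : D.A) : Prop :=
  s((D.aP a).1, (D.aP a).2) ≠ s((D.aP b).1, (D.aP b).2)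

structure LD.Valid (D : LD) : Prop where
  v0 : ∀ t, CGraph.valence D.T t = 0 → ∃ a b c d, D.aV a = t ∧ D.aV b = t ∧ D.aV c = t ∧
    D.aV d = t ∧ D.NP a b ∧ D.NP c d ∧ a ≠ c ∧ a ≠ d ∧ b ≠ c ∧ b ≠ d
  v1 : ∀ t, CGraph.valence D.T t = 1 → ∃ a b, D.aV a = t ∧ D.aV b = t ∧ D.NP a b
  v2 : ∀ t, CGraph.valence D.T t = 2 → ∃ a, D.aV a = t

theorem four {α β : Type*} (R : Finset α) (col : α → β) (hR : 4 ≤ R.card)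
    (h : ∀ c ∈ R, 2 ≤ (R.filter fun b => col b ≠ col c).card) :
    ∃ a ∈ R, ∃ b ∈ R, ∃ c ∈ R, ∃ d ∈ R, col a ≠ col b ∧ col c ≠ col d ∧ a ≠ c ∧ a ≠ d ∧ b ≠ c ∧
      b ≠ d := by
  obtain ⟨a, ha⟩ := Finset.card_pos.1 (by omega : 0 < R.card)
  obtain ⟨b, hb⟩ := Finset.card_pos.1 (by have := h a ha; omega :
    0 < (R.filter fun b => col b ≠ col a).card)
  obtain ⟨hbR, hba⟩ := Finset.mem_filter.1 hb
  have hab : a ≠ b := by rintro rfl; exact hba rfl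
  set R' := (R.erase a).erase b with hR'
  have hbR' : b ∈ R.erase a := Finset.mem_erase.2 ⟨hab.symm, hbR⟩
  have hc' : R'.card = R.card - 1 - 1 := by
    rw [hR', Finset.card_erase_of_mem hbR', Finset.card_erase_of_mem ha]
  have hmem : ∀ x, x ∈ R' ↔ x ≠ b ∧ x ≠ a ∧ x ∈ R := by
    intro x; rw [hR', Finset.mem_erase, Finset.mem_erase]
  by_cases hcd : ∃ c ∈ R', ∃ d ∈ R', col c ≠ col d
  · obtain ⟨c, hc, d, hd, hne⟩ := hcd
    rw [hmem] at hc hd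
    exact ⟨a, ha, b, hbR, c, hc.2.2, d, hd.2.2, hba.symm, hne, hc.2.1.symm, hd.2.1.symm,
      hc.1.symm, hd.1.symm⟩
  · push Not at hcd
    obtain ⟨c, hc, d, hd, hne⟩ := Finset.one_lt_card.1 (by omega : 1 < R'.card)
    have hcR := (hmem c).1 hc
    have hdR := (hmem d).1 hd
    have h2 := h c hcR.2.2
    have hsub : (R.filter fun b => col b ≠ col c) ⊆ {a, b} := by
      intro x hx
      obtain ⟨hx1, hx2⟩ := Finset.mem_filter.1 hx
      by_contra hn
      simp only [Finset.mem_insert, Finset.mem_singleton, not_or] at hn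
      exact hx2 (hcd x ((hmem x).2 ⟨hn.2, hn.1, hx1⟩) c hc)
    have heq : (R.filter fun b => col b ≠ col c) = {a, b} := by
      apply Finset.eq_of_subset_of_card_le hsub
      rw [Finset.card_pair hab]; exact h2
    have h3 : a ∈ (R.filter fun b => col b ≠ col c) := by rw [heq]; simp
    have h4 : b ∈ (R.filter fun b => col b ≠ col c) := by rw [heq]; simp
    have h5 := (Finset.mem_filter.1 h3).2
    have h6 := (Finset.mem_filter.1 h4).2
    refine ⟨a, ha, c, hcR.2.2, b, hbR, d, hdR.2.2, h5, ?_, hab, hdR.2.1.symm, hcR.1, hne⟩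
    rw [hcd d hd c hc]; exact h6

theorem third_sheet (i j : Fin 3) : ∃ k, k ≠ i ∧ k ≠ j := by
  revert i j; decide

theorem np_of_touch {p q : Fin 3 × Fin 3} {k : Fin 3} (hp : p.1 = k ∨ p.2 = k)
    (h1 : k ≠ q.1) (h2 : k ≠ q.2) : s(p.1, p.2) ≠ s(q.1, q.2) := by
  intro h
  have : k ∈ s(q.1, q.2) := by
    rw [← h, Sym2.mem_iff]
    tauto
  rw [Sym2.mem_iff] at this
  tauto

/-- State of the splitting process. -/
structure LD.State (X : CGraph) (g : ℕ) (D : LD) (S : Set D.P.E) : Prop where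
  tree : CGraph.IsTree D.T
  valid : D.Valid
  card : Fintype.card D.A = g + 2
  imm : Nonempty (Imm X D.P S)
  cls : ∀ e i j, Sum.inl (e, i) ∈ S → Sum.inl (e, j) ∈ S

theorem state_start {X T : CGraph} {f : X.V → T.V} {g : ℕ} (hg : 3 ≤ g)
    (hX : CGraph.ThreeEdgeConnected X) (hl : Loopless X) (hst : CGraph.IsStable0 X)
    (hb : Betti X g) (h2 : 2 ≤ Fintype.card X.V) (L : Layout X T f) (hs : Function.Surjective f) :
    ∃ (D : LD) (S : Set D.P.E), LD.State X g D S := by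
  obtain ⟨sh⟩ := sheet_exists hX L hs
  choose rp hrp using sh.s2
  have hinc : ∀ x, ∃ b, CGraph.Incident X b x := by
    intro x
    have := hst x
    rw [valence_loopless hl] at this
    obtain ⟨b, hb⟩ := Finset.card_pos.1 (by omega : 0 < (Finset.univ.filter fun b => CGraph.Incident X b x).card)
    exact ⟨b, (Finset.mem_filter.1 hb).2⟩
  obtain ⟨x0⟩ : Nonempty X.V := Fintype.card_pos_iff.1 (by omega)
  obtain ⟨b1, hb1⟩ := hinc x0
  have hal : ∀ x, ∃ a, sh.kp (f x) a = some x ∧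
      ((∃ j, j ≠ rp x ∧ sh.kp (f x) j = some x) → a ≠ rp x) := by
    intro x
    by_cases h : ∃ j, j ≠ rp x ∧ sh.kp (f x) j = some x
    · obtain ⟨j, h1, h3⟩ := h
      exact ⟨j, h3, fun _ => h1⟩
    · exact ⟨rp x, hrp x, fun h' => absurd h' h⟩
  choose al hal1 hal2 using hal
  let sg : X.E → X.V → Fin 3 := fun b x => if b = b1 then rp x else al x
  have hsg : ∀ b x, sh.kp (f x) (sg b x) = some x := by
    intro b x; simp only [sg]; split_ifs
    · exact hrp x
    · exact hal1 x
  let F0 : ℕ → Frame X T f := fun m =>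
    { sh with
      tree := L.tree, ll := hl, rp := rp, hrp := hrp
      pr := fun b => (sg b (X.src b), sg b (X.tgt b))
      hpr1 := fun b => hsg b _
      hpr2 := fun b => hsg b _
      m := m
      t0 := f x0 }
  have hcount := (F0 0).count hb
  let m := g + 2 - (Fintype.card (F0 0).N + Fintype.card (F0 0).B)
  let F := F0 m
  have hcN : Fintype.card F.N = Fintype.card (F0 0).N := rfl
  have hcB : Fintype.card F.B = Fintype.card (F0 0).B := rfl
  have hcA : Fintype.card F.D.A = g + 2 := by
    have : Fintype.card F.D.A = Fintype.card F.N + (Fintype.card F.B + m) := by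
      rw [← Fintype.card_fin m, ← Fintype.card_sum, ← Fintype.card_sum]
    rw [this, hcN, hcB]
    simp only [m]
    omega
  have hkp : F.kp = sh.kp := rfl
  have hval : F.D.Valid := by
    refine ⟨?_, ?_, ?_⟩
    · intro t ht
      have hT := L.tree
      have hno : ∀ e, ¬ CGraph.Incident T e t := by
        intro e he
        have ht' : CGraph.valence T t = 0 := ht
        rw [valence_loopless (tree_loopless hT), Finset.card_eq_zero] at ht'
        have : e ∈ (Finset.univ.filter fun e => CGraph.Incident T e t) := by simp [he]
        rw [ht'] at this; simp at this
      have hone : ∀ u : T.V, u = t := by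
        intro u
        by_contra hu
        obtain ⟨e, he, -⟩ := sep_exists hT (Ne.symm hu)
        exact hno e he
      have hNall : ∀ b, f (X.src b) = f (X.tgt b) := fun b => (hone _).trans (hone _).symm
      have hkey : ∀ k, 2 ≤ (Finset.univ.filter fun a : F.D.A =>
          ((F.D).aP a).1 = k ∨ ((F.D).aP a).2 = k).card := by
        intro k
        obtain ⟨x, hx⟩ := Option.ne_none_iff_exists'.1 (sh.s5 t hno k)
        have hfx : f x = t := hone _
        have htouch : ∀ b, CGraph.Incident X b x → sg b x = k →
            (Sum.inl ⟨b, hNall b⟩ : F.D.A) ∈ (Finset.univ.filter fun a : F.D.A =>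
              ((F.D).aP a).1 = k ∨ ((F.D).aP a).2 = k) := by
          intro b hbx hk
          refine Finset.mem_filter.2 ⟨Finset.mem_univ _, ?_⟩
          rcases hbx with h | h
          · left; show sg b (X.src b) = k; rw [h, hk]
          · right; show sg b (X.tgt b) = k; rw [h, hk]
        by_cases hj : ∃ j, j ≠ k ∧ sh.kp t j = some x
        · obtain ⟨j, hjk, hj⟩ := hj
          obtain ⟨y, hy⟩ : ∃ y, y ≠ x := Fintype.exists_ne_of_one_lt_card (by omega) x
          have hsh0 : ∀ z i, sh.kp t i = some z → z ≠ x → i ≠ j ∧ i ≠ k := by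
            intro z i hi hz
            constructor
            · rintro rfl; rw [hj, Option.some.injEq] at hi; exact hz hi.symm
            · rintro rfl; rw [hx, Option.some.injEq] at hi; exact hz hi.symm
          have hfin : ∀ a b c d : Fin 3, a ≠ b → c ≠ a → c ≠ b → d ≠ a → d ≠ b → c = d := by decide
          have hxy : ∀ z, z ≠ x → z = y := by
            intro z hz
            have h1 := hrp z
            have h3 := hrp y
            rw [hone (f z)] at h1
            rw [hone (f y)] at h3
            have h4 := hsh0 z _ h1 hz
            have h5 := hsh0 y _ h3 hy
            have h6 := hfin j k _ _ hjk h4.1 h4.2 h5.1 h5.2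
            rw [h6, h3, Option.some.injEq] at h1
            exact h1.symm
          have hall : ∀ b, CGraph.Incident X b x := by
            intro b
            by_contra hbx
            have h1 : X.src b ≠ x := fun h => hbx (Or.inl h)
            have h3 : X.tgt b ≠ x := fun h => hbx (Or.inr h)
            exact hl b ((hxy _ h1).trans (hxy _ h3).symm)
          have hxs : ∀ i, sh.kp t i = some x → i = j ∨ i = k := by
            intro i hi
            by_contra hn
            push Not at hn
            have h3 := hrp y
            rw [hone (f y)] at h3
            have h5 := hsh0 y _ h3 hy
            have h6 := hfin j k _ _ hjk hn.1 hn.2 h5.1 h5.2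
            rw [h6, h3, Option.some.injEq] at hi
            exact hy hi
          -- the N rung
          have hN : ∃ b, sg b x = k := by
            have h1 := hrp x
            rw [hfx] at h1
            rcases hxs _ h1 with h3 | h3
            · -- rp x = j, so al x = k
              obtain ⟨b, hb⟩ : ∃ b, b ≠ b1 := by
                apply Fintype.exists_ne_of_one_lt_card
                unfold Betti at hb; omega
              refine ⟨b, ?_⟩
              simp only [sg, if_neg hb]
              have h4 := hal1 x
              rw [hfx] at h4
              have h5 := hal2 x ⟨k, by rw [h3]; exact hjk.symm, by rw [hfx]; exact hx⟩
              rcases hxs _ h4 with h6 | h6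
              · exact absurd (h6.trans h3.symm) h5
              · exact h6
            · exact ⟨b1, by simp [sg, h3]⟩
          obtain ⟨b, hbk⟩ := hN
          have hB : ∃ q : F.B, (Sum.inr (Sum.inl q) : F.D.A) ∈ (Finset.univ.filter fun a : F.D.A =>
              ((F.D).aP a).1 = k ∨ ((F.D).aP a).2 = k) := by
            by_cases hk : k = rp x
            · have hjr : j ≠ rp x := by rw [← hk]; exact hjk
              refine ⟨⟨(t, j), x, hj, hjr⟩, Finset.mem_filter.2 ⟨Finset.mem_univ _, Or.inr ?_⟩⟩
              show F.par (t, j) = k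
              rw [F.par_eq (q := (t, j)) hj, hk]
            · exact ⟨⟨(t, k), x, hx, hk⟩, Finset.mem_filter.2 ⟨Finset.mem_univ _, Or.inl rfl⟩⟩
          obtain ⟨q, hq⟩ := hB
          exact Finset.one_lt_card.2 ⟨_, htouch b (hall b) hbk, _, hq, by simp⟩
        · push Not at hj
          have h3 := hst x
          rw [valence_loopless hl] at h3
          have hsk : ∀ b, sg b x = k := by
            intro b
            by_contra h
            have := hsg b x
            rw [hfx] at this
            exact hj _ h this
          obtain ⟨c, hc, d, hd, hcd⟩ := Finset.one_lt_card.1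
            (by omega : 1 < (Finset.univ.filter fun b => CGraph.Incident X b x).card)
          refine Finset.one_lt_card.2 ⟨_, htouch c (Finset.mem_filter.1 hc).2 (hsk c), _,
            htouch d (Finset.mem_filter.1 hd).2 (hsk d), ?_⟩
          simpa using hcd
      obtain ⟨a, -, b, -, c, -, d, -, h⟩ := four (Finset.univ : Finset F.D.A)
        (fun a => s(((F.D).aP a).1, ((F.D).aP a).2))
        (by rw [Finset.card_univ, hcA]; omega) (by
          intro c _
          obtain ⟨k, hk1, hk2⟩ := third_sheet ((F.D).aP c).1 ((F.D).aP c).2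
          refine (hkey k).trans (Finset.card_le_card ?_)
          intro a ha
          simp only [Finset.mem_filter, Finset.mem_univ, true_and]
          exact np_of_touch (Finset.mem_filter.1 ha).2 hk1 hk2)
      exact ⟨a, b, c, d, hone _, hone _, hone _, hone _, h⟩
    · intro t ht
      have ht2 : CGraph.valence T t ≤ 2 := by
        have : CGraph.valence T t = 1 := ht
        omega
      obtain ⟨x, hx⟩ := F.leaf_occ ht 0
      obtain ⟨a, ha, -⟩ := F.touch hst ht2 hx
      obtain ⟨k, hk1, hk2⟩ := third_sheet ((F.D).aP a).1 ((F.D).aP a).2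
      obtain ⟨y, hy⟩ := F.leaf_occ ht k
      obtain ⟨b, hb, hbk⟩ := F.touch hst ht2 hy
      exact ⟨b, a, hb, ha, np_of_touch hbk hk1 hk2⟩
    · intro t ht
      obtain ⟨x, hx⟩ := hs t
      have h1 := hrp x
      rw [hx] at h1
      obtain ⟨a, ha, -⟩ := F.touch hst (le_of_eq ht) (k := rp x) (x := x) h1
      exact ⟨a, ha⟩
  refine ⟨F.D, F.S, L.tree, hval, hcA, F.imm, ?_⟩
  rintro e i j ⟨q, hq⟩
  cases hq

end TL


namespace TL

/-! ### Splitting a vertex -/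

namespace LD

noncomputable abbrev splitT (T : CGraph) (t : T.V) (Lg : T.E → Prop) : CGraph where
  V := Option T.V
  E := Option T.E
  fV := inferInstance
  fE := inferInstance
  dV := inferInstance
  dE := inferInstance
  src := fun e => match e with
    | none => some t
    | some e => if Lg e ∧ T.src e = t then none else some (T.src e)
  tgt := fun e => match e with
    | none => none
    | some e => if Lg e ∧ T.tgt e = t then none else some (T.tgt e)

noncomputable abbrev split (D : LD) (t : D.T.V) (Lg : D.T.E → Prop) (Rg : D.A → Prop) : LD where
  T := splitT D.T t Lg
  A := D.A
  fA := inferInstance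
  dA := inferInstance
  aV := fun a => if Rg a then none else some (D.aV a)
  aP := D.aP
  ne := D.ne

abbrev newCls (D : LD) (t : D.T.V) (Lg : D.T.E → Prop) (Rg : D.A → Prop) :
    Set (split D t Lg Rg).P.E := {h | ∃ i : Fin 3, h = Sum.inl (none, i)}

theorem split_cd (D : LD) (t : D.T.V) (Lg : D.T.E → Prop) (Rg : D.A → Prop)
    (hR : ∀ a, Rg a → D.aV a = t) :
    ∃ cd : ContractionData (split D t Lg Rg).P (newCls D t Lg Rg) D.P,
      (∀ e i, (cd.fe (Sum.inl (e, i))).1 = Sum.inl (some e, i)) ∧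
      (∀ a, (cd.fe (Sum.inr a)).1 = Sum.inr a) := by
  have hsr : ∀ i, SReach (split D t Lg Rg).P (newCls D t Lg Rg) (some t, i) (none, i) := by
    intro i
    exact sreach_edge (G := (split D t Lg Rg).P) (e := Sum.inl (none, i)) ⟨i, rfl⟩
  have hto : ∀ (v : Option D.T.V) i,
      SReach (split D t Lg Rg).P (newCls D t Lg Rg) (v, i) (some (v.getD t), i) := by
    intro v i
    cases v with
    | none => exact sreach_symm (hsr i)
    | some v => exact sreach_refl _
  refine ⟨{ c := fun v => (v.1.getD t, v.2)
            fe := { toFun := fun h => match h with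
                      | Sum.inl (e, i) => ⟨Sum.inl (some e, i), by rintro ⟨j, hj⟩; simp at hj⟩
                      | Sum.inr a => ⟨Sum.inr a, by rintro ⟨j, hj⟩; simp at hj⟩
                    invFun := fun h => match h with
                      | ⟨Sum.inl (some e, i), _⟩ => Sum.inl (e, i)
                      | ⟨Sum.inl (none, i), hh⟩ => absurd ⟨i, rfl⟩ hh
                      | ⟨Sum.inr a, _⟩ => Sum.inr a
                    left_inv := by rintro (⟨e, i⟩ | a) <;> rfl
                    right_inv := by
                      rintro ⟨(⟨e | e, i⟩ | a), hh⟩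
                      · exact absurd ⟨i, rfl⟩ hh
                      · rfl
                      · rfl }
            surj := fun v => ⟨(some v.1, v.2), rfl⟩
            ends := ?_
            fibers := ?_ }, fun e i => rfl, fun a => rfl⟩
  · rintro (⟨e, i⟩ | a)
    · left
      constructor
      · show (D.T.src e, i) = (Option.getD (if Lg e ∧ D.T.src e = t then none else some (D.T.src e)) t, i)
        split_ifs with h
        · rw [h.2]; rfl
        · rfl
      · show (D.T.tgt e, i) = (Option.getD (if Lg e ∧ D.T.tgt e = t then none else some (D.T.tgt e)) t, i)
        split_ifs with h
        · rw [h.2]; rfl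
        · rfl
    · left
      have : D.aV a = Option.getD (if Rg a then none else some (D.aV a)) t := by
        split_ifs with h
        · rw [hR a h]; rfl
        · rfl
      constructor
      · show (D.aV a, (D.aP a).1) = (Option.getD (if Rg a then none else some (D.aV a)) t, (D.aP a).1)
        rw [← this]
      · show (D.aV a, (D.aP a).2) = (Option.getD (if Rg a then none else some (D.aV a)) t, (D.aP a).2)
        rw [← this]
  · rintro ⟨u, i⟩ ⟨v, j⟩
    constructor
    · intro h
      simp only [Prod.mk.injEq] at h
      obtain ⟨h0, rfl⟩ := h
      have h1 := hto u i
      have h2 := hto v i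
      rw [h0] at h1
      exact sreach_trans h1 (sreach_symm h2)
    · intro h
      have hs : Sat (split D t Lg Rg).P (newCls D t Lg Rg)
          {w | ((u.getD t, i) : D.T.V × Fin 3) = (w.1.getD t, w.2)} := by
        rintro e ⟨k, rfl⟩
        exact Iff.rfl
      exact (sat_sreach hs h).1 rfl

theorem split_tree {T : CGraph} (hT : CGraph.IsTree T) (t : T.V) (Lg : T.E → Prop) :
    CGraph.IsTree (splitT T t Lg) := by
  refine ⟨?_, ?_⟩
  · apply conn_of_cut ⟨none⟩
    intro W u v hu hv
    by_contra hcon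
    push Not at hcon
    have h0 : (some t : Option T.V) ∈ W ↔ none ∈ W := not_crs.1 (hcon none)
    let W0 : Set T.V := {v | some v ∈ W}
    have hW : ∀ v : Option T.V, v ∈ W ↔ v.getD t ∈ W0 := by
      intro v
      cases v with
      | none => exact h0.symm
      | some v => exact Iff.rfl
    obtain ⟨e, he⟩ := conn_cut hT.1 (W := W0) ((hW u).1 hu) (fun h => hv ((hW v).2 h))
    have h1 := not_crs.1 (hcon (some e))
    rw [hW, hW] at h1
    have hs : Option.getD (if Lg e ∧ T.src e = t then none else some (T.src e)) t = T.src e := by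
      split_ifs with h
      · exact h.2.symm
      · rfl
    have ht : Option.getD (if Lg e ∧ T.tgt e = t then none else some (T.tgt e)) t = T.tgt e := by
      split_ifs with h
      · exact h.2.symm
      · rfl
    simp only at h1
    rw [hs, ht] at h1
    exact he h1
  · have h1 : Fintype.card (splitT T t Lg).E = Fintype.card T.E + 1 := Fintype.card_option
    have h2 : Fintype.card (splitT T t Lg).V = Fintype.card T.V + 1 := Fintype.card_option
    have := hT.2
    omega

theorem split_val {T : CGraph} (hT : CGraph.IsTree T) (t : T.V) (Lg : T.E → Prop)
    (hL : ∀ e, Lg e → CGraph.Incident T e t) :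
    CGraph.valence (splitT T t Lg) none = (Finset.univ.filter Lg).card + 1 ∧
    CGraph.valence (splitT T t Lg) (some t) + (Finset.univ.filter Lg).card =
      CGraph.valence T t + 1 ∧
    ∀ v, v ≠ t → CGraph.valence (splitT T t Lg) (some v) = CGraph.valence T v := by
  have hll := tree_loopless hT
  have hs : ∀ v, CGraph.valence (splitT T t Lg) v = CGraph.incid (splitT T t Lg) none v +
      ∑ e : T.E, CGraph.incid (splitT T t Lg) (some e) v := fun v => Fintype.sum_option _
  refine ⟨?_, ?_, ?_⟩
  · rw [hs, Finset.card_filter, add_comm]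
    congr 1
    apply Finset.sum_congr rfl
    intro e _
    have h1 := hll e
    by_cases he : Lg e
    · rcases hL e he with h | h
      · have : T.tgt e ≠ t := fun h' => h1 (h.trans h'.symm)
        simp [CGraph.incid, he, h, this]
      · have : T.src e ≠ t := fun h' => h1 (h'.trans h.symm)
        simp [CGraph.incid, he, h, this]
    · simp [CGraph.incid, he]
  · rw [hs, Finset.card_filter]
    have : CGraph.incid (splitT T t Lg) none (some t) = 1 := by simp [CGraph.incid]
    rw [this, add_assoc, ← Finset.sum_add_distrib, add_comm]
    congr 1
    apply Finset.sum_congr rfl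
    intro e _
    have h1 := hll e
    by_cases he : Lg e
    · rcases hL e he with h | h
      · have : T.tgt e ≠ t := fun h' => h1 (h.trans h'.symm)
        simp [CGraph.incid, he, h, this]
      · have : T.src e ≠ t := fun h' => h1 (h'.trans h.symm)
        simp [CGraph.incid, he, h, this]
    · simp [CGraph.incid, he]
  · intro v hv
    rw [hs]
    have : CGraph.incid (splitT T t Lg) none (some v) = 0 := by simp [CGraph.incid, hv.symm]
    rw [this, zero_add]
    apply Finset.sum_congr rfl
    intro e _
    have key : ∀ u, (if Lg e ∧ u = t then none else some u : Option T.V) = some v ↔ u = v := by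
      intro u
      split_ifs with h
      · simp [h.2, hv.symm]
      · simp
    simp only [CGraph.incid, key]

theorem val_pos {T : CGraph} (hT : CGraph.Connected T) (h : 1 < Fintype.card T.V) (t : T.V) :
    0 < CGraph.valence T t := by
  obtain ⟨w, hw⟩ := Fintype.exists_ne_of_one_lt_card h t
  exact conn_val_pos hT hw.symm

theorem split_state {X : CGraph} {g : ℕ} {D : LD} {S : Set D.P.E} (h : State X g D S) (t : D.T.V)
    (Lg : D.T.E → Prop) (Rg : D.A → Prop) (hL : ∀ e, Lg e → CGraph.Incident D.T e t)
    (hR : ∀ a, Rg a → D.aV a = t)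
    (l : ℕ) (hl : (Finset.univ.filter Lg).card = l)
    (hA : l = 0 → ∃ a b, Rg a ∧ Rg b ∧ D.NP a b)
    (hB : l = 1 → ∃ a, Rg a)
    (hC : CGraph.valence D.T t = l →
      ∃ a b, (D.aV a = t ∧ ¬ Rg a) ∧ (D.aV b = t ∧ ¬ Rg b) ∧ D.NP a b)
    (hD : CGraph.valence D.T t = l + 1 → ∃ a, D.aV a = t ∧ ¬ Rg a) :
    ∃ (D' : LD) (S' : Set D'.P.E), State X g D' S' ∧
      Fintype.card D'.T.V = Fintype.card D.T.V + 1 := by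
  obtain ⟨cd, hc1, hc2⟩ := split_cd D t Lg Rg hR
  obtain ⟨v1, v2, v3⟩ := split_val h.tree t Lg hL
  rw [hl] at v1 v2
  have htree := split_tree h.tree t Lg
  obtain ⟨I⟩ := h.imm
  have hcard : Fintype.card (splitT D.T t Lg).V = Fintype.card D.T.V + 1 := Fintype.card_option
  refine ⟨split D t Lg Rg, _, ⟨htree, ⟨?_, ?_, ?_⟩, h.card, Imm.lift cd I, ?_⟩, hcard⟩
  · intro v hv
    have hv' : CGraph.valence (splitT D.T t Lg) v = 0 := hv
    have : 0 < CGraph.valence (splitT D.T t Lg) v := by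
      apply val_pos htree.1
      rw [hcard]
      have : 0 < Fintype.card D.T.V := Fintype.card_pos_iff.2 ⟨t⟩
      omega
    omega
  · intro v hv
    have hv' : CGraph.valence (splitT D.T t Lg) v = 1 := hv
    cases v with
    | none =>
      obtain ⟨a, b, ha, hb, hab⟩ := hA (by omega)
      exact ⟨a, b, if_pos ha, if_pos hb, hab⟩
    | some v =>
      by_cases hvt : v = t
      · subst hvt
        obtain ⟨a, b, ha, hb, hab⟩ := hC (by omega)
        refine ⟨a, b, ?_, ?_, hab⟩
        · show (if Rg a then none else some (D.aV a)) = some v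
          rw [if_neg ha.2, ha.1]
        · show (if Rg b then none else some (D.aV b)) = some v
          rw [if_neg hb.2, hb.1]
      · rw [v3 v hvt] at hv'
        obtain ⟨a, b, ha, hb, hab⟩ := h.valid.v1 v hv'
        refine ⟨a, b, ?_, ?_, hab⟩
        · show (if Rg a then none else some (D.aV a)) = some v
          rw [if_neg (fun h => hvt (ha.symm.trans (hR a h))), ha]
        · show (if Rg b then none else some (D.aV b)) = some v
          rw [if_neg (fun h => hvt (hb.symm.trans (hR b h))), hb]
  · intro v hv
    have hv' : CGraph.valence (splitT D.T t Lg) v = 2 := hv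
    cases v with
    | none =>
      obtain ⟨a, ha⟩ := hB (by omega)
      exact ⟨a, if_pos ha⟩
    | some v =>
      by_cases hvt : v = t
      · subst hvt
        obtain ⟨a, ha⟩ := hD (by omega)
        refine ⟨a, ?_⟩
        show (if Rg a then none else some (D.aV a)) = some v
        rw [if_neg ha.2, ha.1]
      · rw [v3 v hvt] at hv'
        obtain ⟨a, ha⟩ := h.valid.v2 v hv'
        refine ⟨a, ?_⟩
        show (if Rg a then none else some (D.aV a)) = some v
        rw [if_neg (fun h => hvt (ha.symm.trans (hR a h))), ha]
  · rintro (_ | e) i j hij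
    · exact Or.inl ⟨j, rfl⟩
    · rcases hij with ⟨k, hk⟩ | ⟨q, hq, hqe⟩
      · simp at hk
      · right
        rcases q with ⟨e', i'⟩ | a
        · rw [hc1] at hqe
          simp only [Sum.inl.injEq, Prod.mk.injEq, Option.some.injEq] at hqe
          obtain ⟨rfl, rfl⟩ := hqe
          exact ⟨Sum.inl (e', j), h.cls _ _ _ hq, hc1 _ _⟩
        · rw [hc2] at hqe; cases hqe

theorem sum_nr (D : LD) : ∑ t : D.T.V, D.nr t = Fintype.card D.A := by
  unfold nr
  rw [← Finset.card_univ (α := D.A)]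
  exact (Finset.card_eq_sum_card_fiberwise (f := D.aV) (t := Finset.univ)
    (fun _ _ => Finset.mem_univ _)).symm

theorem sum_val_nr {X : CGraph} {g : ℕ} {D : LD} {S : Set D.P.E} (h : State X g D S) :
    ∑ t : D.T.V, (CGraph.valence D.T t + D.nr t) = 2 * Fintype.card D.T.V + g := by
  rw [Finset.sum_add_distrib, sum_nr, h.card, sum_valence]
  have := h.tree.2
  omega

theorem nr_pos {D : LD} {t : D.T.V} {a : D.A} (h : D.aV a = t) : 1 ≤ D.nr t := by
  unfold nr
  exact Finset.card_pos.2 ⟨a, by simp [h]⟩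

theorem nr_two {D : LD} {t : D.T.V} {a b : D.A} (ha : D.aV a = t) (hb : D.aV b = t)
    (hab : a ≠ b) : 2 ≤ D.nr t := by
  unfold nr
  exact Finset.one_lt_card.2 ⟨a, by simp [ha], b, by simp [hb], hab⟩

theorem NP.ne {D : LD} {a b : D.A} (h : D.NP a b) : a ≠ b := by
  rintro rfl; exact h rfl

theorem exc_ge {D : LD} (h : D.Valid) (t : D.T.V) (hv : 0 < CGraph.valence D.T t) :
    3 ≤ CGraph.valence D.T t + D.nr t := by
  rcases Nat.lt_or_ge 2 (CGraph.valence D.T t) with h1 | h1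
  · omega
  · have h2 : CGraph.valence D.T t = 1 ∨ CGraph.valence D.T t = 2 := by omega
    rcases h2 with h2 | h2
    · obtain ⟨a, b, ha, hb, hab⟩ := h.v1 t h2
      have := nr_two ha hb hab.ne
      omega
    · obtain ⟨a, ha⟩ := h.v2 t h2
      have := nr_pos ha
      omega

theorem exists_inc {T : CGraph} (hT : CGraph.IsTree T) {t : T.V} {n : ℕ}
    (h : n ≤ CGraph.valence T t) :
    ∃ F : Finset T.E, F.card = n ∧ ∀ e ∈ F, CGraph.Incident T e t := by
  rw [valence_loopless (tree_loopless hT)] at h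
  obtain ⟨F, hF, hc⟩ := Finset.exists_subset_card_eq h
  exact ⟨F, hc, fun e he => (Finset.mem_filter.1 (hF he)).2⟩

theorem split_step {X : CGraph} {g : ℕ} {D : LD} {S : Set D.P.E} (h : State X g D S)
    (hn : Fintype.card D.T.V < g) : ∃ (D' : LD) (S' : Set D'.P.E), State X g D' S' ∧
      Fintype.card D'.T.V = Fintype.card D.T.V + 1 := by
  obtain ⟨t, ht⟩ : ∃ t, 4 ≤ CGraph.valence D.T t + D.nr t := by
    by_contra hcon
    push Not at hcon
    have h1 := sum_val_nr h
    have h2 : ∑ t : D.T.V, (CGraph.valence D.T t + D.nr t) ≤ ∑ t : D.T.V, 3 :=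
      Finset.sum_le_sum (fun t _ => by have := hcon t; omega)
    rw [Finset.sum_const, Finset.card_univ, smul_eq_mul] at h2
    omega
  rcases Nat.eq_zero_or_pos (CGraph.valence D.T t) with hv | hv
  · -- isolated vertex
    obtain ⟨a, b, c, d, ha, hb, hc, hd, hab, hcd, h1, h2, h3, h4⟩ := h.valid.v0 t hv
    refine split_state h t (fun e => e ∈ (∅ : Finset D.T.E)) (fun r => r = a ∨ r = b) ?_ ?_ 0
      (by simp) ?_ ?_ ?_ ?_
    · intro e he; simp at he
    · rintro r (rfl | rfl)
      · exact ha
      · exact hb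
    · intro _; exact ⟨a, b, Or.inl rfl, Or.inr rfl, hab⟩
    · intro h; omega
    · intro _
      refine ⟨c, d, ⟨hc, ?_⟩, ⟨hd, ?_⟩, hcd⟩
      · rintro (h | h)
        · exact h1 h.symm
        · exact h3 h.symm
      · rintro (h | h)
        · exact h2 h.symm
        · exact h4 h.symm
    · intro h; omega
  · rcases Nat.eq_zero_or_pos (D.nr t) with hk | hk
    · obtain ⟨F, hF, hFi⟩ := exists_inc h.tree (t := t) (n := 2) (by omega)
      refine split_state h t (fun e => e ∈ F) (fun r => False) hFi (fun _ h => h.elim) 2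
        (by rw [← hF]; congr 1; ext e; simp) ?_ ?_ ?_ ?_
      · intro h; omega
      · intro h; omega
      · intro h; omega
      · intro h; omega
    · obtain ⟨F, hF, hFi⟩ := exists_inc h.tree (t := t) (n := 1) (by omega)
      obtain ⟨r, hr, hr1⟩ : ∃ r, D.aV r = t ∧ (CGraph.valence D.T t = 1 →
          ∃ a b, (D.aV a = t ∧ ¬ a = r) ∧ (D.aV b = t ∧ ¬ b = r) ∧ D.NP a b) := by
        by_cases hv1 : CGraph.valence D.T t = 1
        · obtain ⟨a, b, ha, hb, hab⟩ := h.valid.v1 t hv1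
          obtain ⟨r, hr, hra⟩ : ∃ r ∈ (Finset.univ.filter fun a : D.A => D.aV a = t),
              r ∉ ({a, b} : Finset D.A) := by
            apply Finset.exists_mem_notMem_of_card_lt_card
            rw [Finset.card_pair hab.ne]
            unfold nr at ht
            omega
          simp only [Finset.mem_insert, Finset.mem_singleton, not_or] at hra
          exact ⟨r, (Finset.mem_filter.1 hr).2, fun _ =>
            ⟨a, b, ⟨ha, Ne.symm hra.1⟩, ⟨hb, Ne.symm hra.2⟩, hab⟩⟩
        · obtain ⟨r, hr⟩ := Finset.card_pos.1 hk
          exact ⟨r, (Finset.mem_filter.1 hr).2, fun h => absurd h hv1⟩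
      refine split_state h t (fun e => e ∈ F) (fun a => a = r) hFi
        (fun a h => by rw [h]; exact hr) 1
        (by rw [← hF]; congr 1; ext e; simp) ?_ ?_ ?_ ?_
      · intro h; omega
      · intro _; exact ⟨r, rfl⟩
      · intro h; exact hr1 (by omega)
      · intro h
        have hn2 : 1 < D.nr t := by omega
        obtain ⟨a, ha, har⟩ := Finset.exists_mem_ne hn2 r
        exact ⟨a, (Finset.mem_filter.1 ha).2, har⟩

theorem split_final {X : CGraph} {g : ℕ} (hg : 3 ≤ g) {D : LD} {S : Set D.P.E} (h : State X g D S) :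
    ∃ (D' : LD) (S' : Set D'.P.E), State X g D' S' ∧ Fintype.card D'.T.V = g := by
  have hle : ∀ (D : LD) (S : Set D.P.E), State X g D S → Fintype.card D.T.V ≤ g := by
    intro D S h
    by_contra hcon
    have h1 := sum_val_nr h
    have h2 : ∑ t : D.T.V, 3 ≤ ∑ t : D.T.V, (CGraph.valence D.T t + D.nr t) :=
      Finset.sum_le_sum (fun t _ => exc_ge h.valid t (val_pos h.tree.1 (by omega) _))
    rw [Finset.sum_const, Finset.card_univ, smul_eq_mul] at h2
    omega
  have key : ∀ k (D : LD) (S : Set D.P.E), State X g D S → Fintype.card D.T.V + k = g →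
      ∃ (D' : LD) (S' : Set D'.P.E), State X g D' S' ∧ Fintype.card D'.T.V = g := by
    intro k
    induction k with
    | zero => intro D S h hk; exact ⟨D, S, h, hk⟩
    | succ k ih =>
      intro D S h hk
      obtain ⟨D', S', h', hc⟩ := split_step h (by omega)
      exact ih D' S' h' (by omega)
  exact key (g - Fintype.card D.T.V) D S h (by have := hle D S h; omega)

theorem final_exc {X : CGraph} {g : ℕ} (hg : 3 ≤ g) {D : LD} {S : Set D.P.E} (h : State X g D S)
    (hc : Fintype.card D.T.V = g) (t : D.T.V) : CGraph.valence D.T t + D.nr t = 3 := by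
  have h1 := sum_val_nr h
  have h3 : ∀ t ∈ (Finset.univ : Finset D.T.V), 3 ≤ CGraph.valence D.T t + D.nr t :=
    fun t _ => exc_ge h.valid t (val_pos h.tree.1 (by omega) _)
  have h2 : ∑ t : D.T.V, 3 = ∑ t : D.T.V, (CGraph.valence D.T t + D.nr t) := by
    rw [Finset.sum_const, Finset.card_univ, smul_eq_mul]
    omega
  exact ((Finset.sum_eq_sum_iff_of_le h3).1 h2 t (Finset.mem_univ _)).symm

end LD

end TL


namespace TL

/-! ### Three edge connectivity of ladders -/

theorem tree_ein {T : CGraph} (hT : CGraph.IsTree T) (U : Finset T.V) (hU : U.Nonempty) :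
    ein T U + 1 ≤ U.card := by
  obtain ⟨u, hu⟩ := hU
  let S : Set T.E := {e | T.src e ∈ U ∧ T.tgt e ∈ U}
  obtain ⟨H, ⟨cd⟩⟩ := exists_cd T S
  have h1 := conn_card (cd_conn cd hT.1)
  have h2 : Fintype.card H.E + ein T U = Fintype.card T.E := by
    have := cd_sum cd (fun _ => 1)
    simp only [Finset.sum_const, Finset.card_univ, smul_eq_mul, mul_one] at this
    rw [← this]
    congr 1
    unfold ein
    rw [Finset.card_filter]
    apply Finset.sum_congr rfl
    intro e _
    by_cases he : T.src e ∈ U ∧ T.tgt e ∈ U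
    · rw [if_pos he, if_pos (show e ∈ S from he)]
    · rw [if_neg he, if_neg (show e ∉ S from he)]
  have hs : ∀ v, v ∉ U → ∀ w, cd.c v = cd.c w → v = w := by
    intro v hv w h
    have hsat : Sat T S {v} := by
      intro e he
      have a1 : T.src e ≠ v := fun h => hv (h ▸ he.1)
      have a2 : T.tgt e ≠ v := fun h => hv (h ▸ he.2)
      simp [a1, a2]
    exact ((sat_sreach hsat ((cd.fibers _ _).1 h)).1 rfl).symm
  have h3 : Fintype.card (Option {v // v ∉ U}) ≤ Fintype.card H.V := by
    apply Fintype.card_le_of_injective (fun o : Option {v // v ∉ U} => o.elim (cd.c u) (fun v => cd.c v.1))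
    rintro (_ | ⟨v, hv⟩) (_ | ⟨w, hw⟩) h
    · rfl
    · have := hs w hw u h.symm
      exact absurd (this ▸ hu) hw
    · have := hs v hv u h
      exact absurd (this ▸ hu) hv
    · have := hs v hv w h
      subst this; rfl
  have h4 : Fintype.card {v // v ∉ U} + U.card = Fintype.card T.V := by
    have := Fintype.card_subtype_compl (fun v => v ∈ U)
    have h5 : Fintype.card {v // v ∈ U} = U.card := Fintype.card_coe U
    have h6 := Finset.card_le_univ U
    omega
  rw [Fintype.card_option] at h3
  have := hT.2
  omega

/-- Leaves in a subset of a tree. -/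
theorem tree_leaves {T : CGraph} (hT : CGraph.IsTree T) (h2 : 1 < Fintype.card T.V)
    (U : Finset T.V) (hU : U.Nonempty) :
    2 ≤ (U.filter fun t => CGraph.valence T t = 1).card + dcut T (U : Set T.V) := by
  have h := handshake U
  have h1 := tree_ein hT U hU
  have h3 : ∑ t ∈ U, 2 ≤ ∑ t ∈ U, (CGraph.valence T t + if CGraph.valence T t = 1 then 1 else 0) := by
    apply Finset.sum_le_sum
    intro t _
    have := LD.val_pos hT.1 h2 t
    split_ifs with h
    · omega
    · omega
  rw [Finset.sum_add_distrib, ← Finset.card_filter, Finset.sum_const, smul_eq_mul] at h3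
  omega

def Cut2 (G : CGraph) : Prop := ∀ W : Finset G.V, W.Nonempty → (∃ v, v ∉ W) →
  dcut G (W : Set G.V) ≤ 2 → ein G W < W.card ∨
    ein G (Finset.univ.filter fun v => v ∉ W) < (Finset.univ.filter fun v => v ∉ W).card

theorem cut2_cd {G H : CGraph} {S : Set G.E} (cd : ContractionData G S H) (h : Cut2 G)
    (hc : ∀ W : Finset H.V, (Finset.univ.filter fun v => cd.c v ∈ W).card ≤ W.card +
      (Finset.univ.filter fun e : G.E => e ∈ S ∧ cd.c (G.src e) ∈ W).card) : Cut2 H := by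
  rintro W ⟨x, hx⟩ ⟨y, hy⟩ hd
  obtain ⟨x', rfl⟩ := cd.surj x
  obtain ⟨y', rfl⟩ := cd.surj y
  have hcoe : ((Finset.univ.filter fun v => cd.c v ∈ W : Finset G.V) : Set G.V) =
      cd.c ⁻¹' (W : Set H.V) := by
    ext v; simp
  rw [cd_dcut cd, ← hcoe] at hd
  rcases h (Finset.univ.filter fun v => cd.c v ∈ W) ⟨x', by simpa using hx⟩ ⟨y', by simpa using hy⟩ hd
    with h1 | h1
  · left
    have := cd_ein cd W
    have := hc W
    omega
  · right
    have e1 : (Finset.univ.filter fun v => v ∉ (Finset.univ.filter fun v => cd.c v ∈ W)) =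
        (Finset.univ.filter fun v => cd.c v ∈ (Finset.univ.filter fun v => v ∉ W)) := by
      ext v; simp
    rw [e1] at h1
    have := cd_ein cd (Finset.univ.filter fun v => v ∉ W)
    have := hc (Finset.univ.filter fun v => v ∉ W)
    omega

theorem cut2_step {G H : CGraph} (hs : Step0 G H) (h : Cut2 G) : Cut2 H := by
  rcases step_cases hs with ⟨⟨i⟩⟩ | ⟨⟨s⟩⟩
  · apply cut2_cd (CIso.cd i) h
    intro W
    apply le_trans _ (Nat.le_add_right _ _)
    apply Finset.card_le_card_of_injOn (fun v => i.vEquiv v)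
    · intro v hv
      simp only [Finset.coe_filter, Finset.mem_univ, true_and, Set.mem_ofPred_eq] at hv
      exact hv
    · intro a _ b _ hab
      exact i.vEquiv.injective hab
  · apply cut2_cd s.cd h
    intro W
    by_cases hW : s.cd.c s.v0 ∈ W
    · have hsrc : s.cd.c (G.src s.e0) ∈ W := by
        rcases s.he0 with h | h
        · rw [h.1]; exact hW
        · rw [h.1, ← s.cv0]; exact hW
      have h2 : (Finset.univ.filter fun v => s.cd.c v ∈ W) ⊆ insert s.v0 (W.image s.j) := by
        intro v hv
        rw [Finset.mem_filter] at hv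
        by_cases hvv : v = s.v0
        · simp [hvv]
        · apply Finset.mem_insert_of_mem
          exact Finset.mem_image.2 ⟨s.cd.c v, hv.2, s.jc v hvv⟩
      have h3 := Finset.card_le_card h2
      have h4 := Finset.card_insert_le s.v0 (W.image s.j)
      have h5 : (W.image s.j).card ≤ W.card := Finset.card_image_le
      refine le_trans (h3.trans (h4.trans (Nat.add_le_add_right h5 1))) (Nat.add_le_add_left ?_ _)
      exact Finset.card_pos.2 ⟨s.e0, by simp [hsrc]⟩
    · have h2 : (Finset.univ.filter fun v => s.cd.c v ∈ W) ⊆ W.image s.j := by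
        intro v hv
        rw [Finset.mem_filter] at hv
        by_cases hvv : v = s.v0
        · rw [hvv] at hv; exact absurd hv.2 hW
        · exact Finset.mem_image.2 ⟨s.cd.c v, hv.2, s.jc v hvv⟩
      have h3 := Finset.card_le_card h2
      have h5 : (W.image s.j).card ≤ W.card := Finset.card_image_le
      omega

theorem cut2_red {G H : CGraph} (hs : StabReduces0 G H) (h : Cut2 G) : Cut2 H := by
  induction hs with
  | refl => exact h
  | tail _ h2 ih => exact cut2_step h2 ih

theorem cut2_tec {G : CGraph} (h : Cut2 G) (hs : CGraph.IsStable0 G) :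
    CGraph.ThreeEdgeConnected G := by
  rw [tec_iff]
  intro W u v hu hv
  by_contra hcon
  have key : ∀ U : Finset G.V, U.Nonempty → dcut G (U : Set G.V) ≤ 2 → ¬ ein G U < U.card := by
    intro U hU hd hlt
    have h1 := handshake U
    have h2 : ∑ v ∈ U, 3 ≤ ∑ v ∈ U, CGraph.valence G v := Finset.sum_le_sum (fun v _ => hs v)
    rw [Finset.sum_const, smul_eq_mul] at h2
    have := Finset.card_pos.2 hU
    omega
  have hW : ((Finset.univ.filter fun v => v ∈ W : Finset G.V) : Set G.V) = W := by ext; simp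
  have hW' : ((Finset.univ.filter fun v => v ∉ (Finset.univ.filter fun v => v ∈ W) : Finset G.V) : Set G.V)
      = Wᶜ := by ext; simp
  rcases h (Finset.univ.filter fun v => v ∈ W) ⟨u, by simpa using hu⟩ ⟨v, by simpa using hv⟩
    (by rw [hW]; omega) with h1 | h1
  · exact key _ ⟨u, by simpa using hu⟩ (by rw [hW]; omega) h1
  · exact key _ ⟨v, by simpa using hv⟩ (by rw [hW', dcut_compl]; omega) h1

namespace LD

/-- the part of `W` in sheet `i` -/
noncomputable def sl (D : LD) (W : Finset D.P.V) (i : Fin 3) : Finset D.T.V :=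
  Finset.univ.filter fun t => (t, i) ∈ W

theorem mem_sl {D : LD} {W : Finset D.P.V} {i : Fin 3} {t : D.T.V} :
    t ∈ D.sl W i ↔ (t, i) ∈ W := by simp [sl]

theorem one_sheet {D : LD} (hT : CGraph.IsTree D.T) (W : Finset D.P.V) (hne : W.Nonempty) (i : Fin 3)
    (h : ∀ v ∈ W, v.2 = i) : ein D.P W < W.card := by
  have h1 : W.card = (D.sl W i).card := by
    apply Finset.card_bij (fun v _ => v.1)
    · intro v hv
      rw [mem_sl, ← h v hv]; exact hv
    · rintro ⟨a, x⟩ ha ⟨b, y⟩ hb hab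
      have h1 := h _ ha
      have h2 := h _ hb
      simp only at h1 h2 hab
      subst h1 h2 hab; rfl
    · intro t ht
      exact ⟨(t, i), mem_sl.1 ht, rfl⟩
  have h2 : ein D.P W ≤ ein D.T (D.sl W i) := by
    unfold ein
    apply le_trans (Finset.card_le_card (t := (Finset.univ.filter fun e : D.T.E =>
      D.T.src e ∈ D.sl W i ∧ D.T.tgt e ∈ D.sl W i).image (fun e => (Sum.inl (e, i) : D.P.E))) _)
      Finset.card_image_le
    intro q hq
    simp only [Finset.mem_filter, Finset.mem_univ, true_and] at hq
    simp only [Finset.mem_image, Finset.mem_filter, Finset.mem_univ, true_and]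
    rcases q with ⟨e, j⟩ | a
    · have hj : j = i := h _ hq.1
      subst hj
      exact ⟨e, ⟨mem_sl.2 hq.1, mem_sl.2 hq.2⟩, rfl⟩
    · have h1 := h _ hq.1
      have h2 := h _ hq.2
      exact absurd (h1.trans h2.symm) (D.ne a)
  obtain ⟨v, hv⟩ := hne
  have := tree_ein hT (D.sl W i) ⟨v.1, by rw [mem_sl, ← h v hv]; exact hv⟩
  omega

theorem dcut_P (D : LD) (W : Finset D.P.V) : dcut D.P (W : Set D.P.V) =
    ∑ i, dcut D.T (D.sl W i : Set D.T.V) +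
      (Finset.univ.filter fun a : D.A => Crs D.P (W : Set D.P.V) (Sum.inr a)).card := by
  have h0 : dcut D.P (W : Set D.P.V) =
      ∑ q : D.T.E × Fin 3, (if Crs D.P (W : Set D.P.V) (Sum.inl q) then 1 else 0) +
      ∑ a : D.A, (if Crs D.P (W : Set D.P.V) (Sum.inr a) then 1 else 0) := by
    unfold dcut
    rw [Finset.card_filter]
    exact Fintype.sum_sum_type _
  rw [h0, Finset.card_filter]
  congr 1
  rw [Fintype.sum_prod_type_right]
  apply Finset.sum_congr rfl
  intro i _
  unfold dcut
  rw [Finset.card_filter]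
  apply Finset.sum_congr rfl
  intro e _
  have : Crs D.P (W : Set D.P.V) (Sum.inl (e, i)) ↔ Crs D.T (D.sl W i : Set D.T.V) e := by
    unfold Crs
    rw [Finset.mem_coe, Finset.mem_coe, Finset.mem_coe, Finset.mem_coe, mem_sl, mem_sl]
  simp only [this]

/-- two nonparallel rungs connect all the sheets -/
theorem np_mixed {p q : Fin 3 × Fin 3} (hp : p.1 ≠ p.2) (hq : q.1 ≠ q.2)
    (h : s(p.1, p.2) ≠ s(q.1, q.2)) (M : Fin 3 → Prop) (h1 : M p.1 ↔ M p.2) (h2 : M q.1 ↔ M q.2)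
    (i j : Fin 3) : M i ↔ M j := by
  obtain ⟨p1, p2⟩ := p
  obtain ⟨q1, q2⟩ := q
  simp only [ne_eq, Sym2.eq_iff] at *
  have key : ∀ k, M k ↔ M p1 := by
    intro k
    by_cases a : k = p1
    · rw [a]
    by_cases b : k = p2
    · rw [b, h1]
    · have : (q1 = k ∧ (q2 = p1 ∨ q2 = p2)) ∨ (q2 = k ∧ (q1 = p1 ∨ q1 = p2)) := by
        clear h1 h2
        revert a b h hp hq
        revert k p1 p2 q1 q2
        decide
      rcases this with ⟨rfl, rfl | rfl⟩ | ⟨rfl, rfl | rfl⟩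
      · exact h2
      · rw [h2, h1]
      · exact h2.symm
      · rw [← h2, h1]
  rw [key i, key j]

theorem mixed_le {D : LD} (hv : D.Valid) (W : Finset D.P.V) (F : Finset D.T.V)
    (hF : ∀ t ∈ F, CGraph.valence D.T t = 1 ∧ ∃ i j, (t, i) ∈ W ∧ (t, j) ∉ W) :
    F.card ≤ (Finset.univ.filter fun a : D.A => Crs D.P (W : Set D.P.V) (Sum.inr a)).card := by
  apply le_trans (Finset.card_le_card (t := (Finset.univ.filter fun a : D.A =>
    Crs D.P (W : Set D.P.V) (Sum.inr a)).image D.aV) _) Finset.card_image_le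
  intro t ht
  obtain ⟨h1, i, j, hi, hj⟩ := hF t ht
  obtain ⟨a, b, ha, hb, hab⟩ := hv.v1 t h1
  by_contra hcon
  have hn : ∀ a, D.aV a = t → ((t, (D.aP a).1) ∈ W ↔ (t, (D.aP a).2) ∈ W) := by
    intro a ha
    by_contra hne
    apply hcon
    refine Finset.mem_image.2 ⟨a, ?_, ha⟩
    simp only [Finset.mem_filter, Finset.mem_univ, true_and]
    intro h
    apply hne
    have h' : (D.aV a, (D.aP a).1) ∈ W ↔ (D.aV a, (D.aP a).2) ∈ W := h
    rw [ha] at h'; exact h'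
  exact hj ((np_mixed (D.ne a) (D.ne b) hab (fun k => (t, k) ∈ W) (hn a ha) (hn b hb) i j).1 hi)

theorem proper_dcut {T : CGraph} (hT : CGraph.Connected T) {U : Finset T.V} (h : U.Nonempty)
    (h0 : dcut T (U : Set T.V) = 0) : ∀ v, v ∈ U := by
  intro v
  by_contra hv
  obtain ⟨u, hu⟩ := h
  obtain ⟨e, he⟩ := conn_cut hT (W := (U : Set T.V)) (u := u) (v := v) (by simpa using hu) (by simpa using hv)
  unfold dcut at h0
  rw [Finset.card_eq_zero] at h0
  have : e ∈ (Finset.univ.filter fun e : T.E => Crs T (U : Set T.V) e) := by simp [he]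
  rw [h0] at this
  simp at this

theorem cut2_aux {D : LD} (hT : CGraph.IsTree D.T) (hc : 1 < Fintype.card D.T.V) (hv : D.Valid)
    (W : Finset D.P.V) (hne : W.Nonempty) (hd : dcut D.P (W : Set D.P.V) ≤ 2) (k : Fin 3)
    (hk : ∀ t, (t, k) ∉ W) : ein D.P W < W.card ∨
    ein D.P (Finset.univ.filter fun v => v ∉ W) < (Finset.univ.filter fun v => v ∉ W).card := by
  obtain ⟨i, j, hij, hik, hjk, hall⟩ : ∃ i j : Fin 3, i ≠ j ∧ i ≠ k ∧ j ≠ k ∧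
      ∀ l, l = i ∨ l = j ∨ l = k := by
    clear hk; revert k; decide
  have hsum : dcut D.T (D.sl W i : Set D.T.V) + dcut D.T (D.sl W j : Set D.T.V) ≤
      ∑ l, dcut D.T (D.sl W l : Set D.T.V) := by
    rw [← Finset.sum_pair hij (f := fun l => dcut D.T (D.sl W l : Set D.T.V))]
    exact Finset.sum_le_sum_of_subset (Finset.subset_univ _)
  have hcut := dcut_P D W
  have hmix : ∀ l, ((D.sl W l).filter fun t => CGraph.valence D.T t = 1).card ≤
      (Finset.univ.filter fun a : D.A => Crs D.P (W : Set D.P.V) (Sum.inr a)).card := by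
    intro l
    apply mixed_le hv
    intro t ht
    rw [Finset.mem_filter] at ht
    exact ⟨ht.2, l, k, mem_sl.1 ht.1, hk t⟩
  by_cases h1 : (D.sl W i).Nonempty
  · by_cases h2 : (D.sl W j).Nonempty
    · right
      have a1 := tree_leaves hT hc _ h1
      have a2 := tree_leaves hT hc _ h2
      have a3 := hmix i
      have a4 := hmix j
      have b1 := proper_dcut hT.1 h1 (by omega)
      have b2 := proper_dcut hT.1 h2 (by omega)
      obtain ⟨t, -⟩ := h1
      refine one_sheet hT _ ⟨(t, k), by simp [hk t]⟩ k ?_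
      rintro ⟨u, l⟩ hu
      simp only [Finset.mem_filter, Finset.mem_univ, true_and] at hu
      rcases hall l with rfl | rfl | rfl
      · exact absurd (mem_sl.1 (b1 u)) hu
      · exact absurd (mem_sl.1 (b2 u)) hu
      · rfl
    · left
      refine one_sheet hT _ hne i ?_
      rintro ⟨u, l⟩ hu
      rcases hall l with rfl | rfl | rfl
      · rfl
      · exact absurd ⟨u, mem_sl.2 hu⟩ h2
      · exact absurd hu (hk u)
  · left
    refine one_sheet hT _ hne j ?_
    rintro ⟨u, l⟩ hu
    rcases hall l with rfl | rfl | rfl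
    · exact absurd ⟨u, mem_sl.2 hu⟩ h1
    · rfl
    · exact absurd hu (hk u)

theorem cut2_P {D : LD} (hT : CGraph.IsTree D.T) (hc : 1 < Fintype.card D.T.V) (hv : D.Valid) :
    Cut2 D.P := by
  intro W hne hnt hd
  have hcut := dcut_P D W
  obtain ⟨k, hk⟩ : ∃ k, dcut D.T (D.sl W k : Set D.T.V) = 0 := by
    by_contra hcon
    push Not at hcon
    have : ∑ i : Fin 3, 1 ≤ ∑ i, dcut D.T (D.sl W i : Set D.T.V) :=
      Finset.sum_le_sum (fun i _ => Nat.one_le_iff_ne_zero.2 (hcon i))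
    simp at this
    omega
  by_cases h : (D.sl W k).Nonempty
  · have hall := proper_dcut hT.1 h hk
    obtain ⟨v, hv'⟩ := hnt
    have hcoe : ((Finset.univ.filter fun v => v ∉ W : Finset D.P.V) : Set D.P.V) = (W : Set D.P.V)ᶜ := by
      ext; simp
    have e1 : (Finset.univ.filter fun v => v ∉ (Finset.univ.filter fun v => v ∉ W)) = W := by
      ext; simp
    have := cut2_aux hT hc hv (Finset.univ.filter fun v => v ∉ W) ⟨v, by simp [hv']⟩
      (by rw [hcoe, dcut_compl]; exact hd) k
      (by intro t; simp only [Finset.mem_filter, Finset.mem_univ, true_and, not_not]; exact mem_sl.1 (hall t))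
    rw [e1] at this
    exact this.symm
  · exact cut2_aux hT hc hv W hne hd k (fun t ht => h ⟨t, mem_sl.2 ht⟩)

theorem P_conn {D : LD} (hT : CGraph.IsTree D.T) (hc : 1 < Fintype.card D.T.V) (hv : D.Valid) :
    CGraph.Connected D.P := by
  apply conn_of_cut
  · obtain ⟨t⟩ := hT.1.1
    exact ⟨(t, 0)⟩
  intro W u v hu hv'
  by_contra hcon
  push Not at hcon
  have hsheet : ∀ (i : Fin 3) (t t' : D.T.V), (t, i) ∈ W → (t', i) ∈ W := by
    intro i t t' h
    by_contra h'
    obtain ⟨e, he⟩ := conn_cut hT.1 (W := {t | (t, i) ∈ W}) h h'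
    exact hcon (Sum.inl (e, i)) he
  obtain ⟨t, ht⟩ : ∃ t, CGraph.valence D.T t = 1 := by
    obtain ⟨t0⟩ := hT.1.1
    have h1 := tree_leaves hT hc Finset.univ ⟨t0, Finset.mem_univ _⟩
    have h0 : dcut D.T ((Finset.univ : Finset D.T.V) : Set D.T.V) = 0 := by
      unfold dcut; simp [Crs]
    rw [h0] at h1
    obtain ⟨t, ht⟩ := Finset.card_pos.1 (by omega :
      0 < (Finset.univ.filter fun t => CGraph.valence D.T t = 1).card)
    exact ⟨t, (Finset.mem_filter.1 ht).2⟩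
  obtain ⟨a, b, ha, hb, hab⟩ := hv.v1 t ht
  have hn : ∀ a, D.aV a = t → ((t, (D.aP a).1) ∈ W ↔ (t, (D.aP a).2) ∈ W) := by
    intro a ha
    have h' : (D.aV a, (D.aP a).1) ∈ W ↔ (D.aV a, (D.aP a).2) ∈ W := not_crs.1 (hcon (Sum.inr a))
    rw [ha] at h'; exact h'
  have := (np_mixed (D.ne a) (D.ne b) hab (fun k => (t, k) ∈ W) (hn a ha) (hn b hb) u.2 v.2).1
    (hsheet _ u.1 t hu)
  exact hv' (hsheet _ t v.1 this)

theorem P_betti {D : LD} {g : ℕ} (hT : CGraph.IsTree D.T) (hc : Fintype.card D.T.V = g)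
    (hA : Fintype.card D.A = g + 2) : Betti D.P g := by
  have h1 : Fintype.card D.P.V = Fintype.card D.T.V * 3 := by
    have : Fintype.card D.P.V = Fintype.card (D.T.V × Fin 3) := by congr
    rw [this, Fintype.card_prod, Fintype.card_fin]
  have h2 : Fintype.card D.P.E = Fintype.card D.T.E * 3 + Fintype.card D.A := by
    have : Fintype.card D.P.E = Fintype.card ((D.T.E × Fin 3) ⊕ D.A) := by congr
    rw [this, Fintype.card_sum, Fintype.card_prod, Fintype.card_fin]
  have := hT.2
  unfold Betti
  omega

end LD

end TL


namespace TL

/-! ### The trigonal type of a ladder -/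

namespace LD

def phi (D : LD) : CMorphism D.P D.T where
  vMap := fun v => v.1
  eMap := fun e => match e with
    | Sum.inl (e, _) => Sum.inl e
    | Sum.inr a => Sum.inr (D.aV a)
  mu := fun e => match e with
    | Sum.inl _ => 1
    | Sum.inr _ => 0
  mu_zero := by
    rintro (⟨e, i⟩ | a)
    · simp
    · simp
  contract_ok := by
    rintro (⟨e, i⟩ | a) v' h
    · simp at h
    · simp only [Sum.inr.injEq] at h
      exact ⟨h, h⟩
  edge_ok := by
    rintro (⟨e, i⟩ | a) e' h
    · simp only [Sum.inl.injEq] at h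
      subst h
      exact Or.inl ⟨rfl, rfl⟩
    · simp at h

theorem phi_locDeg (D : LD) (t : D.T.V) (i : Fin 3) (e' : D.T.E) :
    CMorphism.locDeg D.phi (t, i) e' = CGraph.incid D.T e' t := by
  have h0 : CMorphism.locDeg D.phi (t, i) e' =
      ∑ q : D.T.E × Fin 3, (if D.phi.eMap (Sum.inl q) = Sum.inl e' then
        D.phi.mu (Sum.inl q) * CGraph.incid D.P (Sum.inl q) (t, i) else 0) +
      ∑ a : D.A, (if D.phi.eMap (Sum.inr a) = Sum.inl e' then
        D.phi.mu (Sum.inr a) * CGraph.incid D.P (Sum.inr a) (t, i) else 0) := Fintype.sum_sum_type _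
  have h1 : ∑ a : D.A, (if D.phi.eMap (Sum.inr a) = Sum.inl e' then
        D.phi.mu (Sum.inr a) * CGraph.incid D.P (Sum.inr a) (t, i) else 0) = 0 := by
    apply Finset.sum_eq_zero
    intro a _
    simp [phi]
  rw [h0, h1, add_zero, Fintype.sum_prod_type, Finset.sum_eq_single e']
  · rw [Finset.sum_eq_single i]
    · simp [phi, CGraph.incid]
    · intro j _ hj
      simp [phi, CGraph.incid, hj]
    · simp
  · intro e _ he
    apply Finset.sum_eq_zero
    intro j _
    simp [phi, he]
  · simp

theorem phi_deg (D : LD) : CMorphism.HasDegree D.phi 3 := by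
  intro e'
  have h0 : (∑ e : D.P.E, if D.phi.eMap e = Sum.inl e' then D.phi.mu e else 0) =
      ∑ q : D.T.E × Fin 3, (if D.phi.eMap (Sum.inl q) = Sum.inl e' then
        D.phi.mu (Sum.inl q) else 0) +
      ∑ a : D.A, (if D.phi.eMap (Sum.inr a) = Sum.inl e' then
        D.phi.mu (Sum.inr a) else 0) := Fintype.sum_sum_type _
  have h1 : ∑ a : D.A, (if D.phi.eMap (Sum.inr a) = Sum.inl e' then
        D.phi.mu (Sum.inr a) else 0) = 0 := by
    apply Finset.sum_eq_zero
    intro a _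
    simp [phi]
  rw [h0, h1, add_zero, Fintype.sum_prod_type, Finset.sum_eq_single e']
  · simp [phi]
  · intro e _ he
    apply Finset.sum_eq_zero
    intro j _
    simp [phi, he]
  · simp

theorem incid_one {T : CGraph} (hT : CGraph.IsTree T) {e : T.E} {t : T.V}
    (h : CGraph.Incident T e t) : CGraph.incid T e t = 1 := by
  have hl := tree_loopless hT e
  rcases h with h | h
  · have : T.tgt e ≠ t := fun h' => hl (h.trans h'.symm)
    simp [CGraph.incid, h, this]
  · have : T.src e ≠ t := fun h' => hl (h'.trans h.symm)
    simp [CGraph.incid, h, this]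

theorem exists_cover {α β : Type} [Fintype α] [Fintype β] (h1 : Fintype.card β ≤ Fintype.card α)
    (h2 : Fintype.card α ≤ 2 * Fintype.card β) :
    ∃ f : α → β × Fin 3, Function.Injective f ∧ ∀ b, ∃ a, (f a).1 = b := by
  let k := Fintype.equivFin α
  let m := Fintype.equivFin β
  refine ⟨fun x => if h : (k x).1 < Fintype.card β then (m.symm ⟨(k x).1, h⟩, 0) else
    (m.symm ⟨(k x).1 - Fintype.card β, by have := (k x).2; omega⟩, 1), ?_, ?_⟩
  · intro x y h
    by_cases hx : (k x).1 < Fintype.card β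
    · by_cases hy : (k y).1 < Fintype.card β
      · simp only [hx, hy, dite_true, Prod.mk.injEq, m.symm.injective.eq_iff, Fin.mk.injEq, and_true] at h
        exact k.injective (Fin.ext h)
      · simp [hx, hy] at h
    · by_cases hy : (k y).1 < Fintype.card β
      · simp [hx, hy] at h
      · simp only [hx, hy, dite_false, Prod.mk.injEq, m.symm.injective.eq_iff, Fin.mk.injEq, and_true] at h
        exact k.injective (Fin.ext (by omega))
  · intro b
    refine ⟨k.symm ⟨(m b).1, by have := (m b).2; omega⟩, ?_⟩
    have h : (k (k.symm ⟨(m b).1, by have := (m b).2; omega⟩)).1 < Fintype.card β := by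
      rw [Equiv.apply_symm_apply]; exact (m b).2
    beta_reduce
    rw [dif_pos h]
    simp only [Equiv.apply_symm_apply]
    exact m.symm_apply_apply b

def ladderType (D : LD) (hT : CGraph.IsTree D.T) (hc1 : 1 < Fintype.card D.T.V) (hv : D.Valid)
    (Y : CGraph) (hY : StabReduces0 D.P Y) (hs : CGraph.IsStable0 Y)
    (f : Y.V → D.T.V × Fin 3) (hf : Function.Injective f) (hf2 : ∀ t, ∃ y, (f y).1 = t) :
    TrigonalType where
  G := Y
  w := fun _ => 0
  stable := fun v _ => hs v
  conn := red_conn hY (P_conn hT hc1 hv)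
  threeEC := cut2_tec (cut2_red hY (cut2_P hT hc1 hv)) hs
  Gphi := D.P
  connphi := P_conn hT hc1 hv
  T := D.T
  treeT := hT
  phi := D.phi
  harm := by
    rintro ⟨t, i⟩ e1 e2 h1 h2
    rw [phi_locDeg, phi_locDeg, incid_one (t := t) hT h1, incid_one (t := t) hT h2]
  nondeg := by
    rintro ⟨t, i⟩
    have h := val_pos hT.1 hc1 t
    rw [valence_loopless (tree_loopless hT)] at h
    obtain ⟨e, he⟩ := Finset.card_pos.1 h
    have he := (Finset.mem_filter.1 he).2
    exact ⟨e, he, by rw [phi_locDeg, incid_one hT he]⟩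
  deg3 := D.phi_deg
  stab := red_iso hY (CIso.symm (wl_zero fun _ => rfl))
  vG := f
  vG_inj := hf
  cover := hf2

theorem phi_closed {D : LD} {S : Set D.P.E}
    (h : ∀ e i j, Sum.inl (e, i) ∈ S → Sum.inl (e, j) ∈ S) : ClassClosed D.phi S := by
  rintro (⟨e, i⟩ | a) (⟨e', i'⟩ | a') hc
  · have : e = e' := by simpa [classMap, phi] using hc
    subst this
    exact ⟨h _ _ _, h _ _ _⟩
  · simp [classMap, phi] at hc
  · simp [classMap, phi] at hc
  · have : a = a' := by simpa [classMap, phi] using hc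
    rw [this]

theorem max_red {X : WGraph} {g : ℕ} (hg : 3 ≤ g) (hM : MaximalTrigonal X) (hb : Betti X.G g)
    {D : LD} {S : Set D.P.E} (h : State X.G g D S) (hc : Fintype.card D.T.V = g) :
    StabReduces0 D.P X.G ∧ Fintype.card X.G.V + 2 = 2 * g := by
  have hl := max_loopless hM
  have hw := max_w0 hM
  have hc1 : 1 < Fintype.card D.T.V := by omega
  have hx := final_exc hg h hc
  have hPc := P_conn h.tree hc1 h.valid
  have hPb := P_betti h.tree hc h.card
  obtain ⟨Y, hY, hs⟩ := exists_stable (g := g) (by omega) _ D.P rfl hPc hPb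
  have hYb := red_betti hY hPb
  have hY3 : ∀ v, CGraph.valence Y v = 3 := by
    intro v
    have h1 := red_maxval hY (fun v => (val_le D v.1 v.2).trans (hx v.1).le) v
    have h2 := hs v
    omega
  have hYc := trivalent_card hY3 hYb
  obtain ⟨f, hf, hf2⟩ := exists_cover (α := Y.V) (β := D.T.V) (by omega) (by omega)
  let ty := ladderType D h.tree hc1 h.valid Y hY hs f hf hf2
  obtain ⟨t, ht⟩ := hM.1
  have hst : CGraph.IsStable0 X.G := by
    obtain ⟨j, -⟩ := ht
    exact CIso.stable j (tt_stable t)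
  have hiso : Nonempty (CIso (withLoops t.G t.w) X.G) := by
    obtain ⟨j, hj⟩ := ht
    obtain ⟨k⟩ := wl_iso j hj
    exact ⟨CIso.trans k (wl_zero hw)⟩
  obtain ⟨k⟩ := hiso
  have hcon : TrigContraction ⟨Y, fun _ => 0⟩ X := by
    obtain ⟨H, ⟨cd⟩⟩ := exists_cd D.P S
    refine ⟨ty, wg_refl ⟨Y, fun _ => 0⟩, S, phi_closed h.cls, H, cd, t, withLoops t.G t.w, ht,
      tt_wstable t, ?_, t.stab⟩
    obtain ⟨I⟩ := h.imm
    exact red_iso (red_of_imm (g := g) (by omega) hl hst hb (wl_conn (cd_conn cd hPc))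
      (wl_betti_cd cd hPb) (Imm.loop (Imm.quot cd I))) (CIso.symm k)
  obtain ⟨i, -⟩ := hM.2 ⟨Y, fun _ => 0⟩ ⟨ty, wg_refl ⟨Y, fun _ => 0⟩⟩ hcon
  refine ⟨red_iso hY i, ?_⟩
  rw [← Fintype.card_congr i.vEquiv]
  exact hYc

end LD

end TL


namespace TL

/-! ### The path condition -/

namespace LD

abbrev re (D : LD) (p : D.A → Fin 3 × Fin 3) (hp : ∀ a, (p a).1 ≠ (p a).2) : LD where
  T := D.T
  A := D.A
  fA := inferInstance
  dA := inferInstance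
  aV := D.aV
  aP := p
  ne := hp

theorem re_valid {D : LD} (hc : CGraph.Connected D.T) (hc1 : 1 < Fintype.card D.T.V) (hv : D.Valid)
    (p : D.A → Fin 3 × Fin 3)
    (hp : ∀ a, (p a).1 ≠ (p a).2) (t0 : D.T.V) (r1 r2 : D.A) (h1 : D.aV r1 = t0) (h2 : D.aV r2 = t0)
    (h12 : s((p r1).1, (p r1).2) ≠ s((p r2).1, (p r2).2))
    (hpp : ∀ a, CGraph.valence D.T (D.aV a) = 1 → D.aV a ≠ t0 → p a = D.aP a) :
    (D.re p hp).Valid := by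
  refine ⟨?_, ?_, ?_⟩
  · intro t ht
    have h1 := val_pos hc hc1 t
    have ht' : CGraph.valence D.T t = 0 := ht
    omega
  · intro t ht
    have ht' : CGraph.valence D.T t = 1 := ht
    by_cases h : t = t0
    · subst h
      exact ⟨r1, r2, h1, h2, h12⟩
    · obtain ⟨a, b, ha, hb, hab⟩ := hv.v1 t ht'
      refine ⟨a, b, ha, hb, ?_⟩
      show s((p a).1, (p a).2) ≠ s((p b).1, (p b).2)
      rw [hpp a (by rw [ha]; exact ht') (by rw [ha]; exact h),
        hpp b (by rw [hb]; exact ht') (by rw [hb]; exact h)]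
      exact hab
  · intro t ht
    exact hv.v2 t ht

theorem rep_touch {X : CGraph} {D : LD} (hl : Loopless X) (hst : CGraph.IsStable0 X)
    (I : Imm X D.P ∅) {x : X.V} {t : D.T.V} {i : Fin 3} (h : I.rep x = (t, i)) :
    3 ≤ CGraph.valence D.T t +
      (Finset.univ.filter fun a : D.A => D.aV a = t ∧ ((D.aP a).1 = i ∨ (D.aP a).2 = i)).card := by
  rw [← val, ← h]
  have h1 := I.dcut hl x {I.rep x} (fun e he => absurd he (Set.notMem_empty e)) rfl
    (fun y hy hc => hy (I.inj hc))
  have h2 := dcut_le_valence (G := D.P) (I.rep x)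
  have := hst x
  omega

theorem leaf_nbr {T : CGraph} (hT : CGraph.IsTree T) (hc : 3 ≤ Fintype.card T.V)
    (h2 : ∀ v, CGraph.valence T v ≤ 2) :
    ∃ (t0 t1 : T.V) (e0 : T.E), t0 ≠ t1 ∧ CGraph.valence T t0 = 1 ∧ CGraph.valence T t1 = 2 ∧
      ((T.src e0 = t0 ∧ T.tgt e0 = t1) ∨ (T.src e0 = t1 ∧ T.tgt e0 = t0)) := by
  have hll := tree_loopless hT
  obtain ⟨t, ht⟩ : ∃ t, CGraph.valence T t = 1 := by
    obtain ⟨t0⟩ := hT.1.1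
    have h1 := tree_leaves hT (by omega) Finset.univ ⟨t0, Finset.mem_univ _⟩
    have h0 : dcut T ((Finset.univ : Finset T.V) : Set T.V) = 0 := by
      unfold dcut; simp [Crs]
    rw [h0] at h1
    obtain ⟨t, ht⟩ := Finset.card_pos.1 (by omega :
      0 < (Finset.univ.filter fun t => CGraph.valence T t = 1).card)
    exact ⟨t, (Finset.mem_filter.1 ht).2⟩
  have huniq : ∀ t, CGraph.valence T t = 1 → ∀ e e', CGraph.Incident T e t → CGraph.Incident T e' t →
      e = e' := by
    intro t ht e e' he he'
    rw [valence_loopless hll] at ht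
    exact Finset.card_le_one.1 ht.le e (by simp [he]) e' (by simp [he'])
  obtain ⟨e0, he0⟩ : ∃ e, CGraph.Incident T e t := by
    have h := ht
    rw [valence_loopless hll] at h
    obtain ⟨e, he⟩ := Finset.card_pos.1 (by omega : 0 < (Finset.univ.filter fun e : T.E => CGraph.Incident T e t).card)
    exact ⟨e, (Finset.mem_filter.1 he).2⟩
  obtain ⟨u, hu, hends⟩ := other_end he0 (hll e0)
  refine ⟨t, u, e0, hu.symm, ht, ?_, hends⟩
  by_contra hne
  have hp := val_pos hT.1 (by omega) u
  have hu1 : CGraph.valence T u = 1 := by have := h2 u; omega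
  obtain ⟨w, hw⟩ : ∃ w, w ∉ ({t, u} : Finset T.V) := by
    by_contra hcon
    push Not at hcon
    have : Fintype.card T.V ≤ ({t, u} : Finset T.V).card := by
      rw [← Finset.card_univ]
      exact Finset.card_le_card (fun x _ => hcon x)
    have := Finset.card_le_two (a := t) (b := u)
    omega
  simp only [Finset.mem_insert, Finset.mem_singleton, not_or] at hw
  obtain ⟨e, he⟩ := conn_cut hT.1 (W := {x | x = t ∨ x = u}) (u := t) (v := w) (Or.inl rfl)
    (by rintro (h | h); exacts [hw.1 h, hw.2 h])
  have heu : CGraph.Incident T e0 u := by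
    rcases hends with h | h
    · exact Or.inr h.2
    · exact Or.inl h.1
  have hinc : CGraph.Incident T e t ∨ CGraph.Incident T e u := by
    by_contra hcon
    unfold CGraph.Incident at hcon
    push Not at hcon
    apply he
    simp only [Set.mem_ofPred_eq, hcon, or_self]
  have : e = e0 := by
    rcases hinc with h | h
    · exact huniq t ht e e0 h he0
    · exact huniq u hu1 e e0 h heu
  subst this
  apply he
  rcases hends with h | h
  · simp [h.1, h.2]
  · simp [h.1, h.2]

/-- Everything that is kept while repairing the path condition. -/
structure Good (X : CGraph) (g : ℕ) (D : LD) : Prop where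
  tree : CGraph.IsTree D.T
  valid : D.Valid
  cT : Fintype.card D.T.V = g
  cA : Fintype.card D.A = g + 2
  exc : ∀ t, CGraph.valence D.T t + D.nr t = 3
  red : StabReduces0 D.P X

def PathC (D : LD) : Prop := (∀ v : D.T.V, CGraph.valence D.T v ≤ 2) →
    2 ≤ (Finset.univ.filter fun v : D.T.V => CGraph.valence D.T v = 2).card →
    ¬ ∃ p : Sym2 (Fin 3), ∀ a : D.A, CGraph.valence D.T (D.aV a) = 2 →
        s((D.aP a).1, (D.aP a).2) = p

theorem re_good {X : CGraph} {g : ℕ} (hg : 3 ≤ g) (hl : Loopless X) (hst : CGraph.IsStable0 X)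
    (hb : Betti X g) (hX : Fintype.card X.V + 2 = 2 * g) {D : LD} (h : Good X g D)
    (p : D.A → Fin 3 × Fin 3) (hp : ∀ a, (p a).1 ≠ (p a).2) (hv : (D.re p hp).Valid)
    {S : Set (D.re p hp).P.E} (hI : Nonempty (Imm X (D.re p hp).P S)) : Good X g (D.re p hp) := by
  refine ⟨h.tree, hv, h.cT, h.cA, h.exc, ?_⟩
  have hc1 : 1 < Fintype.card (D.re p hp).T.V := by
    have := h.cT
    show 1 < Fintype.card D.T.V
    omega
  exact red_of_imm_max (g := g) (by omega) hl hst hb hX (P_conn h.tree hc1 hv)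
    (P_betti h.tree h.cT h.cA) hI

theorem nr_eq_two {D : LD} {t : D.T.V} (h : D.nr t = 2) {r1 r2 : D.A} (h1 : D.aV r1 = t)
    (h2 : D.aV r2 = t) (hne : r1 ≠ r2) {a : D.A} (ha : D.aV a = t) : a = r1 ∨ a = r2 := by
  have hs : ({r1, r2} : Finset D.A) ⊆ Finset.univ.filter fun a : D.A => D.aV a = t := by
    intro x hx
    simp only [Finset.mem_insert, Finset.mem_singleton] at hx
    rcases hx with rfl | rfl
    · simp [h1]
    · simp [h2]
  have := Finset.eq_of_subset_of_card_le hs (by rw [Finset.card_pair hne]; exact h.le)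
  have hm : a ∈ ({r1, r2} : Finset D.A) := by rw [this]; simp [ha]
  simpa using hm

theorem nr_eq_one {D : LD} {t : D.T.V} (h : D.nr t = 1) {r a : D.A} (h1 : D.aV r = t)
    (ha : D.aV a = t) : a = r :=
  Finset.card_le_one.1 h.le a (by simp [ha]) r (by simp [h1])

/-- First stage: the rungs over a leaf may be moved freely. -/
theorem stage1 {X : CGraph} {g : ℕ} (hg : 3 ≤ g) (hl : Loopless X) (hst : CGraph.IsStable0 X)
    (hb : Betti X g) (hX : Fintype.card X.V + 2 = 2 * g) {D : LD} (h : Good X g D)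
    (t0 : D.T.V) (r1 r2 : D.A) (h1 : D.aV r1 = t0) (h2 : D.aV r2 = t0) (h12 : D.NP r1 r2)
    (hv : CGraph.valence D.T t0 = 1)
    (p : D.A → Fin 3 × Fin 3) (hp : ∀ a, (p a).1 ≠ (p a).2)
    (hp12 : s((p r1).1, (p r1).2) ≠ s((p r2).1, (p r2).2))
    (hpp : ∀ a, a ≠ r1 → a ≠ r2 → p a = D.aP a) : Good X g (D.re p hp) := by
  have hnr : D.nr t0 = 2 := by have := h.exc t0; omega
  have honly : ∀ a, D.aV a = t0 → a = r1 ∨ a = r2 := fun a ha => nr_eq_two hnr h1 h2 h12.ne ha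
  have hc1 : 1 < Fintype.card D.T.V := by have := h.cT; omega
  have hval := re_valid h.tree.1 hc1 h.valid p hp t0 r1 r2 h1 h2 hp12
    (fun a _ ha => hpp a (fun e => ha (e ▸ h1)) (fun e => ha (e ▸ h2)))
  obtain ⟨I⟩ := imm_of_red h.red
  have htouch : ∀ x i, I.rep x = (t0, i) → ((D.aP r1).1 = i ∨ (D.aP r1).2 = i) ∧
      ((D.aP r2).1 = i ∨ (D.aP r2).2 = i) := by
    intro x i hx
    have h3 := rep_touch hl hst I hx
    have h4 : 2 ≤ (Finset.univ.filter fun a : D.A => D.aV a = t0 ∧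
      ((D.aP a).1 = i ∨ (D.aP a).2 = i)).card := by omega
    have hsub : (Finset.univ.filter fun a : D.A => D.aV a = t0 ∧
      ((D.aP a).1 = i ∨ (D.aP a).2 = i)) ⊆ {r1, r2} := by
      intro a ha
      have := honly a (Finset.mem_filter.1 ha).2.1
      simpa using this
    have heq := Finset.eq_of_subset_of_card_le hsub (by rw [Finset.card_pair h12.ne]; exact h4)
    have m1 : r1 ∈ ({r1, r2} : Finset D.A) := by simp
    have m2 : r2 ∈ ({r1, r2} : Finset D.A) := by simp
    rw [← heq] at m1 m2
    exact ⟨(Finset.mem_filter.1 m1).2.2, (Finset.mem_filter.1 m2).2.2⟩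
  have hone : ∀ x y, (I.rep x).1 = t0 → (I.rep y).1 = t0 → x = y := by
    intro x y hx hy
    apply I.inj
    have ex : I.rep x = (t0, (I.rep x).2) := by rw [← hx]
    have ey : I.rep y = (t0, (I.rep y).2) := by rw [← hy]
    rw [ex, ey]
    by_contra hne
    have hne' : (I.rep x).2 ≠ (I.rep y).2 := fun e => hne (by rw [e])
    obtain ⟨a1, a2⟩ := htouch x _ ex
    obtain ⟨b1, b2⟩ := htouch y _ ey
    apply h12
    generalize (I.rep x).2 = i at *
    generalize (I.rep y).2 = j at *
    have c1 : s((D.aP r1).1, (D.aP r1).2) = s(i, j) := by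
      rw [Sym2.eq_iff]
      rcases a1 with rfl | rfl
      · rcases b1 with b | b
        · exact absurd b hne'
        · exact Or.inl ⟨rfl, b⟩
      · rcases b1 with b | b
        · exact Or.inr ⟨b, rfl⟩
        · exact absurd b hne'
    have c2 : s((D.aP r2).1, (D.aP r2).2) = s(i, j) := by
      rw [Sym2.eq_iff]
      rcases a2 with rfl | rfl
      · rcases b2 with b | b
        · exact absurd b hne'
        · exact Or.inl ⟨rfl, b⟩
      · rcases b2 with b | b
        · exact Or.inr ⟨b, rfl⟩
        · exact absurd b hne'
    rw [c1, c2]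
  let S' : Set (D.re p hp).P.E := {q | q = Sum.inr r1 ∨ q = Sum.inr r2}
  have hrow : ∀ i j, SReach (D.re p hp).P S' (t0, i) (t0, j) := by
    intro i j
    rw [sreach_iff]
    intro W hW hi
    have hn : ∀ a, a = r1 ∨ a = r2 → ((t0, (p a).1) ∈ W ↔ (t0, (p a).2) ∈ W) := by
      intro a ha
      have ha0 : D.aV a = t0 := by rcases ha with rfl | rfl <;> assumption
      have hm : (Sum.inr a : (D.re p hp).P.E) ∈ S' := by
        rcases ha with rfl | rfl
        · exact Or.inl rfl
        · exact Or.inr rfl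
      have h' : (D.aV a, (p a).1) ∈ W ↔ (D.aV a, (p a).2) ∈ W := hW (Sum.inr a) hm
      rw [ha0] at h'; exact h'
    exact (np_mixed (hp r1) (hp r2) hp12 (fun k => (t0, k) ∈ W) (hn r1 (Or.inl rfl))
      (hn r2 (Or.inr rfl)) i j).1 hi
  refine re_good hg hl hst hb hX h p hp hval (S := S') ?_
  refine I.transfer (G' := (D.re p hp).P) (fun v => v)
    (fun q => if q = Sum.inr r1 ∨ q = Sum.inr r2 then none else some q) ?_ ?_ ?_ ?_
    (fun v => if v.1 = t0 then (if hx : ∃ x, (I.rep x).1 = t0 then some hx.choose else none)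
      else I.kap v) ?_ ?_
  · intro q hq; exact absurd hq (Set.notMem_empty q)
  · intro q _ hq
    have hq' : q = Sum.inr r1 ∨ q = Sum.inr r2 := by
      by_contra hcon
      simp only [hcon, if_false] at hq
      cases hq
    rcases hq' with rfl | rfl
    · show SReach _ S' (D.aV r1, (D.aP r1).1) (D.aV r1, (D.aP r1).2)
      rw [h1]; exact hrow _ _
    · show SReach _ S' (D.aV r2, (D.aP r2).1) (D.aV r2, (D.aP r2).2)
      rw [h2]; exact hrow _ _
  · intro q q' _ hq
    by_cases hcon : q = Sum.inr r1 ∨ q = Sum.inr r2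
    · simp only [hcon, if_true] at hq
      cases hq
    · simp only [hcon, if_false, Option.some.injEq] at hq
      subst hq
      left
      rcases q with ⟨e, i⟩ | a
      · exact ⟨sreach_refl _, sreach_refl _⟩
      · have : p a = D.aP a := hpp a (fun e => hcon (Or.inl (by rw [e]))) (fun e => hcon (Or.inr (by rw [e])))
        constructor
        · show SReach _ S' (D.aV a, (D.aP a).1) (D.aV a, (p a).1)
          rw [this]; exact sreach_refl _
        · show SReach _ S' (D.aV a, (D.aP a).2) (D.aV a, (p a).2)
          rw [this]; exact sreach_refl _
  · intro a b q' _ _ ha hb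
    by_cases hca : a = Sum.inr r1 ∨ a = Sum.inr r2
    · simp only [hca, if_true] at ha; cases ha
    by_cases hcb : b = Sum.inr r1 ∨ b = Sum.inr r2
    · simp only [hcb, if_true] at hb; cases hb
    simp only [hca, hcb, if_false, Option.some.injEq] at ha hb
    rw [ha, hb]
  · rintro q (rfl | rfl)
    · simp only [h1, if_true]
    · simp only [h2, if_true]
  · intro x
    by_cases hx : (I.rep x).1 = t0
    · have hex : ∃ x, (I.rep x).1 = t0 := ⟨x, hx⟩
      simp only [hx, if_true, hex, dite_true, Option.some.injEq]
      exact hone _ _ hex.choose_spec hx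
    · simp only [hx, if_false]
      exact I.kr x

end LD

end TL


namespace TL

namespace LD

/-- Second stage: a rung over a leaf and the rung over its neighbour are exchanged. -/
theorem stage2 {X : CGraph} {g : ℕ} (hg : 3 ≤ g) (hl : Loopless X) (hst : CGraph.IsStable0 X)
    (hb : Betti X g) (hX : Fintype.card X.V + 2 = 2 * g) {D : LD} (h : Good X g D)
    (t0 t1 : D.T.V) (e0 : D.T.E) (r1 r2 r3 : D.A) (h1 : D.aV r1 = t0) (h2 : D.aV r2 = t0)
    (h3 : D.aV r3 = t1) (h12 : r1 ≠ r2) (h01 : t0 ≠ t1)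
    (hv0 : CGraph.valence D.T t0 = 1) (hv1 : CGraph.valence D.T t1 = 2)
    (he0 : (D.T.src e0 = t0 ∧ D.T.tgt e0 = t1) ∨ (D.T.src e0 = t1 ∧ D.T.tgt e0 = t0))
    (i j k : Fin 3) (hij : i ≠ j) (hik : i ≠ k) (hjk : j ≠ k)
    (a1 : D.aP r1 = (i, k)) (a2 : D.aP r2 = (j, k)) (a3 : D.aP r3 = (i, j))
    (p : D.A → Fin 3 × Fin 3) (hp : ∀ a, (p a).1 ≠ (p a).2)
    (p1 : p r1 = (i, j)) (p3 : p r3 = (i, k))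
    (hpp : ∀ a, a ≠ r1 → a ≠ r3 → p a = D.aP a) : Good X g (D.re p hp) := by
  have h13 : r1 ≠ r3 := fun e => h01 (by rw [← h1, e, h3])
  have h23 : r2 ≠ r3 := fun e => h01 (by rw [← h2, e, h3])
  have p2 : p r2 = (j, k) := by rw [hpp r2 h12.symm h23, a2]
  have hnr0 : D.nr t0 = 2 := by have := h.exc t0; omega
  have hnr1 : D.nr t1 = 1 := by have := h.exc t1; omega
  have honly : ∀ a, D.aV a = t0 → a = r1 ∨ a = r2 := fun a ha => nr_eq_two hnr0 h1 h2 h12 ha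
  have hc1 : 1 < Fintype.card D.T.V := by have := h.cT; omega
  have hp12 : s((p r1).1, (p r1).2) ≠ s((p r2).1, (p r2).2) := by
    rw [p1, p2]
    simp only [ne_eq, Sym2.eq_iff]
    rintro (⟨e, _⟩ | ⟨e, _⟩)
    · exact hij e
    · exact hik e
  have hval := re_valid h.tree.1 hc1 h.valid p hp t0 r1 r2 h1 h2 hp12 (by
    intro a ha hne
    refine hpp a (fun e => hne (e ▸ h1)) ?_
    rintro rfl
    rw [h3, hv1] at ha
    omega)
  obtain ⟨I⟩ := imm_of_red h.red
  have hno0 : ∀ x s, I.rep x = (t0, s) → s = k := by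
    intro x s hx
    have h3' := rep_touch hl hst I hx
    have h4 : 2 ≤ (Finset.univ.filter fun a : D.A => D.aV a = t0 ∧
      ((D.aP a).1 = s ∨ (D.aP a).2 = s)).card := by omega
    have hsub : (Finset.univ.filter fun a : D.A => D.aV a = t0 ∧
      ((D.aP a).1 = s ∨ (D.aP a).2 = s)) ⊆ {r1, r2} := by
      intro a ha
      have := honly a (Finset.mem_filter.1 ha).2.1
      simpa using this
    have heq := Finset.eq_of_subset_of_card_le hsub (by rw [Finset.card_pair h12]; exact h4)
    have m1 : r1 ∈ ({r1, r2} : Finset D.A) := by simp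
    have m2 : r2 ∈ ({r1, r2} : Finset D.A) := by simp
    rw [← heq] at m1 m2
    have b1 := (Finset.mem_filter.1 m1).2.2
    have b2 := (Finset.mem_filter.1 m2).2.2
    rw [a1] at b1
    rw [a2] at b2
    rcases b1 with b1 | b1
    · rcases b2 with b2 | b2
      · exact absurd (b1.trans b2.symm) hij
      · exact b2.symm
    · exact b1.symm
  have hno1 : ∀ x, I.rep x ≠ (t1, k) := by
    intro x hx
    have h3' := rep_touch hl hst I hx
    obtain ⟨a, ha⟩ := Finset.card_pos.1 (by omega : 0 < (Finset.univ.filter fun a : D.A =>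
      D.aV a = t1 ∧ ((D.aP a).1 = k ∨ (D.aP a).2 = k)).card)
    obtain ⟨_, b1, b2⟩ := Finset.mem_filter.1 ha
    have : a = r3 := nr_eq_one hnr1 h3 b1
    subst this
    rw [a3] at b2
    rcases b2 with b2 | b2
    · exact hik b2
    · exact hjk b2
  let S' : Set (D.re p hp).P.E := {q | ∃ s, q = Sum.inl (e0, s)}
  have hcol : ∀ s, SReach (D.re p hp).P S' (t0, s) (t1, s) ∧
      SReach (D.re p hp).P S' (t1, s) (t0, s) := by
    intro s
    have key : ∀ W, Sat (D.re p hp).P S' W → ((t0, s) ∈ W ↔ (t1, s) ∈ W) := by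
      intro W hW
      have h' : (D.T.src e0, s) ∈ W ↔ (D.T.tgt e0, s) ∈ W := hW (Sum.inl (e0, s)) ⟨s, rfl⟩
      rcases he0 with ⟨u, v⟩ | ⟨u, v⟩
      · rwa [u, v] at h'
      · rw [u, v] at h'; exact h'.symm
    exact ⟨sreach_iff.2 fun W hW => (key W hW).1, sreach_iff.2 fun W hW => (key W hW).2⟩
  refine re_good hg hl hst hb hX h p hp hval (S := S') ?_
  let η : D.P.E → Option (D.re p hp).P.E := fun q => match q with
    | Sum.inl (e, s) => if e = e0 then none else some (Sum.inl (e, s))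
    | Sum.inr a => some (Sum.inr (Equiv.swap r1 r3 a))
  refine I.transfer (G' := (D.re p hp).P) (fun v => v) η ?_ ?_ ?_ ?_
    (fun v => if v.1 = t0 ∧ v.2 ≠ k then I.kap (t1, v.2) else
      if v.1 = t1 ∧ v.2 = k then I.kap (t0, k) else I.kap v) ?_ ?_
  · intro q hq; exact absurd hq (Set.notMem_empty q)
  · rintro (⟨e, s⟩ | a) _ hq
    · have hq' : (if e = e0 then none else some (Sum.inl (e, s)) : Option (D.re p hp).P.E) = none := hq
      by_cases hcon : e = e0
      · subst hcon
        show SReach _ S' (D.T.src e, s) (D.T.tgt e, s)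
        rcases he0 with ⟨u, v⟩ | ⟨u, v⟩
        · rw [u, v]; exact (hcol s).1
        · rw [u, v]; exact (hcol s).2
      · rw [if_neg hcon] at hq'; cases hq'
    · cases hq
  · rintro (⟨e, s⟩ | a) q' _ hq
    · have hq' : (if e = e0 then none else some (Sum.inl (e, s)) : Option (D.re p hp).P.E) = some q' := hq
      by_cases hcon : e = e0
      · rw [if_pos hcon] at hq'; cases hq'
      · rw [if_neg hcon] at hq'
        cases hq'
        exact Or.inl ⟨sreach_refl _, sreach_refl _⟩
    · have hq' : some (Sum.inr (Equiv.swap r1 r3 a)) = some q' := hq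
      cases hq'
      left
      show SReach _ S' (D.aV a, (D.aP a).1) (D.aV (Equiv.swap r1 r3 a), (p (Equiv.swap r1 r3 a)).1) ∧
        SReach _ S' (D.aV a, (D.aP a).2) (D.aV (Equiv.swap r1 r3 a), (p (Equiv.swap r1 r3 a)).2)
      by_cases c1 : a = r1
      · subst c1
        rw [Equiv.swap_apply_left, h1, h3, a1, p3]
        exact ⟨(hcol _).1, (hcol _).1⟩
      by_cases c3 : a = r3
      · subst c3
        rw [Equiv.swap_apply_right, h1, h3, a3, p1]
        exact ⟨(hcol _).2, (hcol _).2⟩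
      rw [Equiv.swap_apply_of_ne_of_ne c1 c3, hpp a c1 c3]
      exact ⟨sreach_refl _, sreach_refl _⟩
  · have hex : ∀ (e : D.T.E) s q', η (Sum.inl (e, s)) = some q' → q' = Sum.inl (e, s) := by
      intro e s q' hq
      have hq' : (if e = e0 then none else some (Sum.inl (e, s)) : Option (D.re p hp).P.E) = some q' := hq
      by_cases hcon : e = e0
      · rw [if_pos hcon] at hq'; cases hq'
      · rw [if_neg hcon] at hq'
        cases hq'
        rfl
    have hex2 : ∀ a q', η (Sum.inr a) = some q' → q' = Sum.inr (Equiv.swap r1 r3 a) := by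
      intro a q' hq
      have hq' : some (Sum.inr (Equiv.swap r1 r3 a)) = some q' := hq
      cases hq'
      rfl
    rintro (⟨e, s⟩ | a) (⟨e', s'⟩ | a') q' _ _ ha hb
    · have x1 := hex _ _ _ ha
      have x2 := hex _ _ _ hb
      rw [x1] at x2
      exact x2
    · have x1 := hex _ _ _ ha
      have x2 := hex2 _ _ hb
      rw [x1] at x2
      cases x2
    · have x1 := hex2 _ _ ha
      have x2 := hex _ _ _ hb
      rw [x1] at x2
      cases x2
    · have x1 := hex2 _ _ ha
      have x2 := hex2 _ _ hb
      rw [x1] at x2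
      have := (Equiv.swap r1 r3).injective (Sum.inr.inj x2)
      rw [this]
  · rintro q ⟨s, rfl⟩
    show (if D.T.src e0 = t0 ∧ s ≠ k then I.kap (t1, s) else
      if D.T.src e0 = t1 ∧ s = k then I.kap (t0, k) else I.kap (D.T.src e0, s)) =
      (if D.T.tgt e0 = t0 ∧ s ≠ k then I.kap (t1, s) else
      if D.T.tgt e0 = t1 ∧ s = k then I.kap (t0, k) else I.kap (D.T.tgt e0, s))
    by_cases hs : s = k
    · subst hs
      rcases he0 with ⟨u, v⟩ | ⟨u, v⟩ <;> rw [u, v] <;> simp [h01, h01.symm]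
    · rcases he0 with ⟨u, v⟩ | ⟨u, v⟩ <;> rw [u, v] <;> simp [h01, h01.symm, hs]
  · intro x
    have c0 : ¬ ((I.rep x).1 = t0 ∧ (I.rep x).2 ≠ k) := by
      rintro ⟨u, v⟩
      exact v (hno0 x _ (by rw [← u]))
    have c1 : ¬ ((I.rep x).1 = t1 ∧ (I.rep x).2 = k) := by
      rintro ⟨u, v⟩
      exact hno1 x (by rw [← u, ← v])
    show (if (I.rep x).1 = t0 ∧ (I.rep x).2 ≠ k then I.kap (t1, (I.rep x).2) else
      if (I.rep x).1 = t1 ∧ (I.rep x).2 = k then I.kap (t0, k) else I.kap (I.rep x)) = some x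
    rw [if_neg c0, if_neg c1]
    exact I.kr x

theorem third (i j : Fin 3) : ∃ k, i ≠ k ∧ j ≠ k := by revert i j; decide

theorem path_fix {X : CGraph} {g : ℕ} (hg : 3 ≤ g) (hl : Loopless X) (hst : CGraph.IsStable0 X)
    (hb : Betti X g) (hX : Fintype.card X.V + 2 = 2 * g) {D : LD} (h : Good X g D) :
    ∃ D', Good X g D' ∧ PathC D' := by
  by_cases hP : PathC D
  · exact ⟨D, h, hP⟩
  unfold PathC at hP
  push Not at hP
  obtain ⟨hm, h2, q, hq⟩ := hP
  obtain ⟨t0, t1, e0, h01, hv0, hv1, he0⟩ := leaf_nbr h.tree (by have := h.cT; omega) hm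
  obtain ⟨r1, r2, hr1, hr2, h12⟩ := h.valid.v1 t0 hv0
  obtain ⟨r3, hr3⟩ := h.valid.v2 t1 hv1
  obtain ⟨t2, ht2, h21⟩ := Finset.exists_mem_ne (by omega : 1 < (Finset.univ.filter fun v : D.T.V => CGraph.valence D.T v = 2).card) t1
  have hv2 := (Finset.mem_filter.1 ht2).2
  obtain ⟨r4, hr4⟩ := h.valid.v2 t2 hv2
  have h13 : r1 ≠ r3 := fun e => h01 (by rw [← hr1, e, hr3])
  have h23 : r2 ≠ r3 := fun e => h01 (by rw [← hr2, e, hr3])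
  have h43 : r4 ≠ r3 := fun e => h21 (by rw [← hr4, e, hr3])
  have h20 : t2 ≠ t0 := by
    rintro rfl
    omega
  have h41 : r4 ≠ r1 := fun e => h20 (by rw [← hr4, e, hr1])
  have h42 : r4 ≠ r2 := fun e => h20 (by rw [← hr4, e, hr2])
  obtain ⟨i, j, a3⟩ : ∃ i j, D.aP r3 = (i, j) := ⟨_, _, rfl⟩
  have hij : i ≠ j := by have := D.ne r3; rwa [a3] at this
  obtain ⟨k, hik, hjk⟩ := third i j
  let p : D.A → Fin 3 × Fin 3 := fun a => if a = r1 then (i, k) else if a = r2 then (j, k) else D.aP a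
  have pr1 : p r1 = (i, k) := if_pos rfl
  have pr2 : p r2 = (j, k) := by
    show (if r2 = r1 then (i, k) else if r2 = r2 then (j, k) else D.aP r2) = _
    rw [if_neg h12.ne.symm, if_pos rfl]
  have pr : ∀ a, a ≠ r1 → a ≠ r2 → p a = D.aP a := by
    intro a u v
    show (if a = r1 then (i, k) else if a = r2 then (j, k) else D.aP a) = _
    rw [if_neg u, if_neg v]
  have hp : ∀ a, (p a).1 ≠ (p a).2 := by
    intro a
    by_cases u : a = r1
    · rw [u, pr1]; exact hik
    by_cases v : a = r2
    · rw [v, pr2]; exact hjk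
    rw [pr a u v]; exact D.ne a
  have G1 : Good X g (D.re p hp) := stage1 hg hl hst hb hX h t0 r1 r2 hr1 hr2 h12 hv0 p hp (by
    rw [pr1, pr2]
    simp only [ne_eq, Sym2.eq_iff]
    rintro (⟨e, _⟩ | ⟨e, _⟩)
    · exact hij e
    · exact hik e) pr
  let p' : D.A → Fin 3 × Fin 3 := fun a => if a = r1 then (i, j) else if a = r3 then (i, k) else p a
  have qr1 : p' r1 = (i, j) := if_pos rfl
  have qr3 : p' r3 = (i, k) := by
    show (if r3 = r1 then (i, j) else if r3 = r3 then (i, k) else p r3) = _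
    rw [if_neg h13.symm, if_pos rfl]
  have qr : ∀ a, a ≠ r1 → a ≠ r3 → p' a = p a := by
    intro a u v
    show (if a = r1 then (i, j) else if a = r3 then (i, k) else p a) = _
    rw [if_neg u, if_neg v]
  have hp' : ∀ a, (p' a).1 ≠ (p' a).2 := by
    intro a
    by_cases u : a = r1
    · rw [u, qr1]; exact hij
    by_cases v : a = r3
    · rw [v, qr3]; exact hik
    rw [qr a u v]; exact hp a
  have G2 : Good X g ((D.re p hp).re p' hp') :=
    stage2 hg hl hst hb hX G1 t0 t1 e0 r1 r2 r3 hr1 hr2 hr3 h12.ne h01 hv0 hv1 he0 i j k hij hik hjk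
      pr1 pr2 (by show p r3 = _; rw [pr r3 h13.symm h23.symm, a3]) p' hp' qr1 qr3 qr
  refine ⟨_, G2, ?_⟩
  rintro - - ⟨q', hq'⟩
  have b3 : s((p' r3).1, (p' r3).2) = q' := hq' r3 (by show CGraph.valence D.T (D.aV r3) = 2; rw [hr3]; exact hv1)
  have b4 : s((p' r4).1, (p' r4).2) = q' := hq' r4 (by show CGraph.valence D.T (D.aV r4) = 2; rw [hr4]; exact hv2)
  rw [qr r4 h41 h43, pr r4 h41 h42, hq r4 (by rw [hr4]; exact hv2),
    ← hq r3 (by rw [hr3]; exact hv1), a3, ← b3, qr3] at b4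
  simp only [Sym2.eq_iff] at b4
  rcases b4 with ⟨_, e⟩ | ⟨e, _⟩
  · exact hjk e
  · exact hik e

theorem good_ladder {X : CGraph} {g : ℕ} (hg : 3 ≤ g) {D : LD} (h : Good X g D) (hP : PathC D) :
    IsThreeLadder D.T D.P := by
  have hc1 : 1 < Fintype.card D.T.V := by have := h.cT; omega
  refine ⟨{
    treeT := h.tree
    maxval := fun v => by have := h.exc v; omega
    A := D.A
    vEquiv := Equiv.refl _
    eEquiv := Equiv.refl _
    ends_copy := fun e i => rfl
    aVert := D.aV
    aPair := D.aP
    aPair_ne := D.ne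
    ends_add := fun a => rfl
    count1 := ?_
    nonparallel := ?_
    count2 := ?_
    count3 := ?_
    pathCond := hP }⟩
  · intro v hv
    have h1 : D.nr v = 2 := by have := h.exc v; omega
    exact h1
  · intro a b hab hv
    have hp := val_pos h.tree.1 hc1 (D.aV a)
    have hex := h.exc (D.aV a)
    have hn : 2 ≤ D.nr (D.aV a) := by
      have : ({a, b} : Finset D.A).card ≤ D.nr (D.aV a) := by
        apply Finset.card_le_card
        intro x hx
        simp only [Finset.mem_insert, Finset.mem_singleton] at hx
        rcases hx with rfl | rfl
        · simp
        · simp [hv]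
      rwa [Finset.card_pair hab] at this
    have hv1 : CGraph.valence D.T (D.aV a) = 1 := by omega
    have hn2 : D.nr (D.aV a) = 2 := by omega
    obtain ⟨r1, r2, e1, e2, h12⟩ := h.valid.v1 _ hv1
    have ha := nr_eq_two hn2 e1 e2 h12.ne (a := a) rfl
    have hb := nr_eq_two hn2 e1 e2 h12.ne (a := b) hv.symm
    rcases ha with rfl | rfl
    · rcases hb with rfl | rfl
      · exact absurd rfl hab
      · exact h12
    · rcases hb with rfl | rfl
      · exact fun e => h12 e.symm
      · exact absurd rfl hab
  · intro v hv
    have h1 : D.nr v = 1 := by have := h.exc v; omega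
    exact h1
  · intro v hv
    have h1 : D.nr v = 0 := by have := h.exc v; omega
    exact h1

end LD

end TL


/-- For `g ≥ 3`, a `3`-edge connected trigonal graph of
genus `g` is maximal with respect to trigonal contractions if and only if it
is weightless and is the stabilization of a `3`-ladder over a tree with `g`
vertices. -/
theorem maximal_cells_are_ladders
    (g : ℕ) (hg : 3 ≤ g) (X : WGraph)
    (hX : IsTrigonalGraph X) (hgen : wgenus X.G X.w = g) :
    MaximalTrigonal X ↔
      ((∀ v, X.w v = 0) ∧ CGraph.IsStable0 X.G ∧
        ∃ T H : CGraph, IsThreeLadder T H ∧ Fintype.card T.V = g ∧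
          StabReduces0 H X.G) := by
  constructor
  · intro hM
    have hw := TL.max_w0 hM
    have hl := TL.max_loopless hM
    obtain ⟨t, j, hj⟩ := hX
    have htw : ∀ v, t.w v = 0 := fun v => (hj v).symm.trans (hw _)
    have htec : CGraph.ThreeEdgeConnected X.G := TL.iso_tec j t.threeEC
    have hconn : CGraph.Connected X.G := TL.iso_conn j t.conn
    have hst : CGraph.IsStable0 X.G := TL.CIso.stable j (TL.tt_stable t)
    have hb : TL.Betti X.G g := TL.iso_betti (TL.wl_zero hw) (TL.wg_betti hconn hgen)
    have h2 : 2 ≤ Fintype.card X.G.V := by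
      obtain ⟨x, y, hxy⟩ := TL.tt_two t
      have : 1 < Fintype.card X.G.V :=
        Fintype.one_lt_card_iff.2 ⟨j.vEquiv x, j.vEquiv y, fun e => hxy (j.vEquiv.injective e)⟩
      exact this
    obtain ⟨f, L⟩ := TL.layout_of_type t htw
    obtain ⟨T', f', L', hs⟩ := TL.layout_surj htec hconn.1 _ _ _ rfl (TL.layout_iso j L)
    obtain ⟨D, S, hS⟩ := TL.state_start hg htec hl hst hb h2 L' hs
    obtain ⟨D', S', hS', hc⟩ := TL.LD.split_final hg hS
    obtain ⟨hred, hcard⟩ := TL.LD.max_red hg hM hb hS' hc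
    have hgood : TL.LD.Good X.G g D' :=
      ⟨hS'.tree, hS'.valid, hc, hS'.card, TL.LD.final_exc hg hS' hc, hred⟩
    obtain ⟨D'', hG, hP⟩ := TL.LD.path_fix hg hl hst hb hcard hgood
    exact ⟨hw, hst, D''.T, D''.P, TL.LD.good_ladder hg hG hP, hG.cT, hG.red⟩
  · rintro ⟨hw, hs, h⟩
    exact TL.main_back hg hX hgen hw hs h
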